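/- For every ε > 0 there exists N such that for all n ≥ N there exist a set E₀ of edges of K_n with at least (binom(n,2) − ε·n²) edges and a coloring of the edges in E₀ using at most (6/7 + ε)·n distinct colors such that no set of 5 vertices has 3 or more color repetitions among its colored edges (i.e., the partial coloring has no (5,8)-violation). -/

import Mathlib

/-- The set of colored (non-loop) edges lying inside the vertex set `S`,
for a partial edge-coloring `c` of `K_n`. -/
def coloredEdgesIn {n : ℕ} {C : Type*} (c : Sym2 (Fin n) → Option C) (S : Finset (Fin n)) :
    Set (Sym2 (Fin n)) :=
  {e : Sym2 (Fin n) | e ∈ S.sym2 ∧ ¬ e.IsDiag ∧ (c e).isSome}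

/-- A partial coloring has no `(5,8)`-violation: no set of `5` vertices has
`3` or more color repetitions among its colored edges (the number of repetitions
being the number of colored edges minus the number of distinct colors on them). -/
def NoViolation58 {n : ℕ} {C : Type*} (c : Sym2 (Fin n) → Option C) : Prop :=
  ∀ S : Finset (Fin n), S.card = 5 →
    (coloredEdgesIn c S).ncard ≤ (c '' coloredEdgesIn c S).ncard + 2

set_option linter.unusedSectionVars false
set_option linter.unusedSimpArgs false
set_option linter.unusedVariables false



namespace Five8

open Finset

section Bern
variable {α : Type*} [DecidableEq α]

/-- Expectation over a random subset of `Ω`, each element kept with probability `p`. -/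
noncomputable def ev (p : ℝ) (Ω : Finset α) (f : Finset α → ℝ) : ℝ :=
  ∑ Z ∈ Ω.powerset, p ^ Z.card * (1 - p) ^ (Ω.card - Z.card) * f Z

lemma ev_empty (p : ℝ) (f : Finset α → ℝ) : ev p ∅ f = f ∅ := by
  simp [ev]

lemma ev_insert (p : ℝ) (Ω : Finset α) (a : α) (ha : a ∉ Ω) (f : Finset α → ℝ) :
    ev p (insert a Ω) f = (1 - p) * ev p Ω f + p * ev p Ω (fun Z => f (insert a Z)) := by
  unfold ev
  rw [Finset.sum_powerset_insert ha, Finset.mul_sum, Finset.mul_sum]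
  congr 1
  · apply Finset.sum_congr rfl
    intro Z hZ
    have h1 : Z.card ≤ Ω.card := Finset.card_le_card (Finset.mem_powerset.1 hZ)
    rw [Finset.card_insert_of_notMem ha, show Ω.card + 1 - Z.card = (Ω.card - Z.card) + 1 by omega]
    ring
  · apply Finset.sum_congr rfl
    intro Z hZ
    have h0 : a ∉ Z := fun h => ha (Finset.mem_powerset.1 hZ h)
    rw [Finset.card_insert_of_notMem ha, Finset.card_insert_of_notMem h0,
      show Ω.card + 1 - (Z.card + 1) = (Ω.card - Z.card) by omega]
    ring

lemma ev_congr {p : ℝ} {Ω : Finset α} {f g : Finset α → ℝ} (h : ∀ Z ⊆ Ω, f Z = g Z) :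
    ev p Ω f = ev p Ω g := by
  unfold ev
  apply Finset.sum_congr rfl
  intro Z hZ
  rw [h Z (Finset.mem_powerset.1 hZ)]

lemma ev_mono {p : ℝ} (hp : 0 ≤ p) (hp1 : p ≤ 1) {Ω : Finset α} {f g : Finset α → ℝ}
    (h : ∀ Z ⊆ Ω, f Z ≤ g Z) : ev p Ω f ≤ ev p Ω g := by
  unfold ev
  apply Finset.sum_le_sum
  intro Z hZ
  have := sub_nonneg.2 hp1
  exact mul_le_mul_of_nonneg_left (h Z (Finset.mem_powerset.1 hZ)) (by positivity)

lemma ev_add (p : ℝ) (Ω : Finset α) (f g : Finset α → ℝ) :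
    ev p Ω (fun Z => f Z + g Z) = ev p Ω f + ev p Ω g := by
  simp [ev, mul_add, Finset.sum_add_distrib]

lemma ev_sub (p : ℝ) (Ω : Finset α) (f g : Finset α → ℝ) :
    ev p Ω (fun Z => f Z - g Z) = ev p Ω f - ev p Ω g := by
  simp [ev, mul_sub, Finset.sum_sub_distrib]

lemma ev_mul (p : ℝ) (Ω : Finset α) (c : ℝ) (f : Finset α → ℝ) :
    ev p Ω (fun Z => c * f Z) = c * ev p Ω f := by
  unfold ev
  rw [Finset.mul_sum]
  exact Finset.sum_congr rfl fun _ _ => by ring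

lemma ev_sum {ι : Type*} (p : ℝ) (Ω : Finset α) (s : Finset ι) (f : ι → Finset α → ℝ) :
    ev p Ω (fun Z => ∑ i ∈ s, f i Z) = ∑ i ∈ s, ev p Ω (f i) := by
  unfold ev
  rw [Finset.sum_comm]
  exact Finset.sum_congr rfl fun _ _ => by rw [Finset.mul_sum]

lemma ev_const (p : ℝ) (Ω : Finset α) (c : ℝ) : ev p Ω (fun _ => c) = c := by
  induction Ω using Finset.induction_on with
  | empty => simp [ev]
  | insert a s ha ih => rw [ev_insert p s a ha, ih]; ring

lemma ev_nonneg {p : ℝ} (hp : 0 ≤ p) (hp1 : p ≤ 1) {Ω : Finset α} {f : Finset α → ℝ}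
    (h : ∀ Z ⊆ Ω, 0 ≤ f Z) : 0 ≤ ev p Ω f := by
  have := ev_mono hp hp1 h
  rwa [ev_const] at this

lemma ev_le_one {p : ℝ} (hp : 0 ≤ p) (hp1 : p ≤ 1) {Ω : Finset α} {f : Finset α → ℝ}
    (h : ∀ Z ⊆ Ω, f Z ≤ 1) : ev p Ω f ≤ 1 := by
  have := ev_mono hp hp1 h
  rwa [ev_const] at this

lemma abs_ev_le {p : ℝ} (hp : 0 ≤ p) (hp1 : p ≤ 1) {Ω : Finset α} {f g : Finset α → ℝ}
    (h : ∀ Z ⊆ Ω, |f Z| ≤ g Z) : |ev p Ω f| ≤ ev p Ω g := by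
  rw [abs_le]
  constructor
  · have := ev_mono hp hp1 (f := fun Z => (-1) * g Z) (g := f)
      (fun Z hZ => by have := (abs_le.1 (h Z hZ)).1; linarith)
    rw [ev_mul] at this
    linarith
  · exact ev_mono hp hp1 (fun Z hZ => (abs_le.1 (h Z hZ)).2)

lemma exists_ev_le {p : ℝ} (hp : 0 ≤ p) (hp1 : p ≤ 1) (Ω : Finset α) (f : Finset α → ℝ) :
    ∃ Z ⊆ Ω, ev p Ω f ≤ f Z := by
  by_contra! hcon
  obtain ⟨Z0, hZ0, hmax⟩ := Finset.exists_max_image Ω.powerset f ⟨∅, by simp⟩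
  have h1 := hcon Z0 (Finset.mem_powerset.1 hZ0)
  have h2 := ev_mono hp hp1 (Ω := Ω) (f := f) (g := fun _ => f Z0)
    (fun Z hZ => hmax Z (Finset.mem_powerset.2 hZ))
  rw [ev_const] at h2
  linarith

open Classical in
/-- indicator of a proposition -/
noncomputable def ind (P : Prop) : ℝ := if P then 1 else 0

lemma ind_true {P : Prop} (h : P) : ind P = 1 := by simp [ind, h]
lemma ind_false {P : Prop} (h : ¬ P) : ind P = 0 := by simp [ind, h]
lemma ind_nonneg (P : Prop) : 0 ≤ ind P := by unfold ind; split_ifs <;> norm_num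
lemma ind_le_one (P : Prop) : ind P ≤ 1 := by unfold ind; split_ifs <;> norm_num
lemma ind_mono {P Q : Prop} (h : P → Q) : ind P ≤ ind Q := by
  by_cases hP : P
  · rw [ind_true hP, ind_true (h hP)]
  · rw [ind_false hP]; exact ind_nonneg _
lemma ind_and (P Q : Prop) : ind (P ∧ Q) = ind P * ind Q := by
  unfold ind; by_cases P <;> by_cases Q <;> simp [*]
lemma ind_congr {P Q : Prop} (h : P ↔ Q) : ind P = ind Q := by rw [propext h]
lemma ind_ne {P Q : Prop} (h : ind P ≠ ind Q) : ¬ (P ↔ Q) := fun h' => h (ind_congr h')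
lemma ind_exists_le {ι : Type*} (s : Finset ι) (P : ι → Prop) :
    ind (∃ i ∈ s, P i) ≤ ∑ i ∈ s, ind (P i) := by
  by_cases h : ∃ i ∈ s, P i
  · obtain ⟨i, hi, hP⟩ := h
    calc ind _ ≤ 1 := ind_le_one _
      _ = ind (P i) := (ind_true hP).symm
      _ ≤ _ := Finset.single_le_sum (f := fun i => ind (P i)) (fun j _ => ind_nonneg _) hi
  · rw [ind_false h]; exact Finset.sum_nonneg fun j _ => ind_nonneg _

lemma ind_prod {ι : Type*} (s : Finset ι) (P : ι → Prop) :
    ∏ i ∈ s, ind (P i) = ind (∀ i ∈ s, P i) := by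
  classical
  induction s using Finset.induction_on with
  | empty => simp [ind]
  | insert a s ha ih =>
    rw [Finset.prod_insert ha, ih, ← ind_and]
    apply ind_congr
    simp

/-- forcing a set of coordinates -/
lemma ev_force (p : ℝ) (Ω B : Finset α) (hB : B ⊆ Ω) (f : Finset α → ℝ) :
    ev p Ω (fun Z => ind (B ⊆ Z) * f Z) = p ^ B.card * ev p Ω (fun Z => f (Z ∪ B)) := by
  induction Ω using Finset.induction_on generalizing B f with
  | empty =>
    have : B = ∅ := Finset.subset_empty.1 hB
    subst this
    simp [ev_empty, ind]
  | insert a s ha ih =>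
    rw [ev_insert p s a ha, ev_insert p s a ha]
    by_cases haB : a ∈ B
    · have hB' : B.erase a ⊆ s := by
        intro x hx
        rcases Finset.mem_insert.1 (hB (Finset.mem_of_mem_erase hx)) with h | h
        · exact absurd h (Finset.ne_of_mem_erase hx)
        · exact h
      have e1 : ev p s (fun Z => ind (B ⊆ Z) * f Z) = 0 := by
        rw [ev_congr (g := fun _ => 0), ev_const]
        intro Z hZ
        rw [ind_false (fun h => ha (hZ (h haB))), zero_mul]
      have e2 : ev p s (fun Z => ind (B ⊆ insert a Z) * f (insert a Z))
          = ev p s (fun Z => ind (B.erase a ⊆ Z) * (fun Y => f (insert a Y)) Z) := by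
        apply ev_congr
        intro Z _
        rw [ind_congr (show B ⊆ insert a Z ↔ B.erase a ⊆ Z from Finset.subset_insert_iff)]
      have e3 : ∀ Z, insert a (Z ∪ B.erase a) = Z ∪ B := by
        intro Z; ext x; by_cases hx : x = a
        · subst hx; simp [haB]
        · simp [hx]
      have e4 : ∀ Z, insert a Z ∪ B = Z ∪ B := by
        intro Z; ext x; by_cases hx : x = a
        · subst hx; simp [haB]
        · simp [hx]
      rw [e1, e2, ih _ hB']
      simp only [e3, e4]
      have hc : B.card = (B.erase a).card + 1 := (Finset.card_erase_add_one haB).symm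
      rw [hc]; ring
    · have hB' : B ⊆ s := by
        intro x hx
        rcases Finset.mem_insert.1 (hB hx) with h | h
        · exact absurd (h ▸ hx) haB
        · exact h
      have e2 : ev p s (fun Z => ind (B ⊆ insert a Z) * f (insert a Z))
          = ev p s (fun Z => ind (B ⊆ Z) * (fun Y => f (insert a Y)) Z) := by
        apply ev_congr
        intro Z _
        rw [ind_congr (show B ⊆ insert a Z ↔ B ⊆ Z from Finset.subset_insert_iff_of_notMem haB)]
      rw [ih B hB', e2, ih B hB']
      simp only [Finset.insert_union]
      ring

lemma ev_subset (p : ℝ) (Ω B : Finset α) (hB : B ⊆ Ω) :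
    ev p Ω (fun Z => ind (B ⊆ Z)) = p ^ B.card := by
  have := ev_force p Ω B hB (fun _ => 1)
  simpa [ev_const] using this

lemma ev_subset_le {p : ℝ} (hp : 0 ≤ p) (Ω B : Finset α) :
    ev p Ω (fun Z => ind (B ⊆ Z)) ≤ p ^ B.card := by
  by_cases h : B ⊆ Ω
  · exact (ev_subset p Ω B h).le
  · rw [ev_congr (g := fun _ => 0), ev_const]
    · positivity
    · intro Z hZ; exact ind_false fun h' => h (h'.trans hZ)

lemma ev_two_subset_le {p : ℝ} (hp : 0 ≤ p) (hp1 : p ≤ 1) (Ω Q : Finset α) :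
    ev p Ω (fun Z => ev p Ω (fun Z' => ind (Q ⊆ Z ∪ Z'))) ≤ (2 * p) ^ Q.card := by
  have h1 : ∀ Z Z' : Finset α, ind (Q ⊆ Z ∪ Z') ≤
      ∑ A ∈ Q.powerset, ind (A ⊆ Z) * ind (Q \ A ⊆ Z') := by
    intro Z Z'
    simp only [← ind_and]
    refine le_trans (ind_mono ?_) (ind_exists_le _ _)
    intro h
    refine ⟨Q ∩ Z, by simp, Finset.inter_subset_right, ?_⟩
    intro x hx
    simp only [Finset.mem_sdiff, Finset.mem_inter, not_and] at hx
    rcases Finset.mem_union.1 (h hx.1) with h' | h'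
    · exact absurd h' (hx.2 hx.1)
    · exact h'
  calc _ ≤ ev p Ω (fun Z => ev p Ω (fun Z' =>
        ∑ A ∈ Q.powerset, ind (A ⊆ Z) * ind (Q \ A ⊆ Z'))) :=
        ev_mono hp hp1 fun Z _ => ev_mono hp hp1 fun Z' _ => h1 Z Z'
    _ = ∑ A ∈ Q.powerset, ev p Ω (fun Z' => ind (Q \ A ⊆ Z')) * ev p Ω (fun Z => ind (A ⊆ Z)) := by
        rw [← Finset.sum_congr rfl (fun A _ => ev_mul p Ω _ (fun Z => ind (A ⊆ Z))), ← ev_sum]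
        apply ev_congr
        intro Z _
        rw [ev_sum]
        exact Finset.sum_congr rfl fun A _ => by rw [ev_mul, mul_comm]
    _ ≤ ∑ A ∈ Q.powerset, p ^ Q.card := by
        apply Finset.sum_le_sum
        intro A hA
        have hA' := Finset.mem_powerset.1 hA
        calc _ ≤ p ^ (Q \ A).card * p ^ A.card :=
              mul_le_mul (ev_subset_le hp _ _) (ev_subset_le hp _ _)
                (ev_nonneg hp hp1 fun _ _ => ind_nonneg _) (by positivity)
          _ = _ := by rw [← pow_add, Finset.card_sdiff_add_card_eq_card hA']
    _ = _ := by simp [mul_pow]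

/-- total weight of a family of witnesses -/
noncomputable def wt (p : ℝ) (𝒬 : Finset (Finset α)) : ℝ :=
  ∑ Q ∈ 𝒬, (Q.card : ℝ) * (2 * p) ^ Q.card

set_option maxHeartbeats 1000000 in
lemma cov_le {p : ℝ} (hp : 0 ≤ p) (hp1 : p ≤ 1) (Ω : Finset α) (F G : Finset α → ℝ)
    (hF0 : ∀ Z, 0 ≤ F Z) (hF1 : ∀ Z, F Z ≤ 1) (hG0 : ∀ Z, 0 ≤ G Z) (hG1 : ∀ Z, G Z ≤ 1)
    (𝒬 : Finset (Finset α))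
    (h : ∀ ω ∈ Ω, ∀ Z ⊆ Ω, ∀ Z' ⊆ Ω, ω ∉ Z → ω ∉ Z' → F (insert ω Z) ≠ F Z →
      G (insert ω Z') ≠ G Z' → ∃ Q ∈ 𝒬, ω ∈ Q ∧ Q ⊆ insert ω (Z ∪ Z')) :
    |ev p Ω (fun Z => F Z * G Z) - ev p Ω F * ev p Ω G| ≤ wt p 𝒬 := by
  induction Ω using Finset.induction_on generalizing F G 𝒬 with
  | empty =>
    simp only [ev_empty, sub_self, abs_zero]
    exact Finset.sum_nonneg fun Q _ => by positivity
  | insert a s ha ih =>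
    have hq : 0 ≤ 1 - p := sub_nonneg.2 hp1
    set F1 : Finset α → ℝ := fun Z => F (insert a Z) with hF1def
    set G1 : Finset α → ℝ := fun Z => G (insert a Z) with hG1def
    set 𝒬0 := 𝒬.filter (fun Q => a ∉ Q)
    set 𝒬a := 𝒬.filter (fun Q => a ∈ Q)
    have hs : s ⊆ insert a s := Finset.subset_insert _ _
    have i0 := ih F G hF0 hF1 hG0 hG1 𝒬0 (by
      intro ω hω Z hZ Z' hZ' h1 h2 h3 h4
      obtain ⟨Q, hQ, hωQ, hQs⟩ := h ω (hs hω) Z (hZ.trans hs) Z' (hZ'.trans hs) h1 h2 h3 h4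
      refine ⟨Q, Finset.mem_filter.2 ⟨hQ, fun haQ => ?_⟩, hωQ, hQs⟩
      have := hQs haQ
      simp only [Finset.mem_insert, Finset.mem_union] at this
      rcases this with h | h | h
      · exact ha (h ▸ hω)
      · exact ha (hZ h)
      · exact ha (hZ' h))
    have i1 := ih F1 G1 (fun _ => hF0 _) (fun _ => hF1 _) (fun _ => hG0 _) (fun _ => hG1 _)
      (𝒬.image (fun Q => Q.erase a)) (by
      intro ω hω Z hZ Z' hZ' h1 h2 h3 h4
      have hωa : ω ≠ a := fun h => ha (h ▸ hω)
      obtain ⟨Q, hQ, hωQ, hQs⟩ := h ω (hs hω) (insert a Z) (Finset.insert_subset_insert _ hZ)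
        (insert a Z') (Finset.insert_subset_insert _ hZ')
        (by simp [hωa, h1]) (by simp [hωa, h2])
        (by rw [Finset.insert_comm]; exact h3) (by rw [Finset.insert_comm]; exact h4)
      refine ⟨Q.erase a, Finset.mem_image_of_mem _ hQ, by simp [hωa, hωQ], ?_⟩
      intro x hx
      have h5 := hQs (Finset.mem_of_mem_erase hx)
      have h6 := Finset.ne_of_mem_erase hx
      simp only [Finset.mem_insert, Finset.mem_union] at h5 ⊢
      tauto)
    have h2 : |ev p s F1 - ev p s F| * |ev p s G1 - ev p s G|
        ≤ ∑ Q ∈ 𝒬a, (2 * p) ^ (Q.card - 1) := by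
      have b1 : |ev p s F1 - ev p s F| ≤ ev p s (fun Z => ind (F1 Z ≠ F Z)) := by
        rw [← ev_sub]
        apply abs_ev_le hp hp1
        intro Z _
        by_cases hz : F1 Z = F Z
        · rw [hz, sub_self, abs_zero]; exact ind_nonneg _
        · rw [ind_true hz, abs_le]
          constructor <;> linarith [hF0 Z, hF1 Z, hF0 (insert a Z), hF1 (insert a Z)]
      have b2 : |ev p s G1 - ev p s G| ≤ ev p s (fun Z => ind (G1 Z ≠ G Z)) := by
        rw [← ev_sub]
        apply abs_ev_le hp hp1
        intro Z _
        by_cases hz : G1 Z = G Z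
        · rw [hz, sub_self, abs_zero]; exact ind_nonneg _
        · rw [ind_true hz, abs_le]
          constructor <;> linarith [hG0 Z, hG1 Z, hG0 (insert a Z), hG1 (insert a Z)]
      calc _ ≤ ev p s (fun Z => ind (F1 Z ≠ F Z)) * ev p s (fun Z => ind (G1 Z ≠ G Z)) :=
            mul_le_mul b1 b2 (abs_nonneg _) (ev_nonneg hp hp1 fun _ _ => ind_nonneg _)
        _ = ev p s (fun Z => ev p s (fun Z' => ind (F1 Z ≠ F Z) * ind (G1 Z' ≠ G Z'))) := by
            rw [mul_comm, ← ev_mul]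
            apply ev_congr
            intro Z _
            rw [ev_mul, mul_comm]
        _ ≤ ev p s (fun Z => ev p s (fun Z' => ∑ Q ∈ 𝒬a, ind (Q.erase a ⊆ Z ∪ Z'))) := by
            apply ev_mono hp hp1; intro Z hZ
            apply ev_mono hp hp1; intro Z' hZ'
            rw [← ind_and]
            refine le_trans (ind_mono ?_) (ind_exists_le _ _)
            rintro ⟨h3, h4⟩
            obtain ⟨Q, hQ, hωQ, hQs⟩ := h a (Finset.mem_insert_self _ _) Z (hZ.trans hs) Z'
              (hZ'.trans hs) (fun h => ha (hZ h)) (fun h => ha (hZ' h)) h3 h4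
            exact ⟨Q, Finset.mem_filter.2 ⟨hQ, hωQ⟩, Finset.subset_insert_iff.1 hQs⟩
        _ = ∑ Q ∈ 𝒬a, ev p s (fun Z => ev p s (fun Z' => ind (Q.erase a ⊆ Z ∪ Z'))) := by
            rw [← ev_sum]
            apply ev_congr
            intro Z _
            rw [ev_sum]
        _ ≤ _ := by
            apply Finset.sum_le_sum
            intro Q hQ
            rw [← Finset.card_erase_of_mem (Finset.mem_filter.1 hQ).2]
            exact ev_two_subset_le hp hp1 s _
    have h3 : wt p (𝒬.image (fun Q => Q.erase a)) ≤
        wt p 𝒬0 + ∑ Q ∈ 𝒬a, ((Q.card : ℝ) - 1) * (2 * p) ^ (Q.card - 1) := by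
      unfold wt
      refine le_trans (Finset.sum_image_le_of_nonneg (g := fun Q : Finset α => Q.erase a)
        (f := fun Q : Finset α => (Q.card : ℝ) * (2 * p) ^ Q.card)
        (fun Q _ => by positivity)) ?_
      rw [← Finset.sum_filter_add_sum_filter_not 𝒬 (fun Q => a ∈ Q), add_comm]
      apply le_of_eq
      congr 1
      · apply Finset.sum_congr rfl
        intro Q hQ
        rw [Finset.erase_eq_of_notMem (Finset.mem_filter.1 hQ).2]
      · apply Finset.sum_congr rfl
        intro Q hQ
        have := (Finset.mem_filter.1 hQ).2
        have h1 : 1 ≤ Q.card := Finset.card_pos.2 ⟨a, this⟩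
        rw [Finset.card_erase_of_mem this]
        push_cast [h1]
        ring
    have h4 : wt p 𝒬 = wt p 𝒬0 + ∑ Q ∈ 𝒬a, (Q.card : ℝ) * (2 * p) * (2 * p) ^ (Q.card - 1) := by
      unfold wt
      rw [← Finset.sum_filter_add_sum_filter_not 𝒬 (fun Q => a ∈ Q), add_comm]
      congr 1
      apply Finset.sum_congr rfl
      intro Q hQ
      have h1 : 1 ≤ Q.card := Finset.card_pos.2 ⟨a, (Finset.mem_filter.1 hQ).2⟩
      obtain ⟨k, hk⟩ := Nat.exists_eq_add_of_le' h1
      rw [hk]; simp [pow_succ]; ring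
    set A := ∑ Q ∈ 𝒬a, ((Q.card : ℝ) - 1) * (2 * p) ^ (Q.card - 1) with hA
    set Bs := ∑ Q ∈ 𝒬a, (2 * p) ^ (Q.card - 1) with hBs
    have h5 : ∑ Q ∈ 𝒬a, (Q.card : ℝ) * (2 * p) * (2 * p) ^ (Q.card - 1) = 2 * p * (A + Bs) := by
      rw [hA, hBs, ← Finset.sum_add_distrib, Finset.mul_sum]
      exact Finset.sum_congr rfl fun _ _ => by ring
    have hA0 : 0 ≤ A := by
      apply Finset.sum_nonneg
      intro Q hQ
      have h1 : 1 ≤ Q.card := Finset.card_pos.2 ⟨a, (Finset.mem_filter.1 hQ).2⟩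
      have : (1 : ℝ) ≤ Q.card := by exact_mod_cast h1
      have := sub_nonneg.2 this
      positivity
    have hB0 : 0 ≤ Bs := Finset.sum_nonneg fun Q _ => by positivity
    rw [ev_insert p s a ha, ev_insert p s a ha, ev_insert p s a ha, h4, h5]
    have key : (1 - p) * ev p s (fun Z => F Z * G Z) + p * ev p s (fun Z => F1 Z * G1 Z) -
        ((1 - p) * ev p s F + p * ev p s F1) * ((1 - p) * ev p s G + p * ev p s G1) =
        (1 - p) * (ev p s (fun Z => F Z * G Z) - ev p s F * ev p s G) +
        p * (ev p s (fun Z => F1 Z * G1 Z) - ev p s F1 * ev p s G1) +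
        p * (1 - p) * ((ev p s F1 - ev p s F) * (ev p s G1 - ev p s G)) := by ring
    calc _ = |(1 - p) * (ev p s (fun Z => F Z * G Z) - ev p s F * ev p s G) +
        p * (ev p s (fun Z => F1 Z * G1 Z) - ev p s F1 * ev p s G1) +
        p * (1 - p) * ((ev p s F1 - ev p s F) * (ev p s G1 - ev p s G))| := by rw [← key]
      _ ≤ (1 - p) * wt p 𝒬0 + p * (wt p 𝒬0 + A) + p * (1 - p) * Bs := by
        refine (abs_add_three _ _ _).trans ?_
        rw [abs_mul, abs_mul, abs_mul (p * (1 - p)), abs_mul p (1 - p), abs_of_nonneg hp,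
          abs_of_nonneg hq, abs_mul (ev p s F1 - ev p s F)]
        gcongr
        exact i1.trans h3
      _ ≤ _ := by nlinarith [mul_nonneg hp hB0, mul_nonneg hp hA0, mul_nonneg (mul_nonneg hp hp) hB0]

/-- product version -/
lemma cov_prod_le {p : ℝ} (hp : 0 ≤ p) (hp1 : p ≤ 1) (Ω : Finset α) {ι : Type*} [DecidableEq ι]
    (s : Finset ι) (F : ι → Finset α → ℝ)
    (hF0 : ∀ i Z, 0 ≤ F i Z) (hF1 : ∀ i Z, F i Z ≤ 1)
    (𝒬 : Finset (Finset α))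
    (h : ∀ i ∈ s, ∀ j ∈ s, i ≠ j → ∀ ω ∈ Ω, ∀ Z ⊆ Ω, ∀ Z' ⊆ Ω, ω ∉ Z → ω ∉ Z' →
      F i (insert ω Z) ≠ F i Z →
      F j (insert ω Z') ≠ F j Z' → ∃ Q ∈ 𝒬, ω ∈ Q ∧ Q ⊆ insert ω (Z ∪ Z')) :
    |ev p Ω (fun Z => ∏ i ∈ s, F i Z) - ∏ i ∈ s, ev p Ω (F i)| ≤ s.card * wt p 𝒬 := by
  induction s using Finset.induction_on with
  | empty => simp [ev_const]
  | insert a s ha ih =>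
    have ih' := ih (fun i hi j hj => h i (Finset.mem_insert_of_mem hi) j (Finset.mem_insert_of_mem hj))
    have hP0 : ∀ Z, 0 ≤ ∏ i ∈ s, F i Z := fun Z => Finset.prod_nonneg fun i _ => hF0 i Z
    have hP1 : ∀ Z, ∏ i ∈ s, F i Z ≤ 1 := fun Z =>
      Finset.prod_le_one (fun i _ => hF0 i Z) (fun i _ => hF1 i Z)
    have hc := cov_le hp hp1 Ω (F a) (fun Z => ∏ i ∈ s, F i Z) (hF0 a) (hF1 a) hP0 hP1 𝒬 (by
      intro ω hω Z hZ Z' hZ' h1 h2 h3 h4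
      have : ∃ j ∈ s, F j (insert ω Z') ≠ F j Z' := by
        by_contra! hcon
        exact h4 (Finset.prod_congr rfl hcon)
      obtain ⟨j, hj, h5⟩ := this
      exact h a (Finset.mem_insert_self _ _) j (Finset.mem_insert_of_mem hj)
        (fun h => ha (h ▸ hj)) ω hω Z hZ Z' hZ' h1 h2 h3 h5)
    simp only [Finset.prod_insert ha]
    rw [Finset.card_insert_of_notMem ha]
    have hE0 := ev_nonneg hp hp1 (Ω := Ω) (fun Z _ => hF0 a Z)
    have hE1 := ev_le_one hp hp1 (Ω := Ω) (fun Z _ => hF1 a Z)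
    have e : ev p Ω (fun Z => F a Z * ∏ i ∈ s, F i Z) - ev p Ω (F a) * ∏ i ∈ s, ev p Ω (F i) =
      (ev p Ω (fun Z => F a Z * ∏ i ∈ s, F i Z) - ev p Ω (F a) * ev p Ω (fun Z => ∏ i ∈ s, F i Z))
      + ev p Ω (F a) * (ev p Ω (fun Z => ∏ i ∈ s, F i Z) - ∏ i ∈ s, ev p Ω (F i)) := by ring
    rw [e]
    refine (abs_add_le _ _).trans ?_
    rw [abs_mul, abs_of_nonneg hE0]
    have : ev p Ω (F a) * |ev p Ω (fun Z => ∏ i ∈ s, F i Z) - ∏ i ∈ s, ev p Ω (F i)| ≤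
        1 * (s.card * wt p 𝒬) := mul_le_mul hE1 ih' (abs_nonneg _) zero_le_one
    push_cast
    linarith

/-- invariance under permutations -/
lemma ev_perm (p : ℝ) (Ω : Finset α) (σ : Equiv.Perm α) (hσ : Ω.map σ.toEmbedding = Ω)
    (f : Finset α → ℝ) : ev p Ω (fun Z => f (Z.map σ.toEmbedding)) = ev p Ω f := by
  unfold ev
  refine Finset.sum_bij' (fun Z _ => Z.map σ.toEmbedding) (fun Z _ => Z.map σ.symm.toEmbedding)
    ?_ ?_ ?_ ?_ ?_
  · intro Z hZ
    rw [Finset.mem_powerset] at hZ ⊢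
    rw [← hσ]
    exact Finset.map_subset_map.2 hZ
  · intro Z hZ
    rw [Finset.mem_powerset] at hZ ⊢
    rw [← hσ] at hZ
    intro x hx
    obtain ⟨y, hy, rfl⟩ := Finset.mem_map.1 hx
    obtain ⟨z, hz, h⟩ := Finset.mem_map.1 (hZ hy)
    rw [← h]; simpa using hz
  · intro Z _; ext x; simp
  · intro Z _; ext x; simp
  · intro Z _; simp

end Bern
end Five8


namespace Five8

open Finset

/-- An abstract system of gadgets. -/
structure Sys (G P : Type) [Fintype G] [DecidableEq G] [Fintype P] [DecidableEq P] where
  supp : G → Finset P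
  items : G → Finset (Finset P)
  card_supp : ∀ g, (supp g).card = 9
  item_sub : ∀ g, ∀ v ∈ items g, v ⊆ supp g
  item_card : ∀ g, ∀ v ∈ items g, v.card = 2
  items_card : ∀ g, (items g).card ≤ 19
  count : ∀ X : Finset P, (univ.filter (fun g => supp g ⊆ X)).card ≤ X.card ^ 9

variable {G P : Type} [Fintype G] [DecidableEq G] [Fintype P] [DecidableEq P]

namespace Sys
variable (𝔖 : Sys G P)

/-- union of supports -/
def sp (Γ : Finset G) : Finset P := Γ.biUnion 𝔖.supp

/-- excess -/
def H (Γ : Finset G) : ℤ := ((𝔖.sp Γ).card : ℤ) - 7 * Γ.card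

lemma sp_union (X Y : Finset G) : 𝔖.sp (X ∪ Y) = 𝔖.sp X ∪ 𝔖.sp Y := by
  unfold sp; exact Finset.union_biUnion ..

lemma sp_mono {X Y : Finset G} (h : X ⊆ Y) : 𝔖.sp X ⊆ 𝔖.sp Y :=
  Finset.biUnion_subset_biUnion_of_subset_left _ h

lemma supp_sub_sp {X : Finset G} {g : G} (h : g ∈ X) : 𝔖.supp g ⊆ 𝔖.sp X :=
  Finset.subset_biUnion_of_mem _ h

lemma sp_singleton (g : G) : 𝔖.sp {g} = 𝔖.supp g := by simp [sp]

lemma H_singleton (g : G) : 𝔖.H {g} = 2 := by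
  simp [H, sp_singleton, 𝔖.card_supp]

lemma H_union_le (X Y : Finset G) : 𝔖.H (X ∪ Y) + 𝔖.H (X ∩ Y) ≤ 𝔖.H X + 𝔖.H Y := by
  unfold H
  have h1 := Finset.card_union_add_card_inter X Y
  have h2 := Finset.card_union_add_card_inter (𝔖.sp X) (𝔖.sp Y)
  have h3 : (𝔖.sp (X ∩ Y)).card ≤ (𝔖.sp X ∩ 𝔖.sp Y).card :=
    Finset.card_le_card (Finset.subset_inter (𝔖.sp_mono Finset.inter_subset_left)
      (𝔖.sp_mono Finset.inter_subset_right))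
  rw [sp_union]
  omega

/-- (nontrivial) conflicts -/
def Conf (C : Finset G) : Prop :=
  3 ≤ C.card ∧ C.card ≤ 10 ∧ 𝔖.H C = 2 ∧ ∀ Γ, Γ ⊂ C → 2 ≤ Γ.card → 3 ≤ 𝔖.H Γ

/-- pairs sharing an item -/
def Conf2 (C : Finset G) : Prop :=
  ∃ g g', g ≠ g' ∧ C = {g, g'} ∧ ∃ v ∈ 𝔖.items g, v ∈ 𝔖.items g'

/-- all conflicts -/
def ConfP (C : Finset G) : Prop := 𝔖.Conf C ∨ 𝔖.Conf2 C

lemma sp_pair (g g' : G) : 𝔖.sp {g, g'} = 𝔖.supp g ∪ 𝔖.supp g' := by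
  simp [sp]

lemma ConfP.card_ge {C : Finset G} (h : 𝔖.ConfP C) : 2 ≤ C.card := by
  rcases h with h | ⟨g, g', h1, rfl, _⟩
  · exact le_trans (by norm_num) h.1
  · rw [Finset.card_pair h1]

lemma ConfP.card_le {C : Finset G} (h : 𝔖.ConfP C) : C.card ≤ 10 := by
  rcases h with h | ⟨g, g', h1, rfl, _⟩
  · exact h.2.1
  · rw [Finset.card_pair h1]; norm_num

lemma ConfP.H_le {C : Finset G} (h : 𝔖.ConfP C) : 𝔖.H C ≤ 2 := by
  rcases h with h | ⟨g, g', h1, rfl, v, hv, hv'⟩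
  · exact h.2.2.1.le
  · unfold H
    rw [Finset.card_pair h1, sp_pair]
    have h2 := Finset.card_union_add_card_inter (𝔖.supp g) (𝔖.supp g')
    have h3 : v.card ≤ (𝔖.supp g ∩ 𝔖.supp g').card :=
      Finset.card_le_card (Finset.subset_inter (𝔖.item_sub g v hv) (𝔖.item_sub g' v hv'))
    rw [𝔖.item_card g v hv] at h3
    rw [𝔖.card_supp, 𝔖.card_supp] at h2
    push_cast
    omega

lemma ConfP.H_sub_ge {C Γ : Finset G} (h : 𝔖.ConfP C) (hΓ : Γ ⊂ C) (h2 : 2 ≤ Γ.card) :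
    𝔖.H C + 1 ≤ 𝔖.H Γ := by
  rcases h with h | ⟨g, g', h1, rfl, v, hv, hv'⟩
  · have := h.2.2.2 Γ hΓ h2
    rw [h.2.2.1]; exact this
  · have := Finset.card_lt_card hΓ
    rw [Finset.card_pair h1] at this
    omega

lemma ConfP.H_sub_nonempty {C Γ : Finset G} (h : 𝔖.ConfP C) (hΓ : Γ ⊆ C) (h2 : Γ.Nonempty) :
    𝔖.H C ≤ 𝔖.H Γ := by
  by_cases hc : Γ.card = 1
  · obtain ⟨g, rfl⟩ := Finset.card_eq_one.1 hc
    rw [H_singleton]; exact h.H_le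
  · have h3 := Finset.card_pos.2 h2
    by_cases he : Γ = C
    · rw [he]
    · have := h.H_sub_ge 𝔖 (Finset.ssubset_iff_subset_ne.2 ⟨hΓ, he⟩) (by omega)
      omega

lemma attach_le {C Y : Finset G} (h : 𝔖.ConfP C) (h2 : (C ∩ Y).Nonempty) :
    𝔖.H (C ∪ Y) ≤ 𝔖.H Y := by
  have h1 := 𝔖.H_union_le C Y
  have h3 := h.H_sub_nonempty 𝔖 (Finset.inter_subset_left) h2
  omega

lemma attach_lt {C Y : Finset G} (h : 𝔖.ConfP C) (h2 : 2 ≤ (C ∩ Y).card) (h3 : ¬ C ⊆ Y) :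
    𝔖.H (C ∪ Y) + 1 ≤ 𝔖.H Y := by
  have h1 := 𝔖.H_union_le C Y
  have h3 := h.H_sub_ge 𝔖 (Γ := C ∩ Y) (Finset.ssubset_iff_subset_ne.2
    ⟨Finset.inter_subset_left, fun h => h3 (Finset.inter_eq_left.1 h)⟩) h2
  omega

/-- chains of conflicts -/
inductive Path : G → G → Finset G → Prop
  | nil (g : G) : Path g g {g}
  | cons {g y x : G} {C X : Finset G} (hC : 𝔖.ConfP C) (hg : g ∈ C) (hy : y ∈ C)
      (h : Path y x X) : Path g x (C ∪ X)

lemma Path.start_mem {g x : G} {X : Finset G} (h : 𝔖.Path g x X) : g ∈ X := by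
  cases h with
  | nil => simp
  | cons hC hg hy h => exact Finset.mem_union_left _ hg

lemma Path.end_mem {g x : G} {X : Finset G} (h : 𝔖.Path g x X) : x ∈ X := by
  induction h with
  | nil => simp
  | cons hC hg hy h ih => exact Finset.mem_union_right _ ih

lemma Path.H_start {g x : G} {X : Finset G} (h : 𝔖.Path g x X) (Y : Finset G) (hY : g ∈ Y) :
    𝔖.H (X ∪ Y) ≤ 𝔖.H Y := by
  induction h generalizing Y with
  | nil => rw [Finset.union_eq_right.2 (by simpa using hY)]
  | @cons g y x C X hC hg hy h ih =>
    have h1 := 𝔖.attach_le hC (Y := Y) ⟨g, by simp [hg, hY]⟩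
    have h2 := ih (C ∪ Y) (Finset.mem_union_left _ hy)
    have h3 : C ∪ X ∪ Y = X ∪ (C ∪ Y) := by ext; simp; tauto
    rw [h3]; omega

lemma Path.H_end {g x : G} {X : Finset G} (h : 𝔖.Path g x X) (Y : Finset G) (hY : x ∈ Y) :
    𝔖.H (X ∪ Y) ≤ 𝔖.H Y := by
  induction h generalizing Y with
  | nil => rw [Finset.union_eq_right.2 (by simpa using hY)]
  | @cons g y x C X hC hg hy h ih =>
    have h2 := ih Y hY
    have h1 := 𝔖.attach_le hC (Y := X ∪ Y) ⟨y, by simp [hy, h.start_mem]⟩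
    rw [Finset.union_assoc]; omega

lemma Path.H_le {g x : G} {X : Finset G} (h : 𝔖.Path g x X) : 𝔖.H X ≤ 2 := by
  have h1 := h.H_start 𝔖 {g} (by simp)
  rw [H_singleton, Finset.union_eq_left.2 (by simpa using h.start_mem)] at h1
  exact h1

lemma Path.H_join {g g' x : G} {X X' : Finset G} (h : 𝔖.Path g x X) (h' : 𝔖.Path g' x X') :
    𝔖.H (X ∪ X') ≤ 2 :=
  (h.H_end 𝔖 X' h'.end_mem).trans h'.H_le

end Sys

/-- functions covering small sets -/
lemma exists_cover {P : Type} [DecidableEq P] [Nonempty P] (T : Finset P) (w : ℕ)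
    (h : T.card ≤ w) : ∃ f : Fin w → P, T ⊆ univ.image f := by
  refine ⟨fun k => if hk : k.1 < T.card then (T.equivFin.symm ⟨k.1, hk⟩ : P) else
    Classical.arbitrary P, ?_⟩
  intro x hx
  rw [Finset.mem_image]
  refine ⟨⟨(T.equivFin ⟨x, hx⟩).1, lt_of_lt_of_le (T.equivFin ⟨x, hx⟩).2 h⟩, Finset.mem_univ _, ?_⟩
  simp

namespace Sys
variable (𝔖 : Sys G P)

lemma count_families [Nonempty P] {β : Type} [DecidableEq β] (Ω : Finset β) (π : β → G) (R : ℕ)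
    (hR : ∀ X : Finset P, (Ω.filter (fun b => 𝔖.supp (π b) ⊆ X)).card ≤ R * X.card ^ 9)
    (P₀ : Finset P) (w : ℕ) (ℱ : Finset (Finset β))
    (hℱ : ∀ Q ∈ ℱ, Q ⊆ Ω ∧ (𝔖.sp (Q.image π) \ P₀).card ≤ w) :
    ℱ.card ≤ Fintype.card P ^ w * 2 ^ (R * (P₀.card + w) ^ 9) := by
  have h1 : ℱ ⊆ (univ : Finset (Fin w → P)).biUnion (fun f =>
      (Ω.filter (fun b => 𝔖.supp (π b) ⊆ P₀ ∪ univ.image f)).powerset) := by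
    intro Q hQ
    obtain ⟨hQ1, hQ2⟩ := hℱ Q hQ
    obtain ⟨f, hf⟩ := exists_cover _ w hQ2
    rw [Finset.mem_biUnion]
    refine ⟨f, Finset.mem_univ _, Finset.mem_powerset.2 ?_⟩
    intro b hb
    rw [Finset.mem_filter]
    refine ⟨hQ1 hb, ?_⟩
    intro x hx
    by_cases hx0 : x ∈ P₀
    · exact Finset.mem_union_left _ hx0
    · exact Finset.mem_union_right _ (hf (Finset.mem_sdiff.2
        ⟨𝔖.supp_sub_sp (Finset.mem_image_of_mem π hb) hx, hx0⟩))
  refine (Finset.card_le_card h1).trans ?_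
  refine (Finset.card_biUnion_le_card_mul _ _ (2 ^ (R * (P₀.card + w) ^ 9)) ?_).trans ?_
  · intro f _
    rw [Finset.card_powerset]
    apply Nat.pow_le_pow_right (by norm_num)
    refine (hR _).trans ?_
    apply Nat.mul_le_mul_left
    apply Nat.pow_le_pow_left
    refine (Finset.card_union_le _ _).trans ?_
    have := Finset.card_image_le (s := (univ : Finset (Fin w))) (f := f)
    simp at this
    omega
  · simp

/-- the ground set of the random choice -/
def Om (G : Type) [Fintype G] (R : ℕ) : Finset (G × ℕ) := univ ×ˢ range R

lemma mem_Om {R : ℕ} {x : G × ℕ} : x ∈ Om G R ↔ x.2 < R := by simp [Om]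

lemma count_Om (R : ℕ) (X : Finset P) :
    ((Om G R).filter (fun b => 𝔖.supp b.1 ⊆ X)).card ≤ R * X.card ^ 9 := by
  have : (Om G R).filter (fun b => 𝔖.supp b.1 ⊆ X) =
      (univ.filter (fun g => 𝔖.supp g ⊆ X)) ×ˢ range R := by
    ext b; simp [Om]; tauto
  rw [this, Finset.card_product, Finset.card_range, mul_comm]
  exact Nat.mul_le_mul_left _ (𝔖.count X)

/-- the witness family -/
def Wit (R q : ℕ) (P₀ : Finset P) : Finset (Finset (G × ℕ)) :=
  (Om G R).powerset.filter (fun Q => Q.card ≤ q ∧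
    (𝔖.sp (Q.image Prod.fst) \ P₀).card + 1 ≤ 7 * Q.card)

/-- constant for the weight bound -/
noncomputable def KW (R q b : ℕ) (θ : ℝ) : ℝ :=
  ∑ r ∈ range (q + 1), (r : ℝ) * (2 ^ (R * (b + (7 * r - 1)) ^ 9) * (2 * θ) ^ r)

lemma KW_nonneg (R q b : ℕ) {θ : ℝ} (h : 0 ≤ θ) : 0 ≤ KW R q b θ :=
  Finset.sum_nonneg fun _ _ => by positivity

lemma wt_Wit_le [Nonempty P] (R q b : ℕ) (P₀ : Finset P) (hb : P₀.card ≤ b) {p θ : ℝ} (hp : 0 ≤ p)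
    (hθ : p * (Fintype.card P : ℝ) ^ 7 ≤ θ) :
    wt p (𝔖.Wit R q P₀) ≤ KW R q b θ / Fintype.card P := by
  have hN : (0 : ℝ) < Fintype.card P := by exact_mod_cast Fintype.card_pos
  rw [le_div_iff₀ hN]
  unfold wt KW
  rw [← Finset.sum_fiberwise_of_maps_to (s := 𝔖.Wit R q P₀) (t := range (q + 1)) (g := Finset.card),
    Finset.sum_mul]
  · apply Finset.sum_le_sum
    intro r _
    rcases Nat.eq_zero_or_pos r with hr | hr
    · subst hr
      rw [Finset.sum_eq_zero]
      · simp
      · intro Q hQ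
        rw [(Finset.mem_filter.1 hQ).2]; simp
    have h1 : ∀ Q ∈ (𝔖.Wit R q P₀).filter (fun Q => Q.card = r),
        (Q.card : ℝ) * (2 * p) ^ Q.card = r * (2 * p) ^ r := by
      intro Q hQ
      rw [(Finset.mem_filter.1 hQ).2]
    rw [Finset.sum_congr rfl h1, Finset.sum_const, nsmul_eq_mul]
    have h2 := 𝔖.count_families (Om G R) Prod.fst R (𝔖.count_Om R) P₀ (7 * r - 1)
      ((𝔖.Wit R q P₀).filter (fun Q => Q.card = r)) (by
        intro Q hQ
        simp only [Wit, Finset.mem_filter, Finset.mem_powerset] at hQ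
        refine ⟨hQ.1.1, ?_⟩
        have := hQ.1.2.2
        rw [hQ.2] at this
        omega)
    have h3 : ((((𝔖.Wit R q P₀).filter (fun Q => Q.card = r)).card : ℕ) : ℝ) ≤
        (Fintype.card P : ℝ) ^ (7 * r - 1) * 2 ^ (R * (b + (7 * r - 1)) ^ 9) := by
      refine le_trans (Nat.cast_le.2 h2) ?_
      push_cast
      gcongr
      norm_num
    calc _ ≤ ((Fintype.card P : ℝ) ^ (7 * r - 1) * 2 ^ (R * (b + (7 * r - 1)) ^ 9)) *
          (r * (2 * p) ^ r) * Fintype.card P := by gcongr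
      _ = r * 2 ^ (R * (b + (7 * r - 1)) ^ 9) * ((2 * p) ^ r *
          ((Fintype.card P : ℝ) ^ (7 * r - 1) * Fintype.card P)) := by ring
      _ = r * 2 ^ (R * (b + (7 * r - 1)) ^ 9) * (2 * (p * (Fintype.card P : ℝ) ^ 7)) ^ r := by
          rw [← pow_succ, show 7 * r - 1 + 1 = 7 * r by omega, pow_mul (Fintype.card P : ℝ) 7 r, ← mul_pow, mul_assoc 2]
      _ ≤ r * 2 ^ (R * (b + (7 * r - 1)) ^ 9) * (2 * θ) ^ r := by gcongr
      _ = _ := by ring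
  · intro Q hQ
    simp only [Wit, Finset.mem_filter] at hQ
    simp; omega

end Sys
end Five8


namespace Five8

open Finset

variable {G P : Type} [Fintype G] [DecidableEq G] [Fintype P] [DecidableEq P]

namespace Sys
variable (𝔖 : Sys G P)

/-- `g` can be added to `M` -/
def Compat (M : Finset G) (g : G) : Prop :=
  ∀ C, 𝔖.ConfP C → g ∈ C → ¬ (C.erase g ⊆ M)

/-- `g` is blocked by a nontrivial conflict -/
def Bl (M : Finset G) (g : G) : Prop :=
  ∃ C, 𝔖.Conf C ∧ g ∈ C ∧ C.erase g ⊆ M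

/-- item not covered yet -/
def Alive (M : Finset G) (v : Finset P) : Prop := ∀ g ∈ M, v ∉ 𝔖.items g

open Classical in
/-- the random greedy process -/
noncomputable def Mt (Z : Finset (G × ℕ)) : ℕ → Finset G
  | 0 => ∅
  | i + 1 => Mt Z i ∪ univ.filter (fun g => (g, i) ∈ Z ∧ 𝔖.Compat (Mt Z i) g)

lemma Mt_zero (Z : Finset (G × ℕ)) : 𝔖.Mt Z 0 = ∅ := rfl

lemma mem_Mt_succ {Z : Finset (G × ℕ)} {i : ℕ} {g : G} :
    g ∈ 𝔖.Mt Z (i + 1) ↔ g ∈ 𝔖.Mt Z i ∨ ((g, i) ∈ Z ∧ 𝔖.Compat (𝔖.Mt Z i) g) := by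
  simp [Mt]

lemma mem_Mt {Z : Finset (G × ℕ)} {i : ℕ} {g : G} :
    g ∈ 𝔖.Mt Z i ↔ ∃ j < i, (g, j) ∈ Z ∧ 𝔖.Compat (𝔖.Mt Z j) g := by
  induction i with
  | zero => simp [Mt_zero]
  | succ i ih =>
    rw [mem_Mt_succ, ih]
    constructor
    · rintro (⟨j, hj, h⟩ | h)
      · exact ⟨j, by omega, h⟩
      · exact ⟨i, by omega, h⟩
    · rintro ⟨j, hj, h⟩
      rcases Nat.lt_succ_iff_lt_or_eq.1 hj with h' | rfl
      · exact Or.inl ⟨j, h', h⟩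
      · exact Or.inr h

lemma Mt_mono {Z : Finset (G × ℕ)} {i j : ℕ} (h : i ≤ j) : 𝔖.Mt Z i ⊆ 𝔖.Mt Z j := by
  intro g hg
  rw [mem_Mt] at hg ⊢
  obtain ⟨k, hk, h'⟩ := hg
  exact ⟨k, by omega, h'⟩

lemma Mt_sel {Z : Finset (G × ℕ)} {i : ℕ} {g : G} (h : g ∈ 𝔖.Mt Z i) : g ∈ Z.image Prod.fst := by
  rw [mem_Mt] at h
  obtain ⟨j, _, h, _⟩ := h
  exact Finset.mem_image_of_mem Prod.fst h

lemma Mt_congr {Z Z' : Finset (G × ℕ)} {i : ℕ}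
    (h : ∀ x : G × ℕ, x.2 < i → (x ∈ Z ↔ x ∈ Z')) : 𝔖.Mt Z i = 𝔖.Mt Z' i := by
  induction i with
  | zero => rfl
  | succ i ih =>
    have ih' := ih (fun x hx => h x (by omega))
    ext g
    rw [mem_Mt_succ, mem_Mt_succ, ih', h (g, i) (by simp)]

lemma compat_of_alive {M : Finset G} {g : G} (h1 : ∀ v ∈ 𝔖.items g, 𝔖.Alive M v)
    (h2 : ¬ 𝔖.Bl M g) : 𝔖.Compat M g := by
  intro C hC hg hM
  rcases hC with hC | ⟨a, b, hab, rfl, v, hva, hvb⟩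
  · exact h2 ⟨C, hC, hg, hM⟩
  · simp only [Finset.mem_insert, Finset.mem_singleton] at hg
    rcases hg with rfl | rfl
    · exact h1 v hva b (hM (by simp [hab.symm])) hvb
    · exact h1 v hvb a (hM (by simp [hab])) hva

/-- tracing a difference back -/
lemma trace_Mt (i : ℕ) : ∀ (Z Z' : Finset (G × ℕ)) (x : G), x ∈ 𝔖.Mt Z i → x ∉ 𝔖.Mt Z' i →
    ∃ (y : G) (j : ℕ) (X : Finset G), j < i ∧ 𝔖.Path x y X ∧ X ⊆ (Z ∪ Z').image Prod.fst ∧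
      ¬ ((y, j) ∈ Z ↔ (y, j) ∈ Z') ∧ X.card ≤ 10 * i := by
  induction i using Nat.strong_induction_on with
  | _ i ih =>
    intro Z Z' x hx hx'
    obtain ⟨j, hj, hxZ, hc⟩ := 𝔖.mem_Mt.1 hx
    by_cases hxZ' : (x, j) ∈ Z'
    · have hnc : ¬ 𝔖.Compat (𝔖.Mt Z' j) x := fun h => hx' (𝔖.mem_Mt.2 ⟨j, hj, hxZ', h⟩)
      unfold Compat at hnc
      push Not at hnc
      obtain ⟨C, hC, hxC, hCs⟩ := hnc
      have h1 := hc C hC hxC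
      obtain ⟨y, hy, hyn⟩ := Finset.not_subset.1 h1
      obtain ⟨z, k, X, hk, hp, hX, hd, hXc⟩ := ih j hj Z' Z y (hCs hy) hyn
      refine ⟨z, k, C ∪ X, by omega, Path.cons hC hxC (Finset.mem_of_mem_erase hy) hp, ?_, ?_, ?_⟩
      · apply Finset.union_subset
        · intro w hw
          by_cases hwx : w = x
          · rw [hwx]
            exact Finset.mem_image.2 ⟨(x, j), Finset.mem_union_left _ hxZ, rfl⟩
          · have := 𝔖.Mt_sel (hCs (Finset.mem_erase.2 ⟨hwx, hw⟩))
            rw [Finset.image_union]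
            exact Finset.mem_union_right _ this
        · rw [Finset.union_comm]; exact hX
      · tauto
      · have := Finset.card_union_le C X
        have := hC.card_le
        omega
    · refine ⟨x, j, {x}, hj, Path.nil x, ?_, by tauto, by simp; omega⟩
      simp only [Finset.singleton_subset_iff]
      exact Finset.mem_image.2 ⟨(x, j), Finset.mem_union_left _ hxZ, rfl⟩

/-- symmetric form -/
lemma trace_Mt' (i : ℕ) (Z Z' : Finset (G × ℕ)) (x : G) (h : ¬ (x ∈ 𝔖.Mt Z i ↔ x ∈ 𝔖.Mt Z' i)) :
    ∃ (y : G) (j : ℕ) (X : Finset G), j < i ∧ 𝔖.Path x y X ∧ X ⊆ (Z ∪ Z').image Prod.fst ∧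
      ¬ ((y, j) ∈ Z ↔ (y, j) ∈ Z') ∧ X.card ≤ 10 * i := by
  by_cases h1 : x ∈ 𝔖.Mt Z i
  · exact 𝔖.trace_Mt i Z Z' x h1 (by tauto)
  · obtain ⟨y, j, X, h2, h3, h4, h5, h6⟩ := 𝔖.trace_Mt i Z' Z x (by tauto) h1
    exact ⟨y, j, X, h2, h3, by rwa [Finset.union_comm], by tauto, h6⟩

lemma trace_alive {i : ℕ} {Z Z' : Finset (G × ℕ)} {v : Finset P}
    (h : ¬ (𝔖.Alive (𝔖.Mt Z i) v ↔ 𝔖.Alive (𝔖.Mt Z' i) v)) :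
    ∃ (x y : G) (j : ℕ) (X : Finset G), v ∈ 𝔖.items x ∧ j < i ∧ 𝔖.Path x y X ∧
      X ⊆ (Z ∪ Z').image Prod.fst ∧
      ¬ ((y, j) ∈ Z ↔ (y, j) ∈ Z') ∧ X.card ≤ 10 * i := by
  have : ∃ x, v ∈ 𝔖.items x ∧ ¬ (x ∈ 𝔖.Mt Z i ↔ x ∈ 𝔖.Mt Z' i) := by
    by_contra! hcon
    apply h
    unfold Alive
    constructor
    · intro h1 g hg hv
      exact h1 g ((hcon g hv).2 hg) hv
    · intro h1 g hg hv
      exact h1 g ((hcon g hv).1 hg) hv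
  obtain ⟨x, hv, hx⟩ := this
  obtain ⟨y, j, X, h⟩ := 𝔖.trace_Mt' i Z Z' x hx
  exact ⟨x, y, j, X, hv, h⟩

/-- generic: conflicts through `e` of a kind -/
lemma trace_block (D : Finset G → Prop) {i : ℕ} {Z Z' : Finset (G × ℕ)} {e : G}
    (h : ¬ ((∃ C, D C ∧ e ∈ C ∧ C.erase e ⊆ 𝔖.Mt Z i) ↔
      (∃ C, D C ∧ e ∈ C ∧ C.erase e ⊆ 𝔖.Mt Z' i))) :
    ∃ (C : Finset G) (x y : G) (j : ℕ) (X : Finset G), D C ∧ e ∈ C ∧ x ∈ C ∧ x ≠ e ∧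
      C.erase e ⊆ (Z ∪ Z').image Prod.fst ∧ j < i ∧ 𝔖.Path x y X ∧
      X ⊆ (Z ∪ Z').image Prod.fst ∧
      ¬ ((y, j) ∈ Z ↔ (y, j) ∈ Z') ∧ X.card ≤ 10 * i := by
  have key : ∃ C x, D C ∧ e ∈ C ∧ x ∈ C.erase e ∧ C.erase e ⊆ (Z ∪ Z').image Prod.fst ∧
      ¬ (x ∈ 𝔖.Mt Z i ↔ x ∈ 𝔖.Mt Z' i) := by
    by_contra! hcon
    apply h
    constructor
    · rintro ⟨C, hD, he, hC⟩
      refine ⟨C, hD, he, fun x hx => ?_⟩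
      refine (hcon C x hD he hx ?_).1 (hC hx)
      intro w hw
      rw [Finset.image_union]
      exact Finset.mem_union_left _ (𝔖.Mt_sel (hC hw))
    · rintro ⟨C, hD, he, hC⟩
      refine ⟨C, hD, he, fun x hx => ?_⟩
      refine (hcon C x hD he hx ?_).2 (hC hx)
      intro w hw
      rw [Finset.image_union]
      exact Finset.mem_union_right _ (𝔖.Mt_sel (hC hw))
  obtain ⟨C, x, hD, he, hx, hs, hn⟩ := key
  obtain ⟨y, j, X, h1⟩ := 𝔖.trace_Mt' i Z Z' x hn
  exact ⟨C, x, y, j, X, hD, he, Finset.mem_of_mem_erase hx, Finset.ne_of_mem_erase hx, hs, h1⟩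

lemma compat_iff {M : Finset G} {g : G} : 𝔖.Compat M g ↔
    ¬ ∃ C, 𝔖.ConfP C ∧ g ∈ C ∧ C.erase g ⊆ M := by
  unfold Compat; push Not; rfl

/-- path form, common to `Compat` and `Bl` -/
lemma trace_root (D : Finset G → Prop) (hD : ∀ C, D C → 𝔖.ConfP C)
    {i : ℕ} {Z Z' : Finset (G × ℕ)} {e : G}
    (h : ¬ ((∃ C, D C ∧ e ∈ C ∧ C.erase e ⊆ 𝔖.Mt Z i) ↔
      (∃ C, D C ∧ e ∈ C ∧ C.erase e ⊆ 𝔖.Mt Z' i))) :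
    ∃ (y : G) (j : ℕ) (X : Finset G), j < i ∧ 𝔖.Path e y X ∧
      X.erase e ⊆ (Z ∪ Z').image Prod.fst ∧ y ∈ (Z ∪ Z').image Prod.fst ∧
      ¬ ((y, j) ∈ Z ↔ (y, j) ∈ Z') ∧ X.card ≤ 10 * i + 10 := by
  obtain ⟨C, x, y, j, X, h1, h2, h3, h4, h5, h6, h7, h8, h9, h10⟩ := 𝔖.trace_block D h
  refine ⟨y, j, C ∪ X, h6, Path.cons (hD C h1) h2 h3 h7, ?_, h8 h7.end_mem, h9, ?_⟩
  · rw [Finset.erase_union_distrib]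
    exact Finset.union_subset h5 ((Finset.erase_subset _ _).trans h8)
  · have := Finset.card_union_le C X
    have := (hD C h1).card_le
    omega

end Sys
end Five8


namespace Five8

open Finset

variable {G P : Type} [Fintype G] [DecidableEq G] [Fintype P] [DecidableEq P]

lemma lift_sel (S : Finset (G × ℕ)) (W : Finset G) (hW : W ⊆ S.image Prod.fst) :
    ∃ Q ⊆ S, Q.image Prod.fst = W ∧ Q.card = W.card := by
  have : ∀ g, ∃ x : G × ℕ, g ∈ W → x ∈ S ∧ x.1 = g := by
    intro g
    by_cases hg : g ∈ W
    · obtain ⟨x, hx, rfl⟩ := Finset.mem_image.1 (hW hg)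
      exact ⟨x, fun _ => ⟨hx, rfl⟩⟩
    · exact ⟨(g, 0), fun h => absurd h hg⟩
  choose f hf using this
  refine ⟨W.image f, ?_, ?_, ?_⟩
  · intro x hx
    obtain ⟨g, hg, rfl⟩ := Finset.mem_image.1 hx
    exact (hf g hg).1
  · ext g
    simp only [Finset.mem_image, exists_exists_and_eq_and]
    constructor
    · rintro ⟨g', h, h'⟩
      rw [(hf g' h).2] at h'
      exact h' ▸ h
    · intro h
      exact ⟨g, h, (hf g h).2⟩
  · apply Finset.card_image_of_injOn
    intro g hg g' hg' h
    rw [← (hf g hg).2, ← (hf g' hg').2]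
    exact congrArg Prod.fst h

lemma lift_sel' (S : Finset (G × ℕ)) (W : Finset G) (hW : W ⊆ S.image Prod.fst) (ω : G × ℕ)
    (hω : ω ∈ S) (hωW : ω.1 ∈ W) :
    ∃ Q ⊆ S, ω ∈ Q ∧ Q.image Prod.fst = W ∧ Q.card = W.card := by
  obtain ⟨Q, h1, h2, h3⟩ := lift_sel S (W.erase ω.1) ((Finset.erase_subset _ _).trans hW)
  have hωQ : ω ∉ Q := by
    intro h
    have : ω.1 ∈ W.erase ω.1 := by
      rw [← h2]; exact Finset.mem_image_of_mem Prod.fst h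
    simp at this
  refine ⟨insert ω Q, Finset.insert_subset hω h1, Finset.mem_insert_self _ _, ?_, ?_⟩
  · rw [Finset.image_insert, h2, Finset.insert_erase hωW]
  · rw [Finset.card_insert_of_notMem hωQ, h3, Finset.card_erase_add_one hωW]

lemma pivot_eq {ω z : G × ℕ} {Z : Finset (G × ℕ)} (hω : ω ∉ Z)
    (h : ¬ (z ∈ insert ω Z ↔ z ∈ Z)) : z = ω := by
  by_contra hne
  exact h (by simp [hne])

lemma image_pivot (ω : G × ℕ) (Z : Finset (G × ℕ)) : insert ω Z ∪ Z = insert ω Z := by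
  ext; simp

namespace Sys
variable (𝔖 : Sys G P)

lemma gain1 {e : G} {U : Finset G} (he : e ∈ U) (h : 𝔖.H U ≤ 2) :
    (𝔖.sp U \ 𝔖.supp e).card + 1 ≤ 7 * U.card := by
  have h1 := Finset.card_sdiff_add_card_eq_card (𝔖.supp_sub_sp he)
  rw [𝔖.card_supp] at h1
  unfold H at h
  omega

lemma gain2 {e : G} {U : Finset G} {T : Finset P} (hT1 : T ⊆ 𝔖.sp U) (hT2 : T ⊆ 𝔖.supp e)
    (hT : 3 ≤ T.card) (h : 𝔖.H U ≤ 2) :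
    (𝔖.sp U \ 𝔖.supp e).card + 1 ≤ 7 * U.card := by
  have h1 := Finset.card_sdiff_add_card_inter (𝔖.sp U) (𝔖.supp e)
  have h2 := Finset.card_le_card (Finset.subset_inter hT1 hT2)
  unfold H at h
  omega

lemma gain3 {e : G} {U : Finset G} (he : e ∈ U) (h : 𝔖.H U ≤ 1) :
    (𝔖.sp (U.erase e) \ 𝔖.supp e).card + 1 ≤ 7 * (U.erase e).card := by
  have h1 := Finset.card_sdiff_add_card_eq_card (𝔖.supp_sub_sp he)
  have h2 : (𝔖.sp (U.erase e) \ 𝔖.supp e).card ≤ (𝔖.sp U \ 𝔖.supp e).card :=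
    Finset.card_le_card (Finset.sdiff_subset_sdiff (𝔖.sp_mono (Finset.erase_subset _ _)) le_rfl)
  have h3 := Finset.card_erase_add_one he
  rw [𝔖.card_supp] at h1
  unfold H at h
  omega

lemma gain4 {C U W : Finset G} (hC : 𝔖.Conf C) (hU : 𝔖.H U ≤ 2) (h2 : 2 ≤ (U ∩ C).card)
    (hWU : W ⊆ U) (hUW : U \ C ⊆ W) (h3 : C ⊆ U → (W ∩ C).Nonempty) :
    (𝔖.sp W \ 𝔖.sp C).card + 1 ≤ 7 * W.card := by
  have a1 : (𝔖.sp W \ 𝔖.sp C).card ≤ (𝔖.sp (U ∪ C) \ 𝔖.sp C).card :=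
    Finset.card_le_card (Finset.sdiff_subset_sdiff (𝔖.sp_mono
      (hWU.trans Finset.subset_union_left)) le_rfl)
  have a2 := Finset.card_sdiff_add_card_eq_card (𝔖.sp_mono
    (Finset.subset_union_right (s₁ := U) (s₂ := C)))
  have a3 : (U ∪ C).card = (U \ C).card + C.card := (Finset.card_sdiff_add_card U C).symm
  have a4 := 𝔖.H_union_le U C
  have a5 : 𝔖.H C = 2 := hC.2.2.1
  have a6 := Finset.card_le_card hUW
  by_cases hs : C ⊆ U
  · have b1 : U ∩ C = C := Finset.inter_eq_right.2 hs
    rw [b1] at a4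
    obtain ⟨x, hx⟩ := h3 hs
    have b2 : (U \ C).card + 1 ≤ W.card := by
      have : insert x (U \ C) ⊆ W := Finset.insert_subset (Finset.mem_inter.1 hx).1 hUW
      have h := Finset.card_le_card this
      rwa [Finset.card_insert_of_notMem (by simp [(Finset.mem_inter.1 hx).2])] at h
    unfold H at a4 a5 hU
    omega
  · have b1 := hC.2.2.2 (U ∩ C) (Finset.ssubset_iff_subset_ne.2
      ⟨Finset.inter_subset_right, fun h => hs (Finset.inter_eq_right.1 h)⟩) h2
    unfold H at a4 a5 hU b1
    omega

/-- building a witness -/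
lemma mk_wit {R q : ℕ} {P₀ : Finset P} {S : Finset (G × ℕ)} (hS : S ⊆ Om G R) {W : Finset G}
    (hW : W ⊆ S.image Prod.fst) {ω : G × ℕ} (hω : ω ∈ S) (hωW : ω.1 ∈ W) (hq : W.card ≤ q)
    (h : (𝔖.sp W \ P₀).card + 1 ≤ 7 * W.card) : ∃ Q ∈ 𝔖.Wit R q P₀, ω ∈ Q ∧ Q ⊆ S := by
  obtain ⟨Q, h1, h2, h3, h4⟩ := lift_sel' S W hW ω hω hωW
  refine ⟨Q, ?_, h2, h1⟩
  simp only [Wit, Finset.mem_filter, Finset.mem_powerset]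
  exact ⟨h1.trans hS, by omega, by rw [h3, h4]; exact h⟩

lemma mk_wit0 {R q : ℕ} {P₀ : Finset P} {S : Finset (G × ℕ)} (hS : S ⊆ Om G R) {W : Finset G}
    (hW : W ⊆ S.image Prod.fst) (hq : W.card ≤ q)
    (h : (𝔖.sp W \ P₀).card + 1 ≤ 7 * W.card) : ∃ Q ∈ 𝔖.Wit R q P₀, Q ⊆ S := by
  obtain ⟨Q, h1, h3, h4⟩ := lift_sel S W hW
  refine ⟨Q, ?_, h1⟩
  simp only [Wit, Finset.mem_filter, Finset.mem_powerset]
  exact ⟨h1.trans hS, by omega, by rw [h3, h4]; exact h⟩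

/-- item-item link -/
lemma link_items {R i : ℕ} (hi : i ≤ R) {e : G} {v v' : Finset P} (hv : v ∈ 𝔖.items e)
    (hv' : v' ∈ 𝔖.items e) (hne : v ≠ v') {ω : G × ℕ} {Z Z' : Finset (G × ℕ)}
    (hω : ω ∈ Om G R) (hZ : Z ⊆ Om G R) (hZ' : Z' ⊆ Om G R) (hωZ : ω ∉ Z) (hωZ' : ω ∉ Z')
    (h : ¬ (𝔖.Alive (𝔖.Mt (insert ω Z) i) v ↔ 𝔖.Alive (𝔖.Mt Z i) v))
    (h' : ¬ (𝔖.Alive (𝔖.Mt (insert ω Z') i) v' ↔ 𝔖.Alive (𝔖.Mt Z' i) v')) :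
    ∃ Q ∈ 𝔖.Wit R (20 * R + 20) (𝔖.supp e), ω ∈ Q ∧ Q ⊆ insert ω (Z ∪ Z') := by
  obtain ⟨x, y, j, X, a1, a2, a3, a4, a5, a6⟩ := 𝔖.trace_alive h
  obtain ⟨x', y', j', X', b1, b2, b3, b4, b5, b6⟩ := 𝔖.trace_alive h'
  have c1 := pivot_eq hωZ a5
  have c2 := pivot_eq hωZ' b5
  rw [image_pivot] at a4 b4
  have c3 : y = ω.1 := by rw [← c1]
  have c4 : y' = ω.1 := by rw [← c2]
  subst c3; subst c4
  have hH := a3.H_join 𝔖 b3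
  have hcu := Finset.card_union_le X X'
  apply 𝔖.mk_wit (W := X ∪ X') (Finset.insert_subset hω (Finset.union_subset hZ hZ'))
  · apply Finset.union_subset
    · refine a4.trans (Finset.image_subset_image ?_)
      exact Finset.insert_subset_insert _ Finset.subset_union_left
    · refine b4.trans (Finset.image_subset_image ?_)
      exact Finset.insert_subset_insert _ Finset.subset_union_right
  · simp
  · exact Finset.mem_union_left _ a3.end_mem
  · omega
  · apply 𝔖.gain2 (T := v ∪ v') _ _ _ hH
    · apply Finset.union_subset
      · exact (𝔖.item_sub x v a1).trans (𝔖.supp_sub_sp (Finset.mem_union_left _ a3.start_mem))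
      · exact (𝔖.item_sub x' v' b1).trans (𝔖.supp_sub_sp (Finset.mem_union_right _ b3.start_mem))
    · exact Finset.union_subset (𝔖.item_sub e v hv) (𝔖.item_sub e v' hv')
    · by_contra hcon
      have d1 := 𝔖.item_card e v hv
      have d2 := 𝔖.item_card e v' hv'
      have d3 : v = v ∪ v' := Finset.eq_of_subset_of_card_le Finset.subset_union_left (by omega)
      have d4 : v' = v ∪ v' := Finset.eq_of_subset_of_card_le Finset.subset_union_right (by omega)
      exact hne (d3.trans d4.symm)

/-- item-block link -/
lemma link_block {R i : ℕ} (hi : i ≤ R) {e : G} {v : Finset P} (hv : v ∈ 𝔖.items e)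
    {ω : G × ℕ} {Z Z' : Finset (G × ℕ)}
    (hω : ω ∈ Om G R) (hZ : Z ⊆ Om G R) (hZ' : Z' ⊆ Om G R) (hωZ : ω ∉ Z) (hωZ' : ω ∉ Z')
    (h : ¬ (𝔖.Alive (𝔖.Mt (insert ω Z) i) v ↔ 𝔖.Alive (𝔖.Mt Z i) v))
    (h' : ¬ (𝔖.Bl (𝔖.Mt (insert ω Z') i) e ↔ 𝔖.Bl (𝔖.Mt Z' i) e)) :
    ∃ Q ∈ 𝔖.Wit R (20 * R + 20) (𝔖.supp e), ω ∈ Q ∧ Q ⊆ insert ω (Z ∪ Z') := by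
  obtain ⟨x, y, j, X, a1, a2, a3, a4, a5, a6⟩ := 𝔖.trace_alive h
  obtain ⟨C, x', y', j', X', b1, b2, b3, b4, b5, b6, b7, b8, b9, b10⟩ := 𝔖.trace_block 𝔖.Conf h'
  have c1 := pivot_eq hωZ a5
  have c2 := pivot_eq hωZ' b9
  rw [image_pivot] at a4 b5 b8
  have c3 : y = ω.1 := by rw [← c1]
  have c4 : y' = ω.1 := by rw [← c2]
  subst c3; subst c4
  have hCP : 𝔖.ConfP C := Or.inl b1
  have hH := a3.H_join 𝔖 b7
  have hcu := Finset.card_union_le X X'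
  have hcu2 := Finset.card_union_le C (X ∪ X')
  have hCc := b1.2.1
  set S := insert ω (Z ∪ Z') with hSdef
  have hS : S ⊆ Om G R := Finset.insert_subset hω (Finset.union_subset hZ hZ')
  have s1 : (insert ω Z).image Prod.fst ⊆ S.image Prod.fst :=
    Finset.image_subset_image (Finset.insert_subset_insert _ Finset.subset_union_left)
  have s2 : (insert ω Z').image Prod.fst ⊆ S.image Prod.fst :=
    Finset.image_subset_image (Finset.insert_subset_insert _ Finset.subset_union_right)
  set U := C ∪ (X ∪ X') with hU
  have hXU : X ∪ X' ⊆ U := Finset.subset_union_right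
  have heU : e ∈ U := Finset.mem_union_left _ b2
  have hωU : ω.1 ∈ X ∪ X' := Finset.mem_union_left _ a3.end_mem
  have hXS : X ∪ X' ⊆ S.image Prod.fst := Finset.union_subset (a4.trans s1) (b8.trans s2)
  have hUS : U.erase e ⊆ S.image Prod.fst := by
    rw [hU, Finset.erase_union_distrib]
    exact Finset.union_subset (b5.trans s2) ((Finset.erase_subset _ _).trans hXS)
  have hx'U : x' ∈ X ∪ X' := Finset.mem_union_right _ b7.start_mem
  by_cases heS : e ∈ S.image Prod.fst
  · apply 𝔖.mk_wit (W := U) hS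
    · rw [← Finset.insert_erase heU]
      exact Finset.insert_subset heS hUS
    · simp [hSdef]
    · exact hXU hωU
    · omega
    · apply 𝔖.gain1 heU
      exact (𝔖.attach_le hCP ⟨x', Finset.mem_inter.2 ⟨b3, hx'U⟩⟩).trans hH
  · have heX : e ∉ X ∪ X' := fun h => heS (hXS h)
    apply 𝔖.mk_wit (W := U.erase e) hS hUS
    · simp [hSdef]
    · exact Finset.mem_erase.2 ⟨fun h => heX (h ▸ hωU), hXU hωU⟩
    · have := Finset.card_erase_le (s := U) (a := e)
      omega
    · apply 𝔖.gain3 heU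
      -- the excess drops
      have k0 : (insert e (X ∪ X')).card = (X ∪ X').card + 1 := Finset.card_insert_of_notMem heX
      have k1 : 𝔖.sp (insert e (X ∪ X')) = 𝔖.supp e ∪ 𝔖.sp (X ∪ X') := by
        unfold sp; rw [Finset.biUnion_insert]
      have k2 := Finset.card_union_add_card_inter (𝔖.supp e) (𝔖.sp (X ∪ X'))
      rw [𝔖.card_supp] at k2
      have k3 : v.card ≤ (𝔖.supp e ∩ 𝔖.sp (X ∪ X')).card :=
        Finset.card_le_card (Finset.subset_inter (𝔖.item_sub e v hv)
          ((𝔖.item_sub x v a1).trans (𝔖.supp_sub_sp (Finset.mem_union_left _ a3.start_mem))))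
      rw [𝔖.item_card e v hv] at k3
      by_cases hCs : C ⊆ insert e (X ∪ X')
      · have hCe : C.erase e ⊆ X ∪ X' := by
          intro w hw
          rcases Finset.mem_insert.1 (hCs (Finset.mem_of_mem_erase hw)) with h | h
          · exact absurd h (Finset.ne_of_mem_erase hw)
          · exact h
        have hUeq : U = insert e (X ∪ X') := by
          apply Finset.Subset.antisymm
          · exact Finset.union_subset hCs (Finset.subset_insert _ _)
          · exact Finset.insert_subset heU hXU
        have m0 := Finset.card_erase_add_one b2
        have m1 := b1.2.2.2 (C.erase e) (Finset.erase_ssubset b2) (by have := b1.1; omega)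
        have m2 : 𝔖.sp C = 𝔖.supp e ∪ 𝔖.sp (C.erase e) := by
          conv_lhs => rw [← Finset.insert_erase b2]
          unfold sp; rw [Finset.biUnion_insert]
        have m3 := Finset.card_union_add_card_inter (𝔖.supp e) (𝔖.sp (C.erase e))
        rw [𝔖.card_supp] at m3
        have m4 : (𝔖.supp e ∩ 𝔖.sp (C.erase e)).card ≤ (𝔖.supp e ∩ 𝔖.sp (X ∪ X')).card :=
          Finset.card_le_card (Finset.inter_subset_inter le_rfl (𝔖.sp_mono hCe))
        have m5 := b1.2.2.1
        rw [hUeq]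
        unfold H at m1 m5 hH ⊢
        rw [m2] at m5
        rw [k1]
        omega
      · have hCi : 2 ≤ (C ∩ insert e (X ∪ X')).card := by
          have : ({e, x'} : Finset G) ⊆ C ∩ insert e (X ∪ X') := by
            intro w hw
            simp only [Finset.mem_insert, Finset.mem_singleton] at hw
            rcases hw with rfl | rfl
            · simp [b2]
            · exact Finset.mem_inter.2 ⟨b3, Finset.mem_insert_of_mem hx'U⟩
          have h := Finset.card_le_card this
          rwa [Finset.card_pair b4.symm] at h
        have n1 := 𝔖.attach_lt hCP hCi hCs
        have n2 : C ∪ insert e (X ∪ X') = U := by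
          rw [hU, Finset.union_insert, Finset.insert_eq_of_mem (Finset.mem_union_left _ b2)]
        rw [n2] at n1
        unfold H at n1 hH ⊢
        rw [k1] at n1
        omega

end Sys
end Five8


namespace Five8

open Finset

variable {G P : Type} [Fintype G] [DecidableEq G] [Fintype P] [DecidableEq P]

lemma ind_not_ne {A B : Prop} (h : ind (¬ A) ≠ ind (¬ B)) : ¬ (A ↔ B) :=
  fun h' => h (ind_congr (not_congr h'))

namespace Sys
variable (𝔖 : Sys G P)

/-- probability of being compatible at time `i` -/
noncomputable def phi (p : ℝ) (R i : ℕ) (e : G) : ℝ :=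
  ev p (Om G R) (fun Z => ind (𝔖.Compat (𝔖.Mt Z i) e))

/-- probability of not being blocked at time `i` -/
noncomputable def uu (p : ℝ) (R i : ℕ) (e : G) : ℝ :=
  ev p (Om G R) (fun Z => ind (¬ 𝔖.Bl (𝔖.Mt Z i) e))

variable {p : ℝ} (hp : 0 ≤ p) (hp1 : p ≤ 1)
include hp hp1

lemma D1 {R i : ℕ} (hi : i ≤ R) (e : G) :
    (∏ v ∈ 𝔖.items e, ev p (Om G R) (fun Z => ind (𝔖.Alive (𝔖.Mt Z i) v))) * 𝔖.uu p R i e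
      - 20 * wt p (𝔖.Wit R (20 * R + 20) (𝔖.supp e)) ≤ 𝔖.phi p R i e := by
  set F : Option (Finset P) → Finset (G × ℕ) → ℝ := fun o Z =>
    match o with
    | none => ind (¬ 𝔖.Bl (𝔖.Mt Z i) e)
    | some v => ind (𝔖.Alive (𝔖.Mt Z i) v) with hF
  have hc := cov_prod_le hp hp1 (Om G R) (Finset.insertNone (𝔖.items e)) F
    (by intro o Z; cases o <;> exact ind_nonneg _) (by intro o Z; cases o <;> exact ind_le_one _)
    (𝔖.Wit R (20 * R + 20) (𝔖.supp e)) (by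
      intro o ho o' ho' hoo ω hω Z hZ Z' hZ' h1 h2 h3 h4
      cases o with
      | none =>
        cases o' with
        | none => exact absurd rfl hoo
        | some v =>
          rw [Finset.union_comm Z Z']
          exact 𝔖.link_block hi (by simpa using ho') hω hZ' hZ h2 h1 (ind_ne h4) (ind_not_ne h3)
      | some v =>
        cases o' with
        | none =>
          exact 𝔖.link_block hi (by simpa using ho) hω hZ hZ' h1 h2 (ind_ne h3) (ind_not_ne h4)
        | some v' =>
          exact 𝔖.link_items hi (by simpa using ho) (by simpa using ho') (by simpa using hoo)
            hω hZ hZ' h1 h2 (ind_ne h3) (ind_ne h4))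
  have hcard : ((Finset.insertNone (𝔖.items e)).card : ℝ) ≤ 20 := by
    rw [Finset.card_insertNone]
    have := 𝔖.items_card e
    exact_mod_cast (by omega : (𝔖.items e).card + 1 ≤ 20)
  have hw : 0 ≤ wt p (𝔖.Wit R (20 * R + 20) (𝔖.supp e)) :=
    Finset.sum_nonneg fun Q _ => by positivity
  have hle : ev p (Om G R) (fun Z => ∏ o ∈ Finset.insertNone (𝔖.items e), F o Z) ≤
      𝔖.phi p R i e := by
    apply ev_mono hp hp1
    intro Z _
    rw [Finset.prod_insertNone]
    simp only [hF]
    rw [ind_prod, ← ind_and]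
    apply ind_mono
    rintro ⟨h1, h2⟩
    exact 𝔖.compat_of_alive h2 h1
  rw [Finset.prod_insertNone] at hc
  have h1 := (abs_le.1 hc).1
  have h2 := mul_le_mul_of_nonneg_right hcard hw
  have h3 : (∏ v ∈ 𝔖.items e, ev p (Om G R) (fun Z => ind (𝔖.Alive (𝔖.Mt Z i) v))) *
      𝔖.uu p R i e = ev p (Om G R) (F none) * ∏ v ∈ 𝔖.items e, ev p (Om G R) (F (some v)) := by
    rw [mul_comm]; rfl
  rw [h3]
  linarith

lemma select_eq {R j : ℕ} (hj : j < R) (g : G) :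
    ev p (Om G R) (fun Z => ind ((g, j) ∈ Z ∧ 𝔖.Compat (𝔖.Mt Z j) g)) = p * 𝔖.phi p R j g := by
  have h1 := ev_force p (Om G R) {(g, j)} (by simp [mem_Om, hj])
    (fun Z => ind (𝔖.Compat (𝔖.Mt Z j) g))
  rw [Finset.card_singleton, pow_one] at h1
  unfold phi
  calc _ = ev p (Om G R) (fun Z => ind ({(g, j)} ⊆ Z) * ind (𝔖.Compat (𝔖.Mt Z j) g)) := by
        apply ev_congr; intro Z _
        rw [ind_and, ind_congr (Finset.singleton_subset_iff)]
    _ = _ := by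
        rw [h1]
        congr 1
        apply ev_congr; intro Z _
        rw [𝔖.Mt_congr (Z := Z ∪ {(g, j)}) (Z' := Z)]
        intro x hx
        simp only [Finset.mem_union, Finset.mem_singleton, or_iff_left_iff_imp]
        rintro rfl
        simp at hx

lemma mem_prob_le {R i : ℕ} (hi : i ≤ R) (g : G) :
    ev p (Om G R) (fun Z => ind (g ∈ 𝔖.Mt Z i)) ≤ ∑ j ∈ range i, p * 𝔖.phi p R j g := by
  calc _ ≤ ev p (Om G R) (fun Z => ∑ j ∈ range i,
        ind ((g, j) ∈ Z ∧ 𝔖.Compat (𝔖.Mt Z j) g)) := by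
        apply ev_mono hp hp1
        intro Z _
        refine le_trans (ind_mono ?_) (ind_exists_le _ _)
        intro h
        obtain ⟨j, hj, h'⟩ := 𝔖.mem_Mt.1 h
        exact ⟨j, by simpa using hj, h'⟩
    _ = _ := by
        rw [ev_sum]
        apply Finset.sum_congr rfl
        intro j hj
        exact 𝔖.select_eq hp hp1 (by simp at hj; omega) g

lemma mem_prob_ge {R : ℕ} (g : G) :
    ∑ j ∈ range R, p * 𝔖.phi p R j g - (R : ℝ) ^ 2 * p ^ 2 ≤
      ev p (Om G R) (fun Z => ind (g ∈ 𝔖.Mt Z R)) := by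
  classical
  have h1 : ∀ Z : Finset (G × ℕ), (∑ j ∈ range R, ind ((g, j) ∈ Z ∧ 𝔖.Compat (𝔖.Mt Z j) g)) -
      ∑ jk ∈ (range R ×ˢ range R).filter (fun jk => jk.1 ≠ jk.2),
        ind ({(g, jk.1), (g, jk.2)} ⊆ Z) ≤ ind (g ∈ 𝔖.Mt Z R) := by
    intro Z
    set T := (range R).filter (fun j => (g, j) ∈ Z ∧ 𝔖.Compat (𝔖.Mt Z j) g) with hT
    have e1 : (∑ j ∈ range R, ind ((g, j) ∈ Z ∧ 𝔖.Compat (𝔖.Mt Z j) g)) = T.card := by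
      rw [hT, Finset.card_filter]
      push_cast
      apply Finset.sum_congr rfl
      intro j _
      unfold ind
      split_ifs <;> simp
    have e2 : ((T.card * T.card - T.card : ℕ) : ℝ) ≤
        ∑ jk ∈ (range R ×ˢ range R).filter (fun jk => jk.1 ≠ jk.2),
        ind ({(g, jk.1), (g, jk.2)} ⊆ Z) := by
      rw [← Finset.offDiag_card]
      have : T.offDiag ⊆ (range R ×ˢ range R).filter (fun jk => jk.1 ≠ jk.2) := by
        intro x hx
        simp only [Finset.mem_offDiag, hT, Finset.mem_filter] at hx
        simp only [Finset.mem_filter, Finset.mem_product]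
        exact ⟨⟨hx.1.1, hx.2.1.1⟩, hx.2.2⟩
      refine le_trans ?_ (Finset.sum_le_sum_of_subset_of_nonneg this fun _ _ _ => ind_nonneg _)
      rw [Finset.card_eq_sum_ones]
      push_cast
      apply Finset.sum_le_sum
      intro x hx
      simp only [Finset.mem_offDiag, hT, Finset.mem_filter] at hx
      rw [ind_true]
      intro y hy
      simp only [Finset.mem_insert, Finset.mem_singleton] at hy
      rcases hy with rfl | rfl
      · exact hx.1.2.1
      · exact hx.2.1.2.1
    rw [e1]
    rcases Nat.eq_zero_or_pos T.card with h0 | h0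
    · rw [h0] at e2 ⊢
      have := ind_nonneg (g ∈ 𝔖.Mt Z R)
      simp at e2 ⊢
      linarith
    · obtain ⟨j, hj⟩ := Finset.card_pos.1 h0
      simp only [hT, Finset.mem_filter, Finset.mem_range] at hj
      rw [ind_true (𝔖.mem_Mt.2 ⟨j, hj.1, hj.2⟩)]
      have e3 : T.card ≤ T.card * T.card - T.card + 1 := by
        obtain ⟨k, hk⟩ := Nat.exists_eq_add_of_le' h0
        rw [hk]
        have : (k + 1) * (k + 1) = k * k + k + (k + 1) := by ring
        rw [this]; simp
      have e4 : (T.card : ℝ) ≤ ((T.card * T.card - T.card : ℕ) : ℝ) + 1 := by exact_mod_cast e3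
      linarith
  refine le_trans ?_ (ev_mono hp hp1 (fun Z _ => h1 Z))
  rw [ev_sub, ev_sum, ev_sum]
  have h2 : ∑ j ∈ range R, ev p (Om G R) (fun Z => ind ((g, j) ∈ Z ∧ 𝔖.Compat (𝔖.Mt Z j) g)) =
      ∑ j ∈ range R, p * 𝔖.phi p R j g :=
    Finset.sum_congr rfl fun j hj => 𝔖.select_eq hp hp1 (by simpa using hj) g
  rw [h2]
  have h3 : ∑ jk ∈ (range R ×ˢ range R).filter (fun jk => jk.1 ≠ jk.2),
      ev p (Om G R) (fun Z => ind ({(g, jk.1), (g, jk.2)} ⊆ Z)) ≤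
      ∑ jk ∈ (range R ×ˢ range R).filter (fun jk => jk.1 ≠ jk.2), p ^ 2 := by
    apply Finset.sum_le_sum
    intro jk hjk
    have hne := (Finset.mem_filter.1 hjk).2
    have := ev_subset_le hp (Om G R) {(g, jk.1), (g, jk.2)}
    rwa [Finset.card_pair (by simpa using hne)] at this
  rw [Finset.sum_const, nsmul_eq_mul] at h3
  have h4 : ((((range R ×ˢ range R).filter (fun jk => jk.1 ≠ jk.2)).card : ℕ) : ℝ) ≤
      (R : ℝ) ^ 2 := by
    have := Finset.card_filter_le (range R ×ˢ range R) (fun jk => jk.1 ≠ jk.2)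
    rw [Finset.card_product, Finset.card_range] at this
    rw [sq]; exact_mod_cast this
  have h5 := mul_le_mul_of_nonneg_right h4 (sq_nonneg p)
  linarith

lemma alive_ge {R i : ℕ} (hi : i ≤ R) (v : Finset P) (s : ℝ)
    (hs : ∀ g, ∑ j ∈ range i, p * 𝔖.phi p R j g ≤ s) :
    1 - (univ.filter (fun g => v ∈ 𝔖.items g)).card * s ≤
      ev p (Om G R) (fun Z => ind (𝔖.Alive (𝔖.Mt Z i) v)) := by
  have h1 : ∀ Z, 1 - ∑ g ∈ univ.filter (fun g => v ∈ 𝔖.items g), ind (g ∈ 𝔖.Mt Z i) ≤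
      ind (𝔖.Alive (𝔖.Mt Z i) v) := by
    intro Z
    by_cases h : 𝔖.Alive (𝔖.Mt Z i) v
    · rw [ind_true h]
      have : 0 ≤ ∑ g ∈ univ.filter (fun g => v ∈ 𝔖.items g), ind (g ∈ 𝔖.Mt Z i) :=
        Finset.sum_nonneg fun _ _ => ind_nonneg _
      linarith
    · rw [ind_false h]
      unfold Alive at h
      push Not at h
      obtain ⟨g, hg, hv⟩ := h
      have h2 := ind_exists_le (univ.filter (fun g => v ∈ 𝔖.items g)) (fun g => g ∈ 𝔖.Mt Z i)
      rw [ind_true ⟨g, by simpa using hv, hg⟩] at h2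
      linarith
  refine le_trans ?_ (ev_mono hp hp1 (fun Z _ => h1 Z))
  rw [ev_sub, ev_const, ev_sum]
  have h2 : ∑ g ∈ univ.filter (fun g => v ∈ 𝔖.items g),
      ev p (Om G R) (fun Z => ind (g ∈ 𝔖.Mt Z i)) ≤
      ∑ g ∈ univ.filter (fun g => v ∈ 𝔖.items g), s :=
    Finset.sum_le_sum fun g _ => (𝔖.mem_prob_le hp hp1 hi g).trans (hs g)
  rw [Finset.sum_const, nsmul_eq_mul] at h2
  linarith

end Sys
end Five8


namespace Five8

open Finset

variable {G P : Type} [Fintype G] [DecidableEq G] [Fintype P] [DecidableEq P]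

/-- graph of a choice of rounds -/
def gr (B : Finset G) (j : G → ℕ) : Finset (G × ℕ) := B.image (fun b => (b, j b))

lemma card_gr (B : Finset G) (j : G → ℕ) : (gr B j).card = B.card :=
  Finset.card_image_of_injective _ (fun a b h => congrArg Prod.fst h)

lemma mem_gr {B : Finset G} {j : G → ℕ} {x : G × ℕ} : x ∈ gr B j ↔ x.1 ∈ B ∧ x.2 = j x.1 := by
  unfold gr
  rw [Finset.mem_image]
  constructor
  · rintro ⟨b, hb, rfl⟩; exact ⟨hb, rfl⟩
  · rintro ⟨h1, h2⟩; exact ⟨x.1, h1, by rw [← h2]⟩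

namespace Sys
variable (𝔖 : Sys G P)

/-- the kind of conflict considered at `g` -/
def kind (e g : G) (C : Finset G) : Prop := if g = e then 𝔖.Conf C else 𝔖.ConfP C

lemma kind_confP {e g : G} {C : Finset G} (h : 𝔖.kind e g C) : 𝔖.ConfP C := by
  unfold kind at h; split_ifs at h
  · exact Or.inl h
  · exact h

/-- test event at `g` -/
def tst (e : G) (k : G → ℕ) (g : G) (Z : Finset (G × ℕ)) : Prop :=
  ∃ C, 𝔖.kind e g C ∧ g ∈ C ∧ C.erase g ⊆ 𝔖.Mt Z (k g)

lemma link_roots {R : ℕ} {C : Finset G} (hC : 𝔖.Conf C) {e : G} {k : G → ℕ} {r r' : G}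
    (hr : r ∈ C) (hr' : r' ∈ C) (hne : r ≠ r') (hk : k r ≤ R) (hk' : k r' ≤ R)
    {ω : G × ℕ} {Z Z' : Finset (G × ℕ)}
    (hω : ω ∈ Om G R) (hZ : Z ⊆ Om G R) (hZ' : Z' ⊆ Om G R) (hωZ : ω ∉ Z) (hωZ' : ω ∉ Z')
    (h : ¬ (𝔖.tst e k r (insert ω Z) ↔ 𝔖.tst e k r Z))
    (h' : ¬ (𝔖.tst e k r' (insert ω Z') ↔ 𝔖.tst e k r' Z')) :
    ∃ Q ∈ 𝔖.Wit R (20 * R + 20) (𝔖.sp C), ω ∈ Q ∧ Q ⊆ insert ω (Z ∪ Z') := by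
  obtain ⟨y, j, X, a1, a2, a3, a4, a5, a6⟩ := 𝔖.trace_root _ (fun C h => 𝔖.kind_confP h) h
  obtain ⟨y', j', X', b1, b2, b3, b4, b5, b6⟩ := 𝔖.trace_root _ (fun C h => 𝔖.kind_confP h) h'
  have c1 := pivot_eq hωZ a5
  have c2 := pivot_eq hωZ' b5
  rw [image_pivot] at a3 b3
  have c3 : y = ω.1 := by rw [← c1]
  have c4 : y' = ω.1 := by rw [← c2]
  subst c3; subst c4
  have hH := a2.H_join 𝔖 b2
  have hcu := Finset.card_union_le X X'
  set S := insert ω (Z ∪ Z') with hSdef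
  have hS : S ⊆ Om G R := Finset.insert_subset hω (Finset.union_subset hZ hZ')
  have s1 : (insert ω Z).image Prod.fst ⊆ S.image Prod.fst :=
    Finset.image_subset_image (Finset.insert_subset_insert _ Finset.subset_union_left)
  have s2 : (insert ω Z').image Prod.fst ⊆ S.image Prod.fst :=
    Finset.image_subset_image (Finset.insert_subset_insert _ Finset.subset_union_right)
  have hsel : ∀ x ∈ X ∪ X', x ≠ r → x ≠ r' → x ∈ S.image Prod.fst := by
    intro x hx h1 h2
    rcases Finset.mem_union.1 hx with hx | hx
    · exact s1 (a3 (Finset.mem_erase.2 ⟨h1, hx⟩))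
    · exact s2 (b3 (Finset.mem_erase.2 ⟨h2, hx⟩))
  have hωS : ω ∈ S := by simp [hSdef]
  apply 𝔖.mk_wit (W := (X ∪ X').filter (fun x => x ∈ S.image Prod.fst)) hS
  · intro x hx; exact (Finset.mem_filter.1 hx).2
  · exact hωS
  · exact Finset.mem_filter.2 ⟨Finset.mem_union_left _ a2.end_mem,
      Finset.mem_image_of_mem Prod.fst hωS⟩
  · have := Finset.card_filter_le (X ∪ X') (fun x => x ∈ S.image Prod.fst)
    omega
  · apply 𝔖.gain4 hC hH
    · have : ({r, r'} : Finset G) ⊆ (X ∪ X') ∩ C := by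
        intro w hw
        simp only [Finset.mem_insert, Finset.mem_singleton] at hw
        rcases hw with rfl | rfl
        · exact Finset.mem_inter.2 ⟨Finset.mem_union_left _ a2.start_mem, hr⟩
        · exact Finset.mem_inter.2 ⟨Finset.mem_union_right _ b2.start_mem, hr'⟩
      have h := Finset.card_le_card this
      rwa [Finset.card_pair hne] at h
    · exact Finset.filter_subset _ _
    · intro x hx
      obtain ⟨h1, h2⟩ := Finset.mem_sdiff.1 hx
      exact Finset.mem_filter.2 ⟨h1, hsel x h1 (fun h => h2 (h ▸ hr)) (fun h => h2 (h ▸ hr'))⟩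
    · intro hCU
      have : ∃ x ∈ C, x ≠ r ∧ x ≠ r' := by
        by_contra! hcon
        have : C ⊆ {r, r'} := by
          intro x hx
          by_cases hxr : x = r
          · simp [hxr]
          · simp [hcon x hx hxr]
        have h1 := Finset.card_le_card this
        have h2 := Finset.card_le_two (a := r) (b := r')
        have h3 := hC.1
        omega
      obtain ⟨x, hx, h1, h2⟩ := this
      exact ⟨x, Finset.mem_inter.2 ⟨Finset.mem_filter.2 ⟨hCU hx, hsel x (hCU hx) h1 h2⟩, hx⟩⟩

/-- removing the forced coordinates -/
lemma link_force {R i : ℕ} {C : Finset G} (hC : 𝔖.Conf C) {e e' : G} {k : G → ℕ}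
    (he : e ∈ C) (he' : e' ∈ C) (hee : e' ≠ e) (hke : k e = i) (hke' : k e' = i)
    (hk : ∀ b ∈ C, k b ≤ i) (hi : i ≤ R)
    {Z : Finset (G × ℕ)} (hZ : Z ⊆ Om G R) {g : G} (hg : g ∈ C)
    (h : ¬ (𝔖.tst e k g (Z ∪ gr (C.erase e) k) ↔ 𝔖.tst e k g Z)) :
    ∃ Q ∈ 𝔖.Wit R (20 * R + 20) (𝔖.sp C), Q ⊆ Z := by
  set B' := (C.erase e).filter (fun b => k b < i) with hB'
  have hcong : 𝔖.tst e k g (Z ∪ gr (C.erase e) k) ↔ 𝔖.tst e k g (Z ∪ gr B' k) := by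
    unfold tst
    rw [𝔖.Mt_congr (Z := Z ∪ gr (C.erase e) k) (Z' := Z ∪ gr B' k)]
    intro x hx
    have := hk g hg
    simp only [Finset.mem_union, mem_gr, hB', Finset.mem_filter]
    constructor
    · rintro (h | ⟨h1, h2⟩)
      · exact Or.inl h
      · exact Or.inr ⟨⟨h1, by omega⟩, h2⟩
    · rintro (h | ⟨h1, h2⟩)
      · exact Or.inl h
      · exact Or.inr ⟨h1.1, h2⟩
  rw [hcong] at h
  obtain ⟨y, j, X, a1, a2, a3, a4, a5, a6⟩ := 𝔖.trace_root _ (fun C h => 𝔖.kind_confP h) h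
  have hgi := hk g hg
  have hy : (y, j) ∈ gr B' k := by
    by_contra hcon
    apply a5
    simp [hcon]
  rw [mem_gr] at hy
  simp only [hB', Finset.mem_filter, Finset.mem_erase] at hy
  have hyg : y ≠ g := by
    rintro rfl
    omega
  have hsel : ∀ x ∈ X, x ≠ g → x ∉ B' → x ∈ Z.image Prod.fst := by
    intro x hx hxg hxB
    have := a3 (Finset.mem_erase.2 ⟨hxg, hx⟩)
    obtain ⟨z, hz, rfl⟩ := Finset.mem_image.1 this
    simp only [Finset.mem_union] at hz
    rcases hz with (hz | hz) | hz
    · exact Finset.mem_image_of_mem Prod.fst hz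
    · exact absurd (mem_gr.1 hz).1 hxB
    · exact Finset.mem_image_of_mem Prod.fst hz
  have hB'C : B' ⊆ C := (Finset.filter_subset _ _).trans (Finset.erase_subset _ _)
  apply 𝔖.mk_wit0 (W := X.filter (fun x => x ∈ Z.image Prod.fst)) hZ
  · intro x hx; exact (Finset.mem_filter.1 hx).2
  · have := Finset.card_filter_le X (fun x => x ∈ Z.image Prod.fst)
    omega
  · apply 𝔖.gain4 hC a2.H_le
    · have : ({g, y} : Finset G) ⊆ X ∩ C := by
        intro w hw
        simp only [Finset.mem_insert, Finset.mem_singleton] at hw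
        rcases hw with rfl | rfl
        · exact Finset.mem_inter.2 ⟨a2.start_mem, hg⟩
        · exact Finset.mem_inter.2 ⟨a2.end_mem, hy.1.1.2⟩
      have h := Finset.card_le_card this
      rwa [Finset.card_pair hyg.symm] at h
    · exact Finset.filter_subset _ _
    · intro x hx
      obtain ⟨h1, h2⟩ := Finset.mem_sdiff.1 hx
      exact Finset.mem_filter.2 ⟨h1, hsel x h1 (fun h => h2 (h ▸ hg)) (fun h => h2 (hB'C h))⟩
    · intro hCX
      by_cases hge : g = e
      · refine ⟨e', Finset.mem_inter.2 ⟨Finset.mem_filter.2 ⟨hCX he', hsel e' (hCX he')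
          (by rw [hge]; exact hee) ?_⟩, he'⟩⟩
        simp [hB', hke']
      · refine ⟨e, Finset.mem_inter.2 ⟨Finset.mem_filter.2 ⟨hCX he, hsel e (hCX he)
          (fun h => hge h.symm) ?_⟩, he⟩⟩
        simp [hB']

variable {p : ℝ} (hp : 0 ≤ p) (hp1 : p ≤ 1)
include hp hp1

lemma wit_prob_le (R q : ℕ) (P₀ : Finset P) :
    ev p (Om G R) (fun Z => ind (∃ Q ∈ 𝔖.Wit R q P₀, Q ⊆ Z)) ≤ wt p (𝔖.Wit R q P₀) := by
  calc _ ≤ ev p (Om G R) (fun Z => ∑ Q ∈ 𝔖.Wit R q P₀, ind (Q ⊆ Z)) :=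
        ev_mono hp hp1 fun Z _ => ind_exists_le _ _
    _ = ∑ Q ∈ 𝔖.Wit R q P₀, ev p (Om G R) (fun Z => ind (Q ⊆ Z)) := ev_sum ..
    _ ≤ _ := by
        apply Finset.sum_le_sum
        intro Q hQ
        have hc : 1 ≤ Q.card := by
          simp only [Wit, Finset.mem_filter] at hQ
          omega
        have hc' : (1 : ℝ) ≤ Q.card := by exact_mod_cast hc
        calc _ ≤ p ^ Q.card := ev_subset_le hp _ _
          _ ≤ (2 * p) ^ Q.card := by gcongr; linarith
          _ ≤ _ := le_mul_of_one_le_left (by positivity) hc'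

lemma D2core {R i : ℕ} (hi : i < R) {C : Finset G} (hC : 𝔖.Conf C) {e e' : G} (j : G → ℕ)
    (he : e ∈ C) (he' : e' ∈ C.erase e) (hje' : j e' = i) (hj : ∀ b ∈ C.erase e, j b ≤ i) :
    ev p (Om G R) (fun Z => ind (gr (C.erase e) j ⊆ Z ∧ ¬ 𝔖.Bl (𝔖.Mt Z i) e ∧
      ∀ b ∈ C.erase e, 𝔖.Compat (𝔖.Mt Z (j b)) b)) ≤
    p ^ (C.card - 1) * (𝔖.uu p R i e * ∏ b ∈ C.erase e, 𝔖.phi p R (j b) b +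
      11 * wt p (𝔖.Wit R (20 * R + 20) (𝔖.sp C))) := by
  set k := Function.update j e i with hkdef
  have hee := Finset.ne_of_mem_erase he'
  have heC := Finset.mem_of_mem_erase he'
  have hke : k e = i := by simp [hkdef]
  have hkb : ∀ b, b ≠ e → k b = j b := fun b hb => by simp [hkdef, hb]
  have hgr : gr (C.erase e) j = gr (C.erase e) k := by
    apply Finset.image_congr
    intro b hb
    simp only [Finset.coe_erase, Set.mem_diff, Set.mem_singleton_iff] at hb
    simp only [hkb b hb.2]
  have hkC : ∀ b ∈ C, k b ≤ i := by
    intro b hb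
    by_cases hbe : b = e
    · rw [hbe, hke]
    · rw [hkb b hbe]; exact hj b (Finset.mem_erase.2 ⟨hbe, hb⟩)
  have hte : ∀ Z, 𝔖.tst e k e Z ↔ 𝔖.Bl (𝔖.Mt Z i) e := by
    intro Z; unfold tst Bl kind; simp [hke]
  have htb : ∀ b, b ≠ e → ∀ Z, ¬ 𝔖.tst e k b Z ↔ 𝔖.Compat (𝔖.Mt Z (j b)) b := by
    intro b hb Z; unfold tst kind; rw [compat_iff]; simp [hb, hkb b hb]
  set F : G → Finset (G × ℕ) → ℝ := fun g Z => ind (¬ 𝔖.tst e k g Z) with hF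
  have hprod : ∀ Z, ind (¬ 𝔖.Bl (𝔖.Mt Z i) e ∧ ∀ b ∈ C.erase e, 𝔖.Compat (𝔖.Mt Z (j b)) b) =
      ∏ g ∈ C, F g Z := by
    intro Z
    rw [hF, ind_prod]
    apply ind_congr
    constructor
    · rintro ⟨h1, h2⟩ g hg
      by_cases hge : g = e
      · rw [hge, hte]; exact h1
      · rw [htb g hge]; exact h2 g (Finset.mem_erase.2 ⟨hge, hg⟩)
    · intro h
      refine ⟨by rw [← hte]; exact h e he, fun b hb => ?_⟩
      rw [← htb b (Finset.ne_of_mem_erase hb)]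
      exact h b (Finset.mem_of_mem_erase hb)
  have hw : 0 ≤ wt p (𝔖.Wit R (20 * R + 20) (𝔖.sp C)) :=
    Finset.sum_nonneg fun Q _ => by positivity
  have hsub : gr (C.erase e) j ⊆ Om G R := by
    intro x hx
    obtain ⟨h1, h2⟩ := mem_gr.1 hx
    rw [mem_Om, h2]
    exact lt_of_le_of_lt (hj _ h1) hi
  have hc := cov_prod_le hp hp1 (Om G R) C F (fun _ _ => ind_nonneg _) (fun _ _ => ind_le_one _)
    (𝔖.Wit R (20 * R + 20) (𝔖.sp C)) (by
      intro r hr r' hr' hne ω hω Z hZ Z' hZ' h1 h2 h3 h4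
      exact 𝔖.link_roots hC hr hr' hne ((hkC r hr).trans hi.le) ((hkC r' hr').trans hi.le)
        hω hZ hZ' h1 h2 (ind_not_ne h3) (ind_not_ne h4))
  have hcard : (C.card : ℝ) ≤ 10 := by exact_mod_cast hC.2.1
  have h2 := mul_le_mul_of_nonneg_right hcard hw
  have h3 := (abs_le.1 hc).2
  have h4 : ∏ g ∈ C, ev p (Om G R) (F g) =
      𝔖.uu p R i e * ∏ b ∈ C.erase e, 𝔖.phi p R (j b) b := by
    rw [← Finset.mul_prod_erase C _ he]
    congr 1
    · unfold uu
      apply ev_congr; intro Z _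
      exact ind_congr (not_congr (hte Z))
    · apply Finset.prod_congr rfl
      intro b hb
      unfold phi
      apply ev_congr; intro Z _
      exact ind_congr (htb b (Finset.ne_of_mem_erase hb) Z)
  have h5 : ev p (Om G R) (fun Z => ∏ g ∈ C, F g (Z ∪ gr (C.erase e) j)) ≤
      ev p (Om G R) (fun Z => ∏ g ∈ C, F g Z) + wt p (𝔖.Wit R (20 * R + 20) (𝔖.sp C)) := by
    refine le_trans ?_ (add_le_add_right (𝔖.wit_prob_le hp hp1 R (20 * R + 20) (𝔖.sp C)) _)
    rw [← ev_add]
    apply ev_mono hp hp1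
    intro Z hZ
    by_cases hQ : ∃ Q ∈ 𝔖.Wit R (20 * R + 20) (𝔖.sp C), Q ⊆ Z
    · rw [ind_true hQ]
      have h6 : ∏ g ∈ C, F g (Z ∪ gr (C.erase e) j) ≤ 1 :=
        Finset.prod_le_one (fun _ _ => ind_nonneg _) (fun _ _ => ind_le_one _)
      have h7 : 0 ≤ ∏ g ∈ C, F g Z := Finset.prod_nonneg (fun _ _ => ind_nonneg _)
      linarith
    · rw [ind_false hQ, add_zero]
      apply le_of_eq
      apply Finset.prod_congr rfl
      intro g hg
      by_contra hne
      apply hQ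
      rw [hgr] at hne
      exact 𝔖.link_force hC he heC hee hke (by rw [hkb e' hee, hje']) hkC hi.le hZ hg
        (ind_not_ne hne)
  calc _ = ev p (Om G R) (fun Z => ind (gr (C.erase e) j ⊆ Z) * ∏ g ∈ C, F g Z) := by
        apply ev_congr; intro Z _
        rw [ind_and, hprod]
    _ = p ^ (C.card - 1) * ev p (Om G R) (fun Z => ∏ g ∈ C, F g (Z ∪ gr (C.erase e) j)) := by
        rw [ev_force p _ _ hsub, card_gr, Finset.card_erase_of_mem he]
    _ ≤ _ := by
        apply mul_le_mul_of_nonneg_left _ (by positivity)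
        rw [← h4]
        linarith

end Sys
end Five8


namespace Five8

open Finset

variable {G P : Type} [Fintype G] [DecidableEq G] [Fintype P] [DecidableEq P]

namespace Sys
variable (𝔖 : Sys G P)

/-- symmetries of the system -/
def Symm (σ : Equiv.Perm G) : Prop :=
  (∀ Γ : Finset G, (𝔖.sp (Γ.map σ.toEmbedding)).card = (𝔖.sp Γ).card) ∧
  ∀ g g', (∃ v ∈ 𝔖.items (σ g), v ∈ 𝔖.items (σ g')) ↔ (∃ v ∈ 𝔖.items g, v ∈ 𝔖.items g')

variable {𝔖}

lemma map_symm_map (σ : Equiv.Perm G) (Γ : Finset G) :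
    (Γ.map σ.symm.toEmbedding).map σ.toEmbedding = Γ := by
  ext x; simp

lemma map_map_symm (σ : Equiv.Perm G) (Γ : Finset G) :
    (Γ.map σ.toEmbedding).map σ.symm.toEmbedding = Γ := by
  ext x; simp

lemma Symm.symm {σ : Equiv.Perm G} (h : 𝔖.Symm σ) : 𝔖.Symm σ.symm := by
  constructor
  · intro Γ
    rw [← h.1 (Γ.map σ.symm.toEmbedding), map_symm_map]
  · intro g g'
    rw [← h.2]; simp

lemma Symm.H {σ : Equiv.Perm G} (h : 𝔖.Symm σ) (Γ : Finset G) :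
    𝔖.H (Γ.map σ.toEmbedding) = 𝔖.H Γ := by
  unfold Sys.H; rw [h.1, Finset.card_map]

lemma Symm.conf_aux {σ : Equiv.Perm G} (h : 𝔖.Symm σ) {C : Finset G} (hC : 𝔖.Conf C) :
    𝔖.Conf (C.map σ.toEmbedding) := by
  obtain ⟨h1, h2, h3, h4⟩ := hC
  refine ⟨by simpa using h1, by simpa using h2, by rw [h.H]; exact h3, ?_⟩
  intro Γ hΓ hc
  have h5 : Γ.map σ.symm.toEmbedding ⊂ C := by
    rw [← map_map_symm σ C]
    exact Finset.map_ssubset_map.2 hΓ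
  have := h4 _ h5 (by simpa using hc)
  rwa [h.symm.H] at this

lemma Symm.conf2_aux {σ : Equiv.Perm G} (h : 𝔖.Symm σ) {C : Finset G} (hC : 𝔖.Conf2 C) :
    𝔖.Conf2 (C.map σ.toEmbedding) := by
  obtain ⟨g, g', hne, rfl, hv⟩ := hC
  exact ⟨σ g, σ g', fun h => hne (σ.injective h), by simp, (h.2 g g').2 hv⟩

lemma Symm.conf {σ : Equiv.Perm G} (h : 𝔖.Symm σ) {C : Finset G} :
    𝔖.Conf (C.map σ.toEmbedding) ↔ 𝔖.Conf C := by
  refine ⟨fun hC => ?_, h.conf_aux⟩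
  rw [← map_map_symm σ C]; exact h.symm.conf_aux hC

lemma Symm.confP_aux {σ : Equiv.Perm G} (h : 𝔖.Symm σ) {C : Finset G} (hC : 𝔖.ConfP C) :
    𝔖.ConfP (C.map σ.toEmbedding) := by
  rcases hC with hC | hC
  · exact Or.inl (h.conf_aux hC)
  · exact Or.inr (h.conf2_aux hC)

lemma Symm.confP {σ : Equiv.Perm G} (h : 𝔖.Symm σ) {C : Finset G} :
    𝔖.ConfP (C.map σ.toEmbedding) ↔ 𝔖.ConfP C := by
  refine ⟨fun hC => ?_, h.confP_aux⟩
  rw [← map_map_symm σ C]; exact h.symm.confP_aux hC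

lemma map_erase_sub (σ : Equiv.Perm G) {C M : Finset G} {g : G} :
    (C.map σ.toEmbedding).erase (σ g) ⊆ M.map σ.toEmbedding ↔ C.erase g ⊆ M := by
  have := Finset.map_subset_map (f := σ.toEmbedding) (s₁ := C.erase g) (s₂ := M)
  rw [← this, Finset.map_erase]; rfl

lemma Symm.compat {σ : Equiv.Perm G} (h : 𝔖.Symm σ) {M : Finset G} {g : G} :
    𝔖.Compat (M.map σ.toEmbedding) (σ g) ↔ 𝔖.Compat M g := by
  constructor
  · intro hc C hC hg hs
    exact hc _ (h.confP.2 hC) (by simpa using hg) ((map_erase_sub σ).2 hs)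
  · intro hc C hC hg hs
    rw [← map_symm_map σ C] at hC hg hs
    exact hc _ (h.confP.1 hC) (by simpa using hg) ((map_erase_sub σ).1 hs)

lemma Symm.bl {σ : Equiv.Perm G} (h : 𝔖.Symm σ) {M : Finset G} {g : G} :
    𝔖.Bl (M.map σ.toEmbedding) (σ g) ↔ 𝔖.Bl M g := by
  constructor
  · rintro ⟨C, hC, hg, hs⟩
    rw [← map_symm_map σ C] at hC hg hs
    exact ⟨_, h.conf.1 hC, by simpa using hg, (map_erase_sub σ).1 hs⟩
  · rintro ⟨C, hC, hg, hs⟩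
    exact ⟨_, h.conf.2 hC, by simpa using hg, (map_erase_sub σ).2 hs⟩

/-- lift to the sample space -/
def lift (σ : Equiv.Perm G) : Equiv.Perm (G × ℕ) := Equiv.prodCongr σ (Equiv.refl ℕ)

lemma mem_lift {σ : Equiv.Perm G} {Z : Finset (G × ℕ)} {g : G} {i : ℕ} :
    (σ g, i) ∈ Z.map (lift σ).toEmbedding ↔ (g, i) ∈ Z := by
  have : (σ g, i) = (lift σ).toEmbedding (g, i) := rfl
  rw [this, Finset.mem_map']

lemma Symm.Mt {σ : Equiv.Perm G} (h : 𝔖.Symm σ) (Z : Finset (G × ℕ)) (i : ℕ) :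
    𝔖.Mt (Z.map (lift σ).toEmbedding) i = (𝔖.Mt Z i).map σ.toEmbedding := by
  induction i with
  | zero => simp [Mt_zero]
  | succ i ih =>
    ext x
    obtain ⟨g, rfl⟩ := σ.surjective x
    have h1 : σ g ∈ (𝔖.Mt Z (i+1)).map σ.toEmbedding ↔ g ∈ 𝔖.Mt Z (i+1) :=
      Finset.mem_map' σ.toEmbedding
    have h2 : σ g ∈ (𝔖.Mt Z i).map σ.toEmbedding ↔ g ∈ 𝔖.Mt Z i :=
      Finset.mem_map' σ.toEmbedding
    rw [h1, mem_Mt_succ, mem_Mt_succ, ih, h2, mem_lift, h.compat]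

lemma lift_Om (σ : Equiv.Perm G) (R : ℕ) : (Om G R).map (lift σ).toEmbedding = Om G R := by
  ext ⟨g, i⟩
  obtain ⟨g, rfl⟩ := σ.surjective g
  rw [mem_lift, mem_Om, mem_Om]

lemma Symm.phi {σ : Equiv.Perm G} (h : 𝔖.Symm σ) (p : ℝ) (R i : ℕ) (e : G) :
    𝔖.phi p R i (σ e) = 𝔖.phi p R i e := by
  unfold Sys.phi
  rw [← ev_perm p (Om G R) (lift σ) (lift_Om σ R)]
  simp only [h.Mt, h.compat]

lemma Symm.uu {σ : Equiv.Perm G} (h : 𝔖.Symm σ) (p : ℝ) (R i : ℕ) (e : G) :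
    𝔖.uu p R i (σ e) = 𝔖.uu p R i e := by
  unfold Sys.uu
  rw [← ev_perm p (Om G R) (lift σ) (lift_Om σ R)]
  simp only [h.Mt, h.bl]

variable (𝔖)
variable {p : ℝ} (hp : 0 ≤ p) (hp1 : p ≤ 1)
include hp hp1

lemma phi_nonneg (R i : ℕ) (e : G) : 0 ≤ 𝔖.phi p R i e :=
  ev_nonneg hp hp1 fun _ _ => ind_nonneg _
lemma phi_le_one (R i : ℕ) (e : G) : 𝔖.phi p R i e ≤ 1 :=
  ev_le_one hp hp1 fun _ _ => ind_le_one _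
lemma uu_nonneg (R i : ℕ) (e : G) : 0 ≤ 𝔖.uu p R i e :=
  ev_nonneg hp hp1 fun _ _ => ind_nonneg _
lemma uu_le_one (R i : ℕ) (e : G) : 𝔖.uu p R i e ≤ 1 :=
  ev_le_one hp hp1 fun _ _ => ind_le_one _

omit hp hp1 in
lemma uu_zero (R : ℕ) (e : G) : 𝔖.uu p R 0 e = 1 := by
  unfold uu
  have : ∀ Z : Finset (G × ℕ), ind (¬ 𝔖.Bl (𝔖.Mt Z 0) e) = 1 := by
    intro Z
    apply ind_true
    rintro ⟨C, hC, he, hs⟩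
    rw [Mt_zero] at hs
    have h1 := Finset.card_le_card hs
    rw [Finset.card_erase_of_mem he] at h1
    have := hC.1
    simp at h1
    omega
  simp only [this, ev_const]

/-- one family of timings -/
def tm (C : Finset G) (e e' : G) (i : ℕ) : G → Finset ℕ := fun g =>
  if g = e' then {i} else if g ∈ C.erase e then range (i + 1) else {0}

omit hp hp1 in
lemma bl_step {Z : Finset (G × ℕ)} {i : ℕ} {e : G} (h1 : ¬ 𝔖.Bl (𝔖.Mt Z i) e)
    (h2 : 𝔖.Bl (𝔖.Mt Z (i+1)) e) :
    ∃ C, 𝔖.Conf C ∧ e ∈ C ∧ ∃ e' ∈ C.erase e, ∃ j ∈ Fintype.piFinset (tm C e e' i),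
      gr (C.erase e) j ⊆ Z ∧ ¬ 𝔖.Bl (𝔖.Mt Z i) e ∧
      ∀ b ∈ C.erase e, 𝔖.Compat (𝔖.Mt Z (j b)) b := by
  classical
  obtain ⟨C, hC, he, hs⟩ := h2
  have h3 : ¬ C.erase e ⊆ 𝔖.Mt Z i := fun h => h1 ⟨C, hC, he, h⟩
  obtain ⟨e', he', hne⟩ := Finset.not_subset.1 h3
  have h4 : ∀ b, b ∈ C.erase e → ∃ j < i+1, (b, j) ∈ Z ∧ 𝔖.Compat (𝔖.Mt Z j) b :=
    fun b hb => 𝔖.mem_Mt.1 (hs hb)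
  choose! J hJ using h4
  refine ⟨C, hC, he, e', he', fun g => if g ∈ C.erase e then J g else 0, ?_, ?_, h1, ?_⟩
  · rw [Fintype.mem_piFinset]
    intro g
    unfold tm
    by_cases hg : g = e'
    · subst hg
      rw [if_pos rfl, if_pos he']
      obtain ⟨ha, hb, hc⟩ := hJ g he'
      simp only [Finset.mem_singleton]
      by_contra hne'
      exact hne (𝔖.mem_Mt.2 ⟨J g, by omega, hb, hc⟩)
    · rw [if_neg hg]
      by_cases hg2 : g ∈ C.erase e
      · rw [if_pos hg2, if_pos hg2]
        exact Finset.mem_range.2 (hJ g hg2).1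
      · rw [if_neg hg2, if_neg hg2]; simp
  · intro x hx
    rw [mem_gr] at hx
    have h5 := (hJ x.1 hx.1).2.1
    simp only [hx.1, if_true] at hx
    rw [← hx.2] at h5
    exact h5
  · intro b hb
    simp only [hb, if_true]
    exact (hJ b hb).2.2

omit hp hp1 in
lemma sum_tm {C : Finset G} {e e' : G} (he : e ∈ C) (he' : e' ∈ C.erase e) (i : ℕ) (f : ℕ → ℝ) :
    ∑ j ∈ Fintype.piFinset (tm C e e' i), ∏ b ∈ C.erase e, f (j b) =
      f i * (∑ j ∈ range (i+1), f j) ^ (C.card - 2) := by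
  classical
  have h1 : ∀ j : G → ℕ, ∏ b ∈ C.erase e, f (j b) =
      ∏ b : G, (if b ∈ C.erase e then f (j b) else 1) := by
    intro j
    rw [Finset.prod_ite, Finset.prod_const_one, mul_one]
    congr 1
    ext; simp
  simp only [h1]
  rw [← Finset.prod_univ_sum (tm C e e' i) (fun b x => if b ∈ C.erase e then f x else 1)]
  rw [← Finset.prod_subset (Finset.subset_univ (C.erase e))]
  · rw [← Finset.mul_prod_erase _ _ he']
    congr 1
    · simp [tm, he']
    · rw [Finset.prod_congr rfl (g := fun _ => ∑ j ∈ range (i+1), f j)]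
      · rw [Finset.prod_const, Finset.card_erase_of_mem he', Finset.card_erase_of_mem he]
        rfl
      · intro b hb
        have h2 := Finset.mem_erase.1 hb
        simp only [tm, h2.1, h2.2, if_true, if_false]
  · intro b _ hb
    have hbe : b ≠ e' := fun h => hb (h ▸ he')
    simp only [tm, hb, hbe, if_false, Finset.sum_const, Finset.card_singleton, one_smul]

open Classical in
lemma D2 {R i : ℕ} (hi : i < R) (hsym : ∀ e e', ∃ σ, 𝔖.Symm σ ∧ σ e = e') (e : G) (W : ℝ)
    (hW : ∀ C, 𝔖.Conf C → 11 * wt p (𝔖.Wit R (20 * R + 20) (𝔖.sp C)) ≤ W) :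
    𝔖.uu p R i e - ∑ C ∈ univ.filter (fun C => 𝔖.Conf C ∧ e ∈ C),
      (C.card - 1 : ℕ) * p ^ (C.card - 1) * (𝔖.uu p R i e * (𝔖.phi p R i e *
        (∑ j ∈ range (i+1), 𝔖.phi p R j e) ^ (C.card - 2)) + (i + 1) ^ (C.card - 2) * W)
      ≤ 𝔖.uu p R (i+1) e := by
  have hphi : ∀ j b, 𝔖.phi p R j b = 𝔖.phi p R j e := by
    intro j b
    obtain ⟨σ, h, rfl⟩ := hsym e b
    exact h.phi p R j e
  have key : ∀ Z, ind (¬ 𝔖.Bl (𝔖.Mt Z i) e) - ∑ C ∈ univ.filter (fun C => 𝔖.Conf C ∧ e ∈ C),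
      ∑ e' ∈ C.erase e, ∑ j ∈ Fintype.piFinset (tm C e e' i),
        ind (gr (C.erase e) j ⊆ Z ∧ ¬ 𝔖.Bl (𝔖.Mt Z i) e ∧
          ∀ b ∈ C.erase e, 𝔖.Compat (𝔖.Mt Z (j b)) b) ≤ ind (¬ 𝔖.Bl (𝔖.Mt Z (i+1)) e) := by
    intro Z
    have hnn : 0 ≤ ∑ C ∈ univ.filter (fun C => 𝔖.Conf C ∧ e ∈ C),
      ∑ e' ∈ C.erase e, ∑ j ∈ Fintype.piFinset (tm C e e' i),
        ind (gr (C.erase e) j ⊆ Z ∧ ¬ 𝔖.Bl (𝔖.Mt Z i) e ∧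
          ∀ b ∈ C.erase e, 𝔖.Compat (𝔖.Mt Z (j b)) b) :=
      Finset.sum_nonneg fun _ _ => Finset.sum_nonneg fun _ _ => Finset.sum_nonneg fun _ _ =>
        ind_nonneg _
    by_cases h1 : 𝔖.Bl (𝔖.Mt Z i) e
    · rw [ind_false (not_not.2 h1)]
      have := ind_nonneg (¬ 𝔖.Bl (𝔖.Mt Z (i+1)) e)
      linarith
    · by_cases h2 : 𝔖.Bl (𝔖.Mt Z (i+1)) e
      · have h3 := 𝔖.bl_step h1 h2
        obtain ⟨C, hC, he, e', he', j, hj, hE⟩ := h3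
        have h4 : (1:ℝ) ≤ ∑ C ∈ univ.filter (fun C => 𝔖.Conf C ∧ e ∈ C),
            ∑ e' ∈ C.erase e, ∑ j ∈ Fintype.piFinset (tm C e e' i),
            ind (gr (C.erase e) j ⊆ Z ∧ ¬ 𝔖.Bl (𝔖.Mt Z i) e ∧
            ∀ b ∈ C.erase e, 𝔖.Compat (𝔖.Mt Z (j b)) b) := by
          rw [← ind_true hE]
          refine le_trans ?_ (Finset.single_le_sum (fun _ _ => Finset.sum_nonneg fun _ _ =>
            Finset.sum_nonneg fun _ _ => ind_nonneg _)
            (Finset.mem_filter.2 ⟨Finset.mem_univ C, hC, he⟩))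
          refine le_trans ?_ (Finset.single_le_sum (fun _ _ =>
            Finset.sum_nonneg fun _ _ => ind_nonneg _) he')
          exact Finset.single_le_sum (f := fun j => ind (gr (C.erase e) j ⊆ Z ∧
            ¬ 𝔖.Bl (𝔖.Mt Z i) e ∧ ∀ b ∈ C.erase e, 𝔖.Compat (𝔖.Mt Z (j b)) b))
            (fun _ _ => ind_nonneg _) hj
        rw [ind_false (not_not.2 h2)]
        have := ind_le_one (¬ 𝔖.Bl (𝔖.Mt Z i) e)
        linarith
      · rw [ind_true h1, ind_true h2]; linarith
  have h5 := ev_mono hp hp1 (Ω := Om G R) (fun Z _ => key Z)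
  rw [ev_sub, ev_sum] at h5
  refine le_trans ?_ h5
  apply sub_le_sub_left
  apply Finset.sum_le_sum
  intro C hC
  obtain ⟨hC, he⟩ := (Finset.mem_filter.1 hC).2
  rw [ev_sum]
  have h6 : ∀ e' ∈ C.erase e, ev p (Om G R) (fun Z => ∑ j ∈ Fintype.piFinset (tm C e e' i),
        ind (gr (C.erase e) j ⊆ Z ∧ ¬ 𝔖.Bl (𝔖.Mt Z i) e ∧
          ∀ b ∈ C.erase e, 𝔖.Compat (𝔖.Mt Z (j b)) b)) ≤
      p ^ (C.card - 1) * (𝔖.uu p R i e * (𝔖.phi p R i e *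
        (∑ j ∈ range (i+1), 𝔖.phi p R j e) ^ (C.card - 2)) + (i + 1) ^ (C.card - 2) * W) := by
    intro e' he'
    rw [ev_sum]
    have h7 : ∀ j ∈ Fintype.piFinset (tm C e e' i), ev p (Om G R) (fun Z =>
        ind (gr (C.erase e) j ⊆ Z ∧ ¬ 𝔖.Bl (𝔖.Mt Z i) e ∧
          ∀ b ∈ C.erase e, 𝔖.Compat (𝔖.Mt Z (j b)) b)) ≤
        p ^ (C.card - 1) * (𝔖.uu p R i e * (∏ b ∈ C.erase e, 𝔖.phi p R (j b) e) +
          (∏ b ∈ C.erase e, (fun _ : ℕ => (1:ℝ)) (j b)) * W) := by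
      intro j hj
      rw [Fintype.mem_piFinset] at hj
      have h8 := 𝔖.D2core hp hp1 hi hC j he he' (by simpa [tm] using hj e') (by
        intro b hb
        have := hj b
        unfold tm at this
        split_ifs at this <;> simp at this <;> omega)
      refine h8.trans ?_
      simp only [hphi, Finset.prod_const_one, one_mul]
      gcongr
      exact hW C hC
    refine (Finset.sum_le_sum h7).trans ?_
    rw [← Finset.mul_sum, Finset.sum_add_distrib, ← Finset.mul_sum, ← Finset.sum_mul]
    rw [sum_tm he he' i (fun j => 𝔖.phi p R j e), sum_tm he he' i (fun _ => 1)]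
    simp
  refine (Finset.sum_le_sum h6).trans ?_
  rw [Finset.sum_const, Finset.card_erase_of_mem he, nsmul_eq_mul, mul_assoc]

end Sys
end Five8


namespace Five8

open Finset

variable {G P : Type} [Fintype G] [DecidableEq G] [Fintype P] [DecidableEq P]

/-- a big constant -/
noncomputable def KB (b : ℕ) : ℝ := 2 ^ ((1 * b ^ 9 : ℕ))

lemma KB_pos (b : ℕ) : 0 < KB b := by unfold KB; positivity

lemma D2_arith (K : ℝ) {N p η c u φ Φ W : ℝ} {R i s : ℕ} (hKB : 0 ≤ K) (hN : 0 ≤ N)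
    (hs : s ≤ 10) (hs2 : 2 ≤ s) (hp : 0 ≤ p) (hη : 0 ≤ η) (hc : 0 < c) (hc1 : c ≤ 1)
    (hpN : p * N ^ 7 ≤ η / c) (hS : η * Φ ≤ 2) (hu0 : 0 ≤ u) (hφ0 : 0 ≤ φ) (hΦ0 : 0 ≤ Φ)
    (hW0 : 0 ≤ W) (hR1 : (1:ℝ) ≤ R) (hiR : (i:ℝ) + 1 ≤ R) :
    K * N ^ (7 * (s - 1)) * (((s - 1 : ℕ) : ℝ) * p ^ (s - 1) * (u * (φ * Φ ^ (s - 2)) +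
    (i + 1) ^ (s - 2) * W)) ≤ u * (9 * K * 2 ^ 8 / c ^ 9 * (η * φ)) +
            9 * K * (1 + η / c) ^ 9 * (R : ℝ) ^ 8 * W := by
  set θ := η / c with hθ
  have hθ0 : 0 ≤ θ := by positivity
  obtain ⟨k, rfl⟩ : ∃ k, s = k + 2 := ⟨s - 2, by omega⟩
  have e1 : k + 2 - 1 = k + 1 := by omega
  have e2 : k + 2 - 2 = k := by omega
  simp only [e1, e2]
  have hk : k ≤ 8 := by omega
  have h5 : (p * N ^ 7) ^ (k + 1) ≤ θ ^ (k + 1) := by gcongr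
  have h6 : K * N ^ (7 * (k + 1)) * (((k + 1 : ℕ) : ℝ) * p ^ (k + 1) *
      (u * (φ * Φ ^ k) + (i + 1) ^ k * W)) =
      K * (k + 1 : ℕ) * (p * N ^ 7) ^ (k + 1) * (u * (φ * Φ ^ k) + (i + 1) ^ k * W) := by
    rw [mul_pow, ← pow_mul]; ring
  rw [h6]
  have h7 : (((k + 1 : ℕ)) : ℝ) ≤ 9 := by exact_mod_cast (by omega : k + 1 ≤ 9)
  have h8 : θ ^ (k + 1) * Φ ^ k ≤ η * (2 ^ 8 / c ^ 9) := by
    have : θ ^ (k + 1) * Φ ^ k = η * ((η * Φ) ^ k / c ^ (k + 1)) := by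
      rw [hθ, div_pow, mul_pow, pow_succ η]; field_simp
    rw [this]
    apply mul_le_mul_of_nonneg_left _ hη
    apply div_le_div₀ (by positivity) _ (by positivity)
    · exact pow_le_pow_of_le_one hc.le hc1 (by omega)
    · calc (η * Φ) ^ k ≤ 2 ^ k := by gcongr
        _ ≤ 2 ^ 8 := pow_le_pow_right₀ (by norm_num) hk
  have h9 : θ ^ (k + 1) * ((i:ℝ) + 1) ^ k ≤ (1 + θ) ^ 9 * (R : ℝ) ^ 8 := by
    apply mul_le_mul _ _ (by positivity) (by positivity)
    · calc θ ^ (k+1) ≤ (1 + θ) ^ (k + 1) := by gcongr; linarith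
        _ ≤ _ := pow_le_pow_right₀ (by linarith) (by omega)
    · calc ((i:ℝ) + 1) ^ k ≤ (R:ℝ) ^ k := by gcongr
        _ ≤ _ := pow_le_pow_right₀ hR1 hk
  calc _ ≤ K * 9 * θ ^ (k + 1) * (u * (φ * Φ ^ k) + (i + 1) ^ k * W) := by
        gcongr
    _ = K * 9 * (u * φ) * (θ ^ (k + 1) * Φ ^ k) +
        K * 9 * W * (θ ^ (k + 1) * (i + 1) ^ k) := by ring
    _ ≤ K * 9 * (u * φ) * (η * (2 ^ 8 / c ^ 9)) +
        K * 9 * W * ((1 + θ) ^ 9 * (R : ℝ) ^ 8) := by gcongr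
    _ = _ := by ring


namespace Sys
variable (𝔖 : Sys G P)

lemma count_span [Nonempty P] (P₀ : Finset P) (w b : ℕ) (hb : P₀.card + w ≤ b)
    (ℱ : Finset (Finset G)) (h : ∀ Q ∈ ℱ, (𝔖.sp Q \ P₀).card ≤ w) :
    (ℱ.card : ℝ) ≤ KB b * (Fintype.card P : ℝ) ^ w := by
  have h1 := 𝔖.count_families (univ : Finset G) id 1 (by
    intro X; rw [one_mul]; exact 𝔖.count X) P₀ w ℱ (by
    intro Q hQ
    exact ⟨Finset.subset_univ _, by rw [Finset.image_id]; exact h Q hQ⟩)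
  have h2 : (ℱ.card : ℝ) ≤ (Fintype.card P : ℝ) ^ w * 2 ^ (1 * (P₀.card + w) ^ 9) := by
    exact_mod_cast h1
  refine h2.trans ?_
  rw [mul_comm]
  unfold KB
  gcongr
  norm_num

attribute [irreducible] KB

lemma Conf.card_sp {C : Finset G} (h : 𝔖.Conf C) : (𝔖.sp C).card = 7 * C.card + 2 := by
  have := h.2.2.1
  unfold H at this
  omega

/-- rate constant -/
noncomputable def lam (c : ℝ) : ℝ := 72 * KB 100 * 2 ^ 8 / c ^ 9

/-- error constant -/
noncomputable def Kerr (R : ℕ) (θ : ℝ) : ℝ :=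
  72 * KB 100 * (1 + θ) ^ 9 * (R : ℝ) ^ 8 * (11 * KW R (20 * R + 20) 90 θ) +
    20 * KW R (20 * R + 20) 9 θ

lemma Kerr_nonneg (R : ℕ) {θ : ℝ} (h : 0 ≤ θ) : 0 ≤ Kerr R θ := by
  have := KW_nonneg R (20 * R + 20) 90 h
  have := KW_nonneg R (20 * R + 20) 9 h
  have := KB_pos 100
  unfold Kerr; positivity

lemma lam_pos {c : ℝ} (h : 0 < c) : 0 < lam c := by
  have := KB_pos 100
  unfold lam; positivity

variable {p : ℝ} (hp : 0 ≤ p) (hp1 : p ≤ 1)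
include hp hp1

set_option maxHeartbeats 1000000 in
lemma D2' [Nonempty P] {R i : ℕ} (hi : i < R) (hsym : ∀ e e', ∃ σ, 𝔖.Symm σ ∧ σ e = e') (e : G)
    {η c : ℝ} (hη : 0 ≤ η) (hc : 0 < c) (hc1 : c ≤ 1)
    (hpN : p * (Fintype.card P : ℝ) ^ 7 ≤ η / c)
    (hS : η * ∑ j ∈ range (i+1), 𝔖.phi p R j e ≤ 2) :
    𝔖.uu p R i e * (1 - lam c * (η * 𝔖.phi p R i e)) - Kerr R (η / c) / Fintype.card P ≤
      𝔖.uu p R (i+1) e := by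
  classical
  have hN : (0 : ℝ) < Fintype.card P := by exact_mod_cast Fintype.card_pos
  set N : ℝ := ((Fintype.card P : ℕ) : ℝ) with hNdef
  set θ := η / c with hθ
  have hθ0 : 0 ≤ θ := by positivity
  set W := 11 * (KW R (20 * R + 20) 90 θ / N) with hWdef
  have hK90 := KW_nonneg R (20 * R + 20) 90 hθ0
  have hK9 := KW_nonneg R (20 * R + 20) 9 hθ0
  have hKB := KB_pos 100
  have hW0 : 0 ≤ W := by positivity
  have h1 := 𝔖.D2 hp hp1 hi hsym e W (by
    intro C hC
    have := 𝔖.wt_Wit_le R (20 * R + 20) 90 (𝔖.sp C) (by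
      rw [hC.card_sp]; have := hC.2.1; omega) hp hpN
    rw [hWdef]; linarith)
  refine le_trans ?_ h1
  set u := 𝔖.uu p R i e with hu
  set φ := 𝔖.phi p R i e with hφ
  set Φ := ∑ j ∈ range (i+1), 𝔖.phi p R j e with hΦ
  have hu0 : 0 ≤ u := 𝔖.uu_nonneg hp hp1 R i e
  have hφ0 : 0 ≤ φ := 𝔖.phi_nonneg hp hp1 R i e
  have hΦ0 : 0 ≤ Φ := Finset.sum_nonneg fun j _ => 𝔖.phi_nonneg hp hp1 R j e
  have hR1 : (1:ℝ) ≤ R := by exact_mod_cast (by omega : 1 ≤ R)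
  have hiR : (i:ℝ) + 1 ≤ R := by exact_mod_cast (by omega : i + 1 ≤ R)
  set F : ℕ → ℝ := fun s => (s - 1 : ℕ) * p ^ (s - 1) * (u * (φ * Φ ^ (s - 2)) +
    (i + 1) ^ (s - 2) * W) with hF
  have hF0 : ∀ s, 0 ≤ F s := fun s => by simp only [hF]; positivity
  have h2 : ∑ C ∈ univ.filter (fun C => 𝔖.Conf C ∧ e ∈ C), F C.card ≤
      u * (lam c * (η * φ)) + 72 * KB 100 * (1 + θ) ^ 9 * (R : ℝ) ^ 8 * W := by
    rw [← Finset.sum_fiberwise_of_maps_to (t := Finset.Icc 3 10) (g := Finset.card)]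
    · have h3 : ∀ s ∈ Finset.Icc 3 10,
          ∑ C ∈ (univ.filter (fun C => 𝔖.Conf C ∧ e ∈ C)).filter (fun C => C.card = s), F C.card
          ≤ u * (9 * KB 100 * 2 ^ 8 / c ^ 9 * (η * φ)) +
            9 * KB 100 * (1 + θ) ^ 9 * (R : ℝ) ^ 8 * W := by
        intro s hs
        rw [Finset.mem_Icc] at hs
        rw [Finset.sum_congr rfl (g := fun _ => F s) (by
          intro C hC; rw [(Finset.mem_filter.1 hC).2])]
        rw [Finset.sum_const, nsmul_eq_mul]
        have h4 := 𝔖.count_span (𝔖.supp e) (7 * (s - 1)) 100 (by rw [𝔖.card_supp]; omega)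
          ((univ.filter (fun C => 𝔖.Conf C ∧ e ∈ C)).filter (fun C => C.card = s)) (by
            intro Q hQ
            simp only [Finset.mem_filter, Finset.mem_univ, true_and] at hQ
            rw [Finset.card_sdiff_of_subset (𝔖.supp_sub_sp hQ.1.2), hQ.1.1.card_sp, 𝔖.card_supp]
            omega)
        refine (mul_le_mul_of_nonneg_right h4 (hF0 s)).trans ?_
        exact D2_arith (KB 100) hKB.le hN.le hs.2 (by omega) hp hη hc hc1 hpN hS hu0 hφ0 hΦ0 hW0 hR1 hiR
      refine (Finset.sum_le_sum h3).trans (le_of_eq ?_)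
      rw [Finset.sum_const, nsmul_eq_mul]
      simp only [Nat.card_Icc, lam]
      push_cast
      ring
    · intro C hC
      simp only [Finset.mem_filter, Finset.mem_univ, true_and] at hC
      exact Finset.mem_Icc.2 ⟨hC.1.1, hC.1.2.1⟩
  have h10 : 72 * KB 100 * (1 + θ) ^ 9 * (R : ℝ) ^ 8 * W ≤ Kerr R θ / N := by
    rw [le_div_iff₀ hN]
    unfold Kerr
    have : 72 * KB 100 * (1 + θ) ^ 9 * (R : ℝ) ^ 8 * W * N =
      72 * KB 100 * (1 + θ) ^ 9 * (R : ℝ) ^ 8 * (11 * KW R (20 * R + 20) 90 θ) := by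
      rw [hWdef]; field_simp
    rw [this]; linarith
  simp only [hF] at h2
  linarith

lemma D1' [Nonempty P] {R i : ℕ} (hi : i ≤ R) (hsym : ∀ e e', ∃ σ, 𝔖.Symm σ ∧ σ e = e') (e : G)
    {η c D : ℝ} (hη : 0 ≤ η) (hc : 0 < c)
    (hpN : p * (Fintype.card P : ℝ) ^ 7 ≤ η / c) (hpD : p * D = η)
    (hdeg : ∀ v, ((univ.filter (fun g => v ∈ 𝔖.items g)).card : ℝ) ≤ D)
    (hS : η * ∑ j ∈ range i, 𝔖.phi p R j e ≤ 1) :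
    (1 - η * ∑ j ∈ range i, 𝔖.phi p R j e) ^ 19 * 𝔖.uu p R i e
      - Kerr R (η / c) / Fintype.card P ≤ 𝔖.phi p R i e := by
  have hN : (0 : ℝ) < Fintype.card P := by exact_mod_cast Fintype.card_pos
  have hθ0 : 0 ≤ η / c := by positivity
  have hphi : ∀ j b, 𝔖.phi p R j b = 𝔖.phi p R j e := by
    intro j b
    obtain ⟨σ, h, rfl⟩ := hsym e b
    exact h.phi p R j e
  refine le_trans ?_ (𝔖.D1 hp hp1 hi e)
  have h1 := 𝔖.wt_Wit_le R (20 * R + 20) 9 (𝔖.supp e) (𝔖.card_supp e).le hp hpN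
  have h2 : 20 * (KW R (20 * R + 20) 9 (η / c) / Fintype.card P) ≤
      Kerr R (η / c) / Fintype.card P := by
    rw [← mul_div_assoc]
    apply div_le_div_of_nonneg_right _ hN.le
    unfold Kerr
    have := KW_nonneg R (20 * R + 20) 90 hθ0
    have := KB_pos 100
    have : 0 ≤ 72 * KB 100 * (1 + η / c) ^ 9 * (R : ℝ) ^ 8 *
      (11 * KW R (20 * R + 20) 90 (η / c)) := by positivity
    linarith
  set S := ∑ j ∈ range i, 𝔖.phi p R j e with hSdef
  have hS0 : 0 ≤ S := Finset.sum_nonneg fun j _ => 𝔖.phi_nonneg hp hp1 R j e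
  have hx0 : 0 ≤ 1 - η * S := by linarith
  have hx1 : 1 - η * S ≤ 1 := by have := mul_nonneg hη hS0; linarith
  have h3 : (1 - η * S) ^ 19 ≤
      ∏ v ∈ 𝔖.items e, ev p (Om G R) (fun Z => ind (𝔖.Alive (𝔖.Mt Z i) v)) := by
    calc (1 - η * S) ^ 19 ≤ (1 - η * S) ^ (𝔖.items e).card :=
          pow_le_pow_of_le_one hx0 hx1 (𝔖.items_card e)
      _ = ∏ v ∈ 𝔖.items e, (1 - η * S) := by rw [Finset.prod_const]
      _ ≤ _ := by
          apply Finset.prod_le_prod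
          · intro _ _; exact hx0
          · intro v _
            refine le_trans ?_ (𝔖.alive_ge hp hp1 hi v (p * S) (by
              intro g
              rw [← Finset.mul_sum, hSdef]
              simp only [hphi, le_refl]))
            have := mul_le_mul_of_nonneg_right (hdeg v) (mul_nonneg hp hS0)
            have h4 : D * (p * S) = η * S := by rw [← hpD]; ring
            linarith
  have h5 := mul_le_mul_of_nonneg_right h3 (𝔖.uu_nonneg hp hp1 R i e)
  linarith

end Sys

/-- the recursion -/
lemma recursion {ε κ lam η δ : ℝ} {R : ℕ} (φ u : ℕ → ℝ) (hε : 0 < ε) (hε1 : ε ≤ 1)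
    (hlam : 0 < lam) (hη : 0 < η) (hηl : lam * η ≤ 1 / 2) (hη1 : η ≤ 1)
    (hκ : κ = Real.exp (-(2 * lam)) / 2)
    (hδ : 0 ≤ δ) (hδ1 : R * δ ≤ κ) (hδ2 : δ ≤ ε ^ 19 * κ / 2)
    (hT : 1 ≤ R * η * (ε ^ 19 * κ / 2))
    (hφ0 : ∀ i, 0 ≤ φ i) (hφ1 : ∀ i, φ i ≤ 1) (hu0 : u 0 = 1) (hun : ∀ i, 0 ≤ u i)
    (hu1 : ∀ i, u i ≤ 1)
    (h1 : ∀ i < R, η * ∑ j ∈ range i, φ j ≤ 1 →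
      (1 - η * ∑ j ∈ range i, φ j) ^ 19 * u i - δ ≤ φ i)
    (h2 : ∀ i < R, η * ∑ j ∈ range (i+1), φ j ≤ 2 → u i * (1 - lam * (η * φ i)) - δ ≤ u (i+1)) :
    1 - ε ≤ η * ∑ j ∈ range R, φ j := by
  by_contra! hcon
  have hS : ∀ i ≤ R, η * ∑ j ∈ range i, φ j < 1 - ε := by
    intro i hi
    refine lt_of_le_of_lt ?_ hcon
    apply mul_le_mul_of_nonneg_left _ hη.le
    exact Finset.sum_le_sum_of_subset_of_nonneg (Finset.range_mono hi) fun j _ _ => hφ0 j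
  have hκ0 : 0 < κ := by rw [hκ]; positivity
  have hu : ∀ i ≤ R, Real.exp (-(2 * lam * (η * ∑ j ∈ range i, φ j))) - i * δ ≤ u i := by
    intro i
    induction i with
    | zero => intro _; simp [hu0]
    | succ i ih =>
      intro hi
      have ih' := ih (by omega)
      have h3 := h2 i (by omega) (by have := hS (i+1) hi; linarith)
      refine le_trans ?_ h3
      rw [Finset.sum_range_succ]
      set S := ∑ j ∈ range i, φ j
      have hx0 : 0 ≤ lam * (η * φ i) := by have := hφ0 i; positivity
      have hx1 : lam * (η * φ i) ≤ 1/2 := by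
        calc lam * (η * φ i) = lam * η * φ i := by ring
          _ ≤ lam * η * 1 := by gcongr; exact hφ1 i
          _ ≤ 1/2 := by linarith
      set x := lam * (η * φ i) with hx
      have e1 : -(2 * lam * (η * (S + φ i))) = -(2 * lam * (η * S)) + (-(2 * x)) := by
        rw [hx]; ring
      rw [e1, Real.exp_add]
      set A := Real.exp (-(2 * lam * (η * S)))
      have hA : 0 < A := Real.exp_pos _
      have h4 : Real.exp (-(2 * x)) ≤ 1 - x := by
        have h5 : 1 + 2 * x ≤ Real.exp (2 * x) := by
          have := Real.add_one_le_exp (2 * x); linarith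
        rw [Real.exp_neg]
        have h6 : (Real.exp (2 * x))⁻¹ ≤ (1 + 2 * x)⁻¹ := by
          apply inv_anti₀ (by linarith) h5
        refine h6.trans ?_
        rw [inv_le_iff_one_le_mul₀ (by linarith)]
        nlinarith
      have h7 : A * Real.exp (-(2 * x)) ≤ A * (1 - x) := by gcongr
      have h8 : (A - i * δ) * (1 - x) ≤ u i * (1 - x) :=
        mul_le_mul_of_nonneg_right ih' (by linarith)
      have h9 : (i * δ) * (1 - x) ≤ i * δ := by
        have : 0 ≤ (i:ℝ) * δ := by positivity
        nlinarith
      push_cast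
      nlinarith
  have hu' : ∀ i ≤ R, κ ≤ u i := by
    intro i hi
    refine le_trans ?_ (hu i hi)
    have h3 : Real.exp (-(2 * lam)) ≤ Real.exp (-(2 * lam * (η * ∑ j ∈ range i, φ j))) := by
      apply Real.exp_le_exp.2
      have := hS i hi
      have : 2 * lam * (η * ∑ j ∈ range i, φ j) ≤ 2 * lam * 1 := by
        gcongr; linarith
      linarith
    have h4 : (i:ℝ) * δ ≤ κ := by
      refine le_trans ?_ hδ1
      gcongr
    have : Real.exp (-(2 * lam)) = 2 * κ := by rw [hκ]; ring
    linarith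
  have hφ : ∀ i < R, ε ^ 19 * κ / 2 ≤ φ i := by
    intro i hi
    have h3 := hS i hi.le
    have h4 := h1 i hi (by linarith)
    have h5 : ε ^ 19 * κ ≤ (1 - η * ∑ j ∈ range i, φ j) ^ 19 * u i := by
      apply mul_le_mul _ (hu' i hi.le) hκ0.le
      · apply pow_nonneg; linarith
      · apply pow_le_pow_left₀ hε.le; linarith
    linarith
  have h6 : (R:ℝ) * (ε ^ 19 * κ / 2) ≤ ∑ j ∈ range R, φ j := by
    have : ∑ j ∈ range R, (ε ^ 19 * κ / 2) ≤ ∑ j ∈ range R, φ j :=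
      Finset.sum_le_sum fun i hi => hφ i (Finset.mem_range.1 hi)
    rwa [Finset.sum_const, Finset.card_range, nsmul_eq_mul] at this
  have h7 : η * (R * (ε ^ 19 * κ / 2)) ≤ η * ∑ j ∈ range R, φ j := by gcongr
  nlinarith

end Five8


namespace Five8

open Finset

variable {G P : Type} [Fintype G] [DecidableEq G] [Fintype P] [DecidableEq P]

namespace Sys
variable (𝔖 : Sys G P)

lemma prod_card_ite (B : Finset G) (R : ℕ) (t : G → Finset ℕ)
    (h1 : ∀ b ∈ B, (t b).card = R) (h2 : ∀ b, b ∉ B → (t b).card = 1) :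
    (Fintype.piFinset t).card = R ^ B.card := by
  rw [Fintype.card_piFinset]
  rw [← Finset.prod_subset (Finset.subset_univ B) (fun b _ hb => h2 b hb)]
  rw [Finset.prod_congr rfl h1, Finset.prod_const]

/-- the first time a conflict is completed -/
lemma bad_step {Z : Finset (G × ℕ)} {R : ℕ} {C : Finset G} (hC : 𝔖.ConfP C)
    (hs : C ⊆ 𝔖.Mt Z R) : ∃ x ∈ C, ∃ y ∈ C.erase x, ∃ i ∈ range R,
      ∃ j ∈ Fintype.piFinset (fun b => if b ∈ (C.erase x).erase y then range R
        else if b ∈ C then {i} else {0}), gr C j ⊆ Z := by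
  classical
  have hne : C.Nonempty := by
    rw [← Finset.card_pos]; have := hC.card_ge; omega
  have hex : ∃ i, C ⊆ 𝔖.Mt Z i := ⟨R, hs⟩
  obtain ⟨i, hi1, hi2⟩ : ∃ i, C ⊆ 𝔖.Mt Z (i+1) ∧ ¬ C ⊆ 𝔖.Mt Z i := by
    have h1 := Nat.find_spec hex
    have h0 : Nat.find hex ≠ 0 := by
      intro h
      rw [h, Mt_zero, Finset.subset_empty] at h1
      exact hne.ne_empty h1
    obtain ⟨i, hi⟩ := Nat.exists_eq_succ_of_ne_zero h0
    refine ⟨i, ?_, Nat.find_min hex (by omega)⟩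
    rw [hi] at h1; exact h1
  have hiR : i < R := by
    by_contra h
    exact hi2 (hs.trans (𝔖.Mt_mono (by omega)))
  obtain ⟨x, hx, hxn⟩ := Finset.not_subset.1 hi2
  have hnew : ∀ z ∈ C, z ∉ 𝔖.Mt Z i → (z, i) ∈ Z ∧ 𝔖.Compat (𝔖.Mt Z i) z := by
    intro z hz hzn
    rcases 𝔖.mem_Mt_succ.1 (hi1 hz) with h | h
    · exact absurd h hzn
    · exact h
  obtain ⟨y, hy, hyn⟩ := Finset.not_subset.1 ((hnew x hx hxn).2 C hC hx)
  have h4 : ∀ b, b ∈ C → ∃ j < R, (b, j) ∈ Z := by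
    intro b hb
    obtain ⟨j, h1, h2, _⟩ := 𝔖.mem_Mt.1 (hs hb)
    exact ⟨j, h1, h2⟩
  choose! J hJ using h4
  refine ⟨x, hx, y, hy, i, by simpa using hiR, fun b => if b ∈ (C.erase x).erase y then J b
        else if b ∈ C then i else 0, ?_, ?_⟩
  · rw [Fintype.mem_piFinset]
    intro b
    by_cases hb : b ∈ (C.erase x).erase y
    · rw [if_pos hb, if_pos hb]
      exact Finset.mem_range.2
        (hJ b (Finset.mem_of_mem_erase (Finset.mem_of_mem_erase hb))).1
    · rw [if_neg hb, if_neg hb]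
      split_ifs <;> simp
  · rintro ⟨b, k⟩ hb
    rw [mem_gr] at hb
    obtain ⟨hb1, hb2⟩ := hb
    simp only at hb1 hb2
    by_cases hb : b ∈ (C.erase x).erase y
    · rw [if_pos hb] at hb2
      rw [hb2]; exact (hJ b hb1).2
    · rw [if_neg hb, if_pos hb1] at hb2
      rw [hb2]
      have : b = x ∨ b = y := by
        by_contra! h
        exact hb (Finset.mem_erase.2 ⟨h.2, Finset.mem_erase.2 ⟨h.1, hb1⟩⟩)
      rcases this with rfl | rfl
      · exact (hnew b hx hxn).1
      · exact (hnew b (Finset.mem_of_mem_erase hy) hyn).1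

variable {p : ℝ} (hp : 0 ≤ p) (hp1 : p ≤ 1)
include hp hp1

lemma bad_prob {R : ℕ} {C : Finset G} (hC : 𝔖.ConfP C) :
    ev p (Om G R) (fun Z => ind (C ⊆ 𝔖.Mt Z R)) ≤
      (C.card : ℝ) ^ 2 * (R : ℝ) ^ (C.card - 1) * p ^ C.card := by
  classical
  set T : G → G → ℕ → G → Finset ℕ := fun x y i b => if b ∈ (C.erase x).erase y then range R
        else if b ∈ C then {i} else {0} with hT
  have h1 : ∀ Z, ind (C ⊆ 𝔖.Mt Z R) ≤ ∑ x ∈ C, ∑ y ∈ C.erase x, ∑ i ∈ range R,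
      ∑ j ∈ Fintype.piFinset (T x y i), ind (gr C j ⊆ Z) := by
    intro Z
    refine le_trans (ind_mono (𝔖.bad_step hC)) ?_
    refine le_trans (ind_exists_le _ _) (Finset.sum_le_sum fun x _ => ?_)
    refine le_trans (ind_exists_le _ _) (Finset.sum_le_sum fun y _ => ?_)
    refine le_trans (ind_exists_le _ _) (Finset.sum_le_sum fun i _ => ?_)
    exact ind_exists_le _ _
  refine le_trans (ev_mono hp hp1 fun Z _ => h1 Z) ?_
  rw [ev_sum]
  have hc2 := hC.card_ge
  have h2 : ∀ x ∈ C, ev p (Om G R) (fun Z => ∑ y ∈ C.erase x, ∑ i ∈ range R,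
      ∑ j ∈ Fintype.piFinset (T x y i), ind (gr C j ⊆ Z)) ≤
      C.card * ((R:ℝ) * (R ^ (C.card - 2) * p ^ C.card)) := by
    intro x hx
    rw [ev_sum]
    have h3 : ∀ y ∈ C.erase x, ev p (Om G R) (fun Z => ∑ i ∈ range R,
      ∑ j ∈ Fintype.piFinset (T x y i), ind (gr C j ⊆ Z)) ≤
      ((R:ℝ) * (R ^ (C.card - 2) * p ^ C.card)) := by
      intro y hy
      rw [ev_sum]
      have h4 : ∀ i ∈ range R, ev p (Om G R) (fun Z =>
        ∑ j ∈ Fintype.piFinset (T x y i), ind (gr C j ⊆ Z)) ≤ (R ^ (C.card - 2) * p ^ C.card) := by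
        intro i _
        rw [ev_sum]
        have h5 : ∀ j ∈ Fintype.piFinset (T x y i), ev p (Om G R) (fun Z => ind (gr C j ⊆ Z)) ≤
            p ^ C.card := by
          intro j _
          have := ev_subset_le hp (Om G R) (gr C j)
          rwa [card_gr] at this
        refine (Finset.sum_le_sum h5).trans ?_
        rw [Finset.sum_const, nsmul_eq_mul, prod_card_ite ((C.erase x).erase y) R (T x y i)
          (by intro b hb; simp only [hT, if_pos hb, Finset.card_range])
          (by intro b hb; simp only [hT, if_neg hb]; split_ifs <;> simp),
          Finset.card_erase_of_mem hy, Finset.card_erase_of_mem hx]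
        push_cast
        rfl
      refine (Finset.sum_le_sum h4).trans ?_
      rw [Finset.sum_const, nsmul_eq_mul, Finset.card_range]
    refine (Finset.sum_le_sum h3).trans ?_
    rw [Finset.sum_const, nsmul_eq_mul]
    gcongr
    exact Finset.erase_subset _ _
  refine (Finset.sum_le_sum h2).trans ?_
  rw [Finset.sum_const, nsmul_eq_mul]
  obtain ⟨k, hk⟩ : ∃ k, C.card = k + 2 := ⟨C.card - 2, by omega⟩
  rw [hk]
  have e1 : k + 2 - 1 = k + 1 := by omega
  have e2 : k + 2 - 2 = k := by omega
  rw [e1, e2, pow_succ (R:ℝ) k]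
  apply le_of_eq; ring

lemma sel_prob {R : ℕ} (C : Finset G) :
    ev p (Om G R) (fun Z => ind (C ⊆ 𝔖.Mt Z R)) ≤ (R : ℝ) ^ C.card * p ^ C.card := by
  classical
  set T : G → Finset ℕ := fun b => if b ∈ C then range R else {0} with hT
  have h1 : ∀ Z, ind (C ⊆ 𝔖.Mt Z R) ≤ ∑ j ∈ Fintype.piFinset T, ind (gr C j ⊆ Z) := by
    intro Z
    refine le_trans (ind_mono ?_) (ind_exists_le _ _)
    intro hs
    have h4 : ∀ b, b ∈ C → ∃ j < R, (b, j) ∈ Z := by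
      intro b hb
      obtain ⟨j, h1, h2, _⟩ := 𝔖.mem_Mt.1 (hs hb)
      exact ⟨j, h1, h2⟩
    choose! J hJ using h4
    refine ⟨fun b => if b ∈ C then J b else 0, ?_, ?_⟩
    · rw [Fintype.mem_piFinset]
      intro b
      by_cases hb : b ∈ C
      · simp only [hT, if_pos hb, Finset.mem_range]; exact (hJ b hb).1
      · simp only [hT, if_neg hb, Finset.mem_singleton]
    · rintro ⟨b, k⟩ hb
      rw [mem_gr] at hb
      obtain ⟨hb1, hb2⟩ := hb
      simp only at hb1 hb2
      rw [if_pos hb1] at hb2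
      rw [hb2]; exact (hJ b hb1).2
  refine le_trans (ev_mono hp hp1 fun Z _ => h1 Z) ?_
  rw [ev_sum]
  have h5 : ∀ j ∈ Fintype.piFinset T, ev p (Om G R) (fun Z => ind (gr C j ⊆ Z)) ≤
      p ^ C.card := by
    intro j _
    have := ev_subset_le hp (Om G R) (gr C j)
    rwa [card_gr] at this
  refine (Finset.sum_le_sum h5).trans ?_
  rw [Finset.sum_const, nsmul_eq_mul, prod_card_ite C R T
    (by intro b hb; simp only [hT, if_pos hb, Finset.card_range])
    (by intro b hb; simp only [hT, if_neg hb]; simp)]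
  push_cast
  rfl

/-- a rare configuration -/
def Rare (Γ : Finset G) : Prop := 2 ≤ Γ.card ∧ Γ.card ≤ 10 ∧ (𝔖.sp Γ).card ≤ 7 * Γ.card + 1

open Classical in
lemma sum_bad [Nonempty P] {R : ℕ} (hR : 1 ≤ R) {T c : ℝ} (hT : 0 ≤ T) (hc : 0 < c)
    (hpN : p * (Fintype.card P : ℝ) ^ 7 ≤ T / R / c) :
    ∑ C ∈ univ.filter 𝔖.ConfP, ev p (Om G R) (fun Z => ind (C ⊆ 𝔖.Mt Z R)) ≤
      900 * KB 100 * (1 + T / c) ^ 10 / R * (Fintype.card P : ℝ) ^ 2 := by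
  have hR0 : (0:ℝ) < R := by exact_mod_cast hR
  have hN : (0 : ℝ) < Fintype.card P := by exact_mod_cast Fintype.card_pos
  have hKB := KB_pos 100
  rw [← Finset.sum_fiberwise_of_maps_to (t := Finset.Icc 2 10) (g := Finset.card)]
  · have h3 : ∀ s ∈ Finset.Icc 2 10,
        ∑ C ∈ (univ.filter 𝔖.ConfP).filter (fun C => C.card = s),
          ev p (Om G R) (fun Z => ind (C ⊆ 𝔖.Mt Z R))
        ≤ 100 * KB 100 * (1 + T / c) ^ 10 / R * (Fintype.card P : ℝ) ^ 2 := by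
      intro s hs
      rw [Finset.mem_Icc] at hs
      have h1 : ∀ C ∈ (univ.filter 𝔖.ConfP).filter (fun C => C.card = s),
          ev p (Om G R) (fun Z => ind (C ⊆ 𝔖.Mt Z R)) ≤ 100 * (R:ℝ) ^ (s - 1) * p ^ s := by
        intro C hC
        simp only [Finset.mem_filter, Finset.mem_univ, true_and] at hC
        have := 𝔖.bad_prob hp hp1 (R := R) hC.1
        rw [hC.2] at this
        refine this.trans ?_
        gcongr
        have : (s:ℝ) ≤ 10 := by exact_mod_cast hs.2
        nlinarith
      refine (Finset.sum_le_sum h1).trans ?_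
      rw [Finset.sum_const, nsmul_eq_mul]
      have h4 := 𝔖.count_span ∅ (7 * s + 2) 100 (by simp; omega)
        ((univ.filter 𝔖.ConfP).filter (fun C => C.card = s)) (by
          intro Q hQ
          simp only [Finset.mem_filter, Finset.mem_univ, true_and] at hQ
          have h5 := hQ.1.H_le
          unfold H at h5
          rw [Finset.sdiff_empty]
          omega)
      refine (mul_le_mul_of_nonneg_right h4 (by positivity)).trans ?_
      obtain ⟨k, rfl⟩ : ∃ k, s = k + 1 := ⟨s - 1, by omega⟩
      rw [Nat.add_sub_cancel]
      have h5 : (p * (Fintype.card P : ℝ) ^ 7) ^ (k + 1) ≤ (T / R / c) ^ (k + 1) := by gcongr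
      have h6 : (T / R / c) ^ (k + 1) * (R:ℝ) ^ k ≤ (1 + T / c) ^ 10 / R := by
        have e1 : (T / R / c) ^ (k + 1) * (R:ℝ) ^ k = (T / c) ^ (k + 1) / R := by
          rw [div_pow, div_pow, div_pow, pow_succ (R:ℝ)]; field_simp
        rw [e1]
        gcongr
        calc (T / c) ^ (k + 1) ≤ (1 + T / c) ^ (k + 1) := by gcongr; linarith
          _ ≤ _ := pow_le_pow_right₀ (by have : 0 ≤ T / c := by positivity
                                         linarith) (by omega)
      calc _ = 100 * KB 100 * (Fintype.card P : ℝ) ^ 2 *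
            ((p * (Fintype.card P : ℝ) ^ 7) ^ (k + 1) * (R:ℝ) ^ k) := by
            rw [mul_pow, ← pow_mul, pow_add]; ring
        _ ≤ 100 * KB 100 * (Fintype.card P : ℝ) ^ 2 * ((T / R / c) ^ (k + 1) * (R:ℝ) ^ k) := by
            gcongr
        _ ≤ 100 * KB 100 * (Fintype.card P : ℝ) ^ 2 * ((1 + T / c) ^ 10 / R) := by gcongr
        _ = _ := by ring
    refine (Finset.sum_le_sum h3).trans (le_of_eq ?_)
    rw [Finset.sum_const, nsmul_eq_mul]
    simp only [Nat.card_Icc]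
    push_cast
    ring
  · intro C hC
    simp only [Finset.mem_filter, Finset.mem_univ, true_and] at hC
    exact Finset.mem_Icc.2 ⟨hC.card_ge, hC.card_le⟩

open Classical in
lemma sum_rare [Nonempty P] {R : ℕ} (hR : 1 ≤ R) {T c : ℝ} (hT : 0 ≤ T) (hc : 0 < c)
    (hpN : p * (Fintype.card P : ℝ) ^ 7 ≤ T / R / c) :
    ∑ C ∈ univ.filter 𝔖.Rare, ev p (Om G R) (fun Z => ind (C ⊆ 𝔖.Mt Z R)) ≤
      9 * KB 100 * (1 + T / c) ^ 10 * (Fintype.card P : ℝ) := by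
  have hR0 : (0:ℝ) < R := by exact_mod_cast hR
  have hN : (0 : ℝ) < Fintype.card P := by exact_mod_cast Fintype.card_pos
  have hKB := KB_pos 100
  rw [← Finset.sum_fiberwise_of_maps_to (t := Finset.Icc 2 10) (g := Finset.card)]
  · have h3 : ∀ s ∈ Finset.Icc 2 10,
        ∑ C ∈ (univ.filter 𝔖.Rare).filter (fun C => C.card = s),
          ev p (Om G R) (fun Z => ind (C ⊆ 𝔖.Mt Z R))
        ≤ KB 100 * (1 + T / c) ^ 10 * (Fintype.card P : ℝ) := by
      intro s hs
      rw [Finset.mem_Icc] at hs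
      have h1 : ∀ C ∈ (univ.filter 𝔖.Rare).filter (fun C => C.card = s),
          ev p (Om G R) (fun Z => ind (C ⊆ 𝔖.Mt Z R)) ≤ (R:ℝ) ^ s * p ^ s := by
        intro C hC
        simp only [Finset.mem_filter, Finset.mem_univ, true_and] at hC
        have := 𝔖.sel_prob hp hp1 (R := R) C
        rwa [hC.2] at this
      refine (Finset.sum_le_sum h1).trans ?_
      rw [Finset.sum_const, nsmul_eq_mul]
      have h4 := 𝔖.count_span ∅ (7 * s + 1) 100 (by simp; omega)
        ((univ.filter 𝔖.Rare).filter (fun C => C.card = s)) (by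
          intro Q hQ
          simp only [Finset.mem_filter, Finset.mem_univ, true_and] at hQ
          have h5 := hQ.1.2.2
          rw [Finset.sdiff_empty]
          omega)
      refine (mul_le_mul_of_nonneg_right h4 (by positivity)).trans ?_
      have h5 : (p * (Fintype.card P : ℝ) ^ 7) ^ s ≤ (T / R / c) ^ s := by gcongr
      have h6 : (T / R / c) ^ s * (R:ℝ) ^ s ≤ (1 + T / c) ^ 10 := by
        have e1 : (T / R / c) ^ s * (R:ℝ) ^ s = (T / c) ^ s := by
          rw [← mul_pow]; congr 1; field_simp
        rw [e1]
        calc (T / c) ^ s ≤ (1 + T / c) ^ s := by gcongr; linarith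
          _ ≤ _ := pow_le_pow_right₀ (by have : 0 ≤ T / c := by positivity
                                         linarith) (by omega)
      calc _ = KB 100 * (Fintype.card P : ℝ) *
            ((p * (Fintype.card P : ℝ) ^ 7) ^ s * (R:ℝ) ^ s) := by
            rw [mul_pow, ← pow_mul, pow_add]; ring
        _ ≤ KB 100 * (Fintype.card P : ℝ) * ((T / R / c) ^ s * (R:ℝ) ^ s) := by
            gcongr
        _ ≤ KB 100 * (Fintype.card P : ℝ) * ((1 + T / c) ^ 10) := by gcongr
        _ = _ := by ring
    refine (Finset.sum_le_sum h3).trans (le_of_eq ?_)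
    rw [Finset.sum_const, nsmul_eq_mul]
    simp only [Nat.card_Icc]
    push_cast
    ring
  · intro C hC
    simp only [Finset.mem_filter, Finset.mem_univ, true_and] at hC
    exact Finset.mem_Icc.2 ⟨hC.1, hC.2.1⟩

end Sys
end Five8


namespace Five8

open Finset

variable {G P : Type} [Fintype G] [DecidableEq G] [Fintype P] [DecidableEq P]

namespace Sys
variable (𝔖 : Sys G P)

/-- the good property of a matching -/
def Good (M : Finset G) : Prop :=
  (∀ g ∈ M, ∀ g' ∈ M, g ≠ g' → ∀ v ∈ 𝔖.items g, v ∉ 𝔖.items g') ∧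
  ∀ Γ ⊆ M, 2 ≤ Γ.card → Γ.card ≤ 10 → (𝔖.sp Γ).card ≤ 7 * Γ.card + 2 →
    (𝔖.sp Γ).card = 7 * Γ.card + 2 ∧
    ∃ g ∈ Γ, ∃ g' ∈ Γ, g ≠ g' ∧ (𝔖.supp g ∩ 𝔖.supp g').card = 2

lemma good_of {M : Finset G} (h1 : ∀ C, 𝔖.ConfP C → ¬ C ⊆ M) (h2 : ∀ C, 𝔖.Rare C → ¬ C ⊆ M) :
    𝔖.Good M := by
  classical
  refine ⟨?_, ?_⟩
  · intro g hg g' hg' hne v hv hv'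
    apply h1 {g, g'} (Or.inr ⟨g, g', hne, rfl, v, hv, hv'⟩)
    intro x hx
    simp only [Finset.mem_insert, Finset.mem_singleton] at hx
    rcases hx with rfl | rfl <;> assumption
  · intro Γ hΓ hc2 hc10 hsp
    have key : ∀ Γ' ⊆ Γ, 2 ≤ Γ'.card → 2 ≤ 𝔖.H Γ' := by
      intro Γ' hs hc
      by_contra hlt
      apply h2 Γ' _ (hs.trans hΓ)
      refine ⟨hc, (Finset.card_le_card hs).trans hc10, ?_⟩
      unfold H at hlt
      omega
    have hΓ2 := key Γ (Finset.Subset.refl _) hc2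
    refine ⟨by unfold H at hΓ2; omega, ?_⟩
    obtain ⟨Γ', hΓ', hmin⟩ := Finset.exists_min_image
      (Γ.powerset.filter (fun X => 2 ≤ X.card ∧ 𝔖.H X ≤ 2)) Finset.card
      ⟨Γ, by simp only [Finset.mem_filter, Finset.mem_powerset, Finset.Subset.refl, true_and]
             exact ⟨hc2, by unfold H; omega⟩⟩
    simp only [Finset.mem_filter, Finset.mem_powerset] at hΓ' hmin
    obtain ⟨hs, hc, hH⟩ := hΓ'
    have hH2 := key Γ' hs hc
    by_cases h3 : 3 ≤ Γ'.card
    · exfalso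
      apply h1 Γ' (Or.inl ⟨h3, (Finset.card_le_card hs).trans hc10, le_antisymm hH hH2, ?_⟩)
        (hs.trans hΓ)
      intro Δ hΔ hcΔ
      by_contra hlt
      have := hmin Δ ⟨hΔ.1.trans hs, hcΔ, by omega⟩
      have := Finset.card_lt_card hΔ
      omega
    · obtain ⟨g, g', hne, rfl⟩ := Finset.card_eq_two.1 (by omega : Γ'.card = 2)
      refine ⟨g, hs (by simp), g', hs (by simp), hne, ?_⟩
      have h4 := Finset.card_union_add_card_inter (𝔖.supp g) (𝔖.supp g')
      rw [𝔖.card_supp, 𝔖.card_supp] at h4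
      unfold H at hH hH2
      rw [sp_pair, Finset.card_pair hne] at hH hH2
      push_cast at hH hH2
      omega

variable {p : ℝ} (hp : 0 ≤ p) (hp1 : p ≤ 1)
include hp hp1

lemma delete [Nonempty P] [Nonempty G] {R : ℕ} (hR : 1 ≤ R) {T c m : ℝ} (hT : 0 ≤ T) (hc : 0 < c)
    (hpN : p * (Fintype.card P : ℝ) ^ 7 ≤ T / R / c)
    (hm : ∀ g, m ≤ ev p (Om G R) (fun Z => ind (g ∈ 𝔖.Mt Z R))) :
    ∃ M, 𝔖.Good M ∧ Fintype.card G * m -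
      900 * KB 100 * (1 + T / c) ^ 10 / R * (Fintype.card P : ℝ) ^ 2
      - 9 * KB 100 * (1 + T / c) ^ 10 * (Fintype.card P : ℝ) ≤ M.card := by
  classical
  obtain ⟨Z, hZ, hle⟩ := exists_ev_le hp hp1 (Om G R) (fun Z =>
    ∑ g : G, ind (g ∈ 𝔖.Mt Z R) - ∑ C ∈ univ.filter 𝔖.ConfP, ind (C ⊆ 𝔖.Mt Z R)
      - ∑ C ∈ univ.filter 𝔖.Rare, ind (C ⊆ 𝔖.Mt Z R))
  rw [ev_sub, ev_sub, ev_sum, ev_sum, ev_sum] at hle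
  have h1 := 𝔖.sum_bad hp hp1 hR hT hc hpN
  have h2 := 𝔖.sum_rare hp hp1 hR hT hc hpN
  have h3 : Fintype.card G * m ≤ ∑ g : G, ev p (Om G R) (fun Z => ind (g ∈ 𝔖.Mt Z R)) := by
    have := Finset.sum_le_sum (s := univ) (fun g _ => hm g)
    rwa [Finset.sum_const, nsmul_eq_mul] at this
  set M0 := 𝔖.Mt Z R with hM0
  have cnt : ∀ (Q : Finset G → Prop), ∑ C ∈ univ.filter Q, ind (C ⊆ M0) =
      ((univ.filter (fun C => Q C ∧ C ⊆ M0)).card : ℝ) := by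
    intro Q
    rw [← Finset.filter_filter, Finset.card_filter]
    push_cast
    apply Finset.sum_congr rfl
    intro C _
    unfold ind
    split_ifs <;> rfl
  have cnt0 : ∑ g : G, ind (g ∈ M0) = (M0.card : ℝ) := by
    rw [Finset.sum_congr rfl (g := fun g => if g ∈ M0 then (1:ℝ) else 0) (by
      intro g _; unfold ind; congr)]
    simp
  rw [cnt, cnt, cnt0] at hle
  set B1 := univ.filter (fun C => 𝔖.ConfP C ∧ C ⊆ M0)
  set B2 := univ.filter (fun C => 𝔖.Rare C ∧ C ⊆ M0)
  have hne : ∀ C ∈ B1 ∪ B2, ∃ x, x ∈ C := by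
    intro C hC
    have : 2 ≤ C.card := by
      rcases Finset.mem_union.1 hC with h | h
      · exact ((Finset.mem_filter.1 h).2.1).card_ge
      · exact (Finset.mem_filter.1 h).2.1.1
    exact Finset.card_pos.1 (by omega)
  choose! f hf using hne
  refine ⟨M0 \ (B1 ∪ B2).image f, 𝔖.good_of ?_ ?_, ?_⟩
  · intro C hC hs
    have hmem : C ∈ B1 ∪ B2 := Finset.mem_union_left _ (Finset.mem_filter.2
      ⟨Finset.mem_univ _, hC, hs.trans Finset.sdiff_subset⟩)
    have := hs (hf C hmem)
    exact (Finset.mem_sdiff.1 this).2 (Finset.mem_image_of_mem f hmem)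
  · intro C hC hs
    have hmem : C ∈ B1 ∪ B2 := Finset.mem_union_right _ (Finset.mem_filter.2
      ⟨Finset.mem_univ _, hC, hs.trans Finset.sdiff_subset⟩)
    have := hs (hf C hmem)
    exact (Finset.mem_sdiff.1 this).2 (Finset.mem_image_of_mem f hmem)
  · have h4 : M0.card ≤ (M0 \ (B1 ∪ B2).image f).card + (B1.card + B2.card) := by
      have a1 := Finset.le_card_sdiff ((B1 ∪ B2).image f) M0
      have a2 := Finset.card_image_le (s := B1 ∪ B2) (f := f)
      have a3 := Finset.card_union_le B1 B2
      omega
    have h5 : (M0.card : ℝ) ≤ (M0 \ (B1 ∪ B2).image f).card + (B1.card + B2.card) := by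
      exact_mod_cast h4
    linarith

end Sys

set_option maxHeartbeats 1000000 in
/-- the abstract matching theorem -/
theorem matching (ε c : ℝ) (hε : 0 < ε) (hε1 : ε ≤ 1) (hc : 0 < c) (hc1 : c ≤ 1) :
    ∃ N₀ : ℕ, ∀ (G P : Type) [Fintype G] [DecidableEq G] [Fintype P] [DecidableEq P]
      (𝔖 : Sys G P) (D : ℝ), N₀ ≤ Fintype.card P → c * (Fintype.card P : ℝ) ^ 7 ≤ D →
      c * (Fintype.card P : ℝ) ^ 2 * D ≤ Fintype.card G →
      (∀ v, ((univ.filter (fun g => v ∈ 𝔖.items g)).card : ℝ) ≤ D) →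
      (∀ e e', ∃ σ, 𝔖.Symm σ ∧ σ e = e') →
      ∃ M, 𝔖.Good M ∧ (1 - 4 * ε) * Fintype.card G ≤ M.card * D := by
  set L := Sys.lam c with hL
  have hL0 : 0 < L := Sys.lam_pos hc
  set κ := Real.exp (-(2 * L)) / 2 with hκ
  have hκ0 : 0 < κ := by rw [hκ]; positivity
  set T := 2 / (ε ^ 19 * κ) with hT
  have hT0 : 0 < T := by rw [hT]; positivity
  have hKB := KB_pos 100
  set A := 900 * KB 100 * (1 + T / c) ^ 10 with hA
  set B := 9 * KB 100 * (1 + T / c) ^ 10 with hB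
  have hA0 : 0 < A := by rw [hA]; positivity
  have hB0 : 0 < B := by rw [hB]; positivity
  obtain ⟨R, hR⟩ := exists_nat_ge (2 * L * T + T + A / (c * ε) + 1)
  have hAc : 0 < A / (c * ε) := by positivity
  have hLT : 0 < 2 * L * T := by positivity
  have hR1' : (1:ℝ) ≤ R := by linarith
  have hR1 : 1 ≤ R := by exact_mod_cast hR1'
  have hR0 : (0:ℝ) < R := by linarith
  set η := T / R with hη
  have hη0 : 0 < η := by rw [hη]; positivity
  have hθ0 : 0 < η / c := by positivity
  have hK := Sys.Kerr_nonneg R hθ0.le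
  set K := Sys.Kerr R (η / c) with hKdef
  obtain ⟨N₀, hN₀⟩ := exists_nat_ge (1 + η / c + T ^ 2 / (c * ε) + B / (c * ε) + K * R / κ +
    K * 2 / (ε ^ 19 * κ))
  refine ⟨N₀, ?_⟩
  intro G P _ _ _ _ 𝔖 D hN hD hG hdeg hsym
  have hNr : (N₀ : ℝ) ≤ Fintype.card P := by exact_mod_cast hN
  set N : ℝ := ((Fintype.card P : ℕ) : ℝ) with hNdef
  have q1 : 0 < η / c := by positivity
  have q2 : 0 < T ^ 2 / (c * ε) := by positivity
  have q3 : 0 < B / (c * ε) := by positivity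
  have q4 : 0 ≤ K * R / κ := by positivity
  have q5 : 0 ≤ K * 2 / (ε ^ 19 * κ) := by positivity
  have hN1 : 1 ≤ N := by linarith
  have hN0 : 0 < N := by linarith
  have hN7 : N ≤ N ^ 7 := by
    calc N = N ^ 1 := (pow_one N).symm
      _ ≤ N ^ 7 := pow_le_pow_right₀ hN1 (by norm_num)
  have hDN : c * N ≤ D := le_trans (by gcongr) hD
  have hD0 : 0 < D := lt_of_lt_of_le (by positivity) hDN
  have hPne : Nonempty P := by
    rw [← Fintype.card_pos_iff]
    have : (0:ℝ) < ((Fintype.card P : ℕ) : ℝ) := hN0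
    exact_mod_cast this
  set p := η / D with hpdef
  have hp : 0 ≤ p := by positivity
  have hp1 : p ≤ 1 := by
    rw [hpdef, div_le_one hD0]
    have : η / c ≤ N := by linarith
    rw [div_le_iff₀ hc] at this
    linarith
  have hpD : p * D = η := by rw [hpdef]; field_simp
  have hpN : p * N ^ 7 ≤ η / c := by
    rw [hpdef, div_mul_eq_mul_div, div_le_div_iff₀ hD0 hc]
    have := mul_le_mul_of_nonneg_left hD hη0.le
    linarith
  have hGr0 : (0:ℝ) < Fintype.card G := lt_of_lt_of_le (by positivity) hG
  have hGne : Nonempty G := by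
    rw [← Fintype.card_pos_iff]; exact_mod_cast hGr0
  -- lower bound for the trajectory
  have hphi : ∀ j (b b' : G), 𝔖.phi p R j b = 𝔖.phi p R j b' := by
    intro j b b'
    obtain ⟨σ, h, rfl⟩ := hsym b' b
    exact h.phi p R j b'
  have hmain : ∀ e : G, 1 - ε ≤ η * ∑ j ∈ range R, 𝔖.phi p R j e := by
    intro e
    apply recursion (κ := κ) (lam := L) (δ := K / N) (R := R) (fun i => 𝔖.phi p R i e)
      (fun i => 𝔖.uu p R i e) hε hε1 hL0 hη0 _ _ hκ
    · positivity
    · rw [← mul_div_assoc, div_le_iff₀ hN0]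
      have : K * R / κ ≤ N := by linarith
      rw [div_le_iff₀ hκ0] at this
      linarith
    · rw [div_le_iff₀ hN0]
      have : K * 2 / (ε ^ 19 * κ) ≤ N := by linarith
      rw [div_le_iff₀ (by positivity)] at this
      linarith
    · apply le_of_eq
      rw [hη, hT]
      field_simp
    · exact fun i => 𝔖.phi_nonneg hp hp1 R i e
    · exact fun i => 𝔖.phi_le_one hp hp1 R i e
    · exact 𝔖.uu_zero R e
    · exact fun i => 𝔖.uu_nonneg hp hp1 R i e
    · exact fun i => 𝔖.uu_le_one hp hp1 R i e
    · intro i hi hS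
      exact 𝔖.D1' hp hp1 hi.le hsym e hη0.le hc hpN hpD hdeg hS
    · intro i hi hS
      exact 𝔖.D2' hp hp1 hi hsym e hη0.le hc hc1 hpN hS
    · rw [hη, ← mul_div_assoc, div_le_iff₀ hR0]
      linarith
    · rw [hη, div_le_iff₀ hR0]; linarith
  obtain ⟨M, hM, hcard⟩ := 𝔖.delete hp hp1 hR1 (T := T) (c := c)
    (m := (1 - ε) / D - (R:ℝ) ^ 2 * p ^ 2) hT0.le hc hpN (by
      intro g
      refine le_trans ?_ (𝔖.mem_prob_ge hp hp1 g)
      have := hmain g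
      rw [← Finset.mul_sum]
      have h2 : (1 - ε) / D ≤ p * ∑ j ∈ range R, 𝔖.phi p R j g := by
        rw [div_le_iff₀ hD0]
        calc 1 - ε ≤ _ := this
          _ = _ := by rw [← hpD]; ring
      linarith)
  refine ⟨M, hM, ?_⟩
  set g : ℝ := ((Fintype.card G : ℕ) : ℝ) with hg
  have e1 : (R:ℝ) ^ 2 * p ^ 2 * D = T ^ 2 / D := by
    rw [hpdef, hη]; field_simp
  have e2 : T ^ 2 / D ≤ ε := by
    rw [div_le_iff₀ hD0]
    have : T ^ 2 / (c * ε) ≤ N := by linarith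
    rw [div_le_iff₀ (by positivity)] at this
    calc T ^ 2 ≤ N * (c * ε) := this
      _ = ε * (c * N) := by ring
      _ ≤ ε * D := mul_le_mul_of_nonneg_left hDN hε.le
  have e3 : A / R * N ^ 2 * D ≤ ε * g := by
    have : A / (c * ε) ≤ R := by linarith
    rw [div_le_iff₀ (by positivity)] at this
    have h4 : A / R ≤ c * ε := by rw [div_le_iff₀ hR0]; linarith
    calc A / R * N ^ 2 * D ≤ c * ε * N ^ 2 * D := by gcongr
      _ = ε * (c * N ^ 2 * D) := by ring
      _ ≤ _ := by gcongr
  have e4 : B * N * D ≤ ε * g := by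
    have : B / (c * ε) ≤ N := by linarith
    rw [div_le_iff₀ (by positivity)] at this
    calc B * N * D ≤ (N * (c * ε)) * N * D := by gcongr
      _ = ε * (c * N ^ 2 * D) := by ring
      _ ≤ _ := by gcongr
  have h5 := mul_le_mul_of_nonneg_right hcard hD0.le
  have h6 : (g * ((1 - ε) / D - (R:ℝ) ^ 2 * p ^ 2) - A / R * N ^ 2 - B * N) * D =
      g * ((1 - ε) - (R:ℝ) ^ 2 * p ^ 2 * D) - A / R * N ^ 2 * D - B * N * D := by
    field_simp
  rw [h6, e1] at h5
  have h7 : g * ((1 - ε) - ε) ≤ g * ((1 - ε) - T ^ 2 / D) := by gcongr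
  linarith

end Five8


namespace Five8

open Finset

/-! ### the concrete design -/

/-- first type class of a vertex position -/
def cI : Fin 6 → Fin 4 := ![0, 1, 2, 0, 1, 3]
/-- second type class of a vertex position -/
def cJ : Fin 6 → Fin 4 := ![2, 1, 0, 0, 3, 1]
/-- third type class of a vertex position -/
def cK : Fin 6 → Fin 7 := Fin.castSucc
/-- type class of a colour position -/
def cC : Fin 3 → Fin 7 := ![3, 1, 6]

/-- first end of the seven edges -/
def eA : Fin 7 → Fin 6 := ![0, 1, 0, 1, 4, 3, 4]
/-- second end of the seven edges -/
def eB : Fin 7 → Fin 6 := ![1, 2, 2, 3, 3, 5, 5]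
/-- colour of the seven edges -/
def eC : Fin 7 → Fin 3 := ![0, 0, 2, 2, 1, 1, 2]
/-- vertex of the twelve incidences -/
def iV : Fin 12 → Fin 6 := ![0, 1, 2, 4, 3, 5, 0, 1, 2, 3, 4, 5]
/-- colour of the twelve incidences -/
def iC : Fin 12 → Fin 3 := ![0, 0, 0, 1, 1, 1, 2, 2, 2, 2, 2, 2]

lemma cK_inj : Function.Injective cK := Fin.castSucc_injective 6
lemma cC_inj : Function.Injective cC := by decide
lemma eI_ne : ∀ τ, cI (eA τ) ≠ cI (eB τ) := by decide
lemma eJ_ne : ∀ τ, cJ (eA τ) ≠ cJ (eB τ) := by decide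
lemma eAB_ne : ∀ τ, eA τ ≠ eB τ := by decide
lemma iK_ne : ∀ τ, cK (iV τ) ≠ cC (iC τ) := by decide

/-- vertices -/
abbrev Vx (s m : ℕ) := (Fin s × Fin s × Fin s) × Fin m
/-- colours -/
abbrev Cl (s l : ℕ) := Fin s × Fin l
/-- gadgets -/
abbrev Gad (s m l : ℕ) := (Fin 4 ↪ Fin s) × (Fin 4 ↪ Fin s) × (Fin 7 ↪ Fin s) ×
  (Fin 6 → Fin m) × (Fin 3 → Fin l)

noncomputable instance (s m l : ℕ) : DecidableEq (Gad s m l) := Classical.decEq _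

variable {s m l : ℕ}

/-- vertex of a gadget -/
def vert (g : Gad s m l) (q : Fin 6) : Vx s m :=
  ((g.1 (cI q), g.2.1 (cJ q), g.2.2.1 (cK q)), g.2.2.2.1 q)

/-- colour of a gadget -/
def col (g : Gad s m l) (r : Fin 3) : Cl s l := (g.2.2.1 (cC r), g.2.2.2.2 r)

lemma vert_inj (g : Gad s m l) : Function.Injective (vert g) := by
  intro p q h
  have : g.2.2.1 (cK p) = g.2.2.1 (cK q) := congrArg (fun v : Vx s m => v.1.2.2) h
  exact cK_inj (g.2.2.1.injective this)

lemma col_inj (g : Gad s m l) : Function.Injective (col g) := by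
  intro p q h
  have : g.2.2.1 (cC p) = g.2.2.1 (cC q) := congrArg (fun v : Cl s l => v.1) h
  exact cC_inj (g.2.2.1.injective this)

/-- points of a gadget -/
def pt (g : Gad s m l) : Fin 6 ⊕ Fin 3 → Vx s m ⊕ Cl s l := Sum.map (vert g) (col g)

lemma pt_inj (g : Gad s m l) : Function.Injective (pt g) :=
  (vert_inj g).sumMap (col_inj g)

lemma pt_injective : Function.Injective (pt : Gad s m l → _) := by
  intro g g' h
  have hv : ∀ q, vert g q = vert g' q := fun q => Sum.inl_injective (congrFun h (Sum.inl q))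
  have hc : ∀ r, col g r = col g' r := fun r => Sum.inr_injective (congrFun h (Sum.inr r))
  have h1 : g.1 = g'.1 := by
    ext x
    have : ∃ q, cI q = x := by revert x; decide
    obtain ⟨q, rfl⟩ := this
    have := congrArg (fun v : Vx s m => v.1.1) (hv q)
    exact congrArg Fin.val this
  have h2 : g.2.1 = g'.2.1 := by
    ext x
    have : ∃ q, cJ q = x := by revert x; decide
    obtain ⟨q, rfl⟩ := this
    have := congrArg (fun v : Vx s m => v.1.2.1) (hv q)
    exact congrArg Fin.val this
  have h3 : g.2.2.1 = g'.2.2.1 := by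
    ext x
    have : (∃ q, cK q = x) ∨ (∃ r, cC r = x) := by revert x; decide
    rcases this with ⟨q, rfl⟩ | ⟨r, rfl⟩
    · have := congrArg (fun v : Vx s m => v.1.2.2) (hv q)
      exact congrArg Fin.val this
    · have := congrArg (fun v : Cl s l => v.1) (hc r)
      exact congrArg Fin.val this
  have h4 : g.2.2.2.1 = g'.2.2.2.1 := by
    funext q
    exact congrArg (fun v : Vx s m => v.2) (hv q)
  have h5 : g.2.2.2.2 = g'.2.2.2.2 := by
    funext r
    exact congrArg (fun v : Cl s l => v.2) (hc r)
  exact Prod.ext h1 (Prod.ext h2 (Prod.ext h3 (Prod.ext h4 h5)))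

/-- edge items -/
def eItem (g : Gad s m l) (τ : Fin 7) : Finset (Vx s m ⊕ Cl s l) :=
  {Sum.inl (vert g (eA τ)), Sum.inl (vert g (eB τ))}
/-- incidence items -/
def iItem (g : Gad s m l) (τ : Fin 12) : Finset (Vx s m ⊕ Cl s l) :=
  {Sum.inl (vert g (iV τ)), Sum.inr (col g (iC τ))}

/-- the design -/
noncomputable def des (s m l : ℕ) : Sys (Gad s m l) (Vx s m ⊕ Cl s l) where
  supp g := univ.image (pt g)
  items g := univ.image (eItem g) ∪ univ.image (iItem g)
  card_supp g := by
    rw [Finset.card_image_of_injective _ (pt_inj g)]; simp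
  item_sub := by
    intro g v hv x hx
    simp only [Finset.mem_union, Finset.mem_image, Finset.mem_univ, true_and] at hv
    rcases hv with ⟨τ, rfl⟩ | ⟨τ, rfl⟩
    · simp only [eItem, Finset.mem_insert, Finset.mem_singleton] at hx
      rcases hx with rfl | rfl
      · exact Finset.mem_image.2 ⟨Sum.inl (eA τ), Finset.mem_univ _, rfl⟩
      · exact Finset.mem_image.2 ⟨Sum.inl (eB τ), Finset.mem_univ _, rfl⟩
    · simp only [iItem, Finset.mem_insert, Finset.mem_singleton] at hx
      rcases hx with rfl | rfl
      · exact Finset.mem_image.2 ⟨Sum.inl (iV τ), Finset.mem_univ _, rfl⟩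
      · exact Finset.mem_image.2 ⟨Sum.inr (iC τ), Finset.mem_univ _, rfl⟩
  item_card := by
    intro g v hv
    simp only [Finset.mem_union, Finset.mem_image, Finset.mem_univ, true_and] at hv
    rcases hv with ⟨τ, rfl⟩ | ⟨τ, rfl⟩
    · apply Finset.card_pair
      intro h
      exact eAB_ne τ (vert_inj g (Sum.inl_injective h))
    · apply Finset.card_pair
      simp
  items_card := by
    intro g
    refine (Finset.card_union_le _ _).trans ?_
    have h1 := Finset.card_image_le (s := univ) (f := eItem g)
    have h2 := Finset.card_image_le (s := univ) (f := iItem g)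
    simp only [Finset.card_univ, Fintype.card_fin] at h1 h2
    omega
  count := by
    intro X
    have h1 : ((univ.filter (fun g : Gad s m l => univ.image (pt g) ⊆ X)).image pt) ⊆
        Fintype.piFinset (fun _ => X) := by
      intro f hf
      obtain ⟨g, hg, rfl⟩ := Finset.mem_image.1 hf
      rw [Fintype.mem_piFinset]
      intro q
      exact (Finset.mem_filter.1 hg).2 (Finset.mem_image_of_mem _ (Finset.mem_univ q))
    have h2 := Finset.card_le_card h1
    rw [Finset.card_image_of_injective _ pt_injective] at h2
    simpa using h2

lemma mem_des_supp {g : Gad s m l} {x} : x ∈ (des s m l).supp g ↔ ∃ q, pt g q = x := by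
  simp [des]

lemma mem_des_items {g : Gad s m l} {v} : v ∈ (des s m l).items g ↔
    (∃ τ, eItem g τ = v) ∨ (∃ τ, iItem g τ = v) := by
  simp [des]

/-! ### symmetry -/

/-- parameters of a symmetry -/
structure Sy (s m l : ℕ) where
  pI : Equiv.Perm (Fin s)
  pJ : Equiv.Perm (Fin s)
  pK : Equiv.Perm (Fin s)
  rV : Fin s → Equiv.Perm (Fin m)
  rC : Fin s → Equiv.Perm (Fin l)

/-- action on points -/
def Sy.act (y : Sy s m l) : Vx s m ⊕ Cl s l → Vx s m ⊕ Cl s l :=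
  Sum.map (fun v => ((y.pI v.1.1, y.pJ v.1.2.1, y.pK v.1.2.2), y.rV v.1.2.2 v.2))
    (fun c => (y.pK c.1, y.rC c.1 c.2))

lemma Sy.act_inj (y : Sy s m l) : Function.Injective y.act := by
  apply Function.Injective.sumMap
  · rintro ⟨⟨a, b, c⟩, d⟩ ⟨⟨a', b', c'⟩, d'⟩ h
    simp only [Prod.mk.injEq, EmbeddingLike.apply_eq_iff_eq] at h
    obtain ⟨⟨rfl, rfl, rfl⟩, h⟩ := h
    simpa using h
  · rintro ⟨c, d⟩ ⟨c', d'⟩ h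
    simp only [Prod.mk.injEq, EmbeddingLike.apply_eq_iff_eq] at h
    obtain ⟨rfl, h⟩ := h
    simpa using h

/-- action on gadgets -/
def Sy.gact (y : Sy s m l) (g : Gad s m l) : Gad s m l :=
  (g.1.trans y.pI.toEmbedding, g.2.1.trans y.pJ.toEmbedding, g.2.2.1.trans y.pK.toEmbedding,
    fun q => y.rV (g.2.2.1 (cK q)) (g.2.2.2.1 q), fun r => y.rC (g.2.2.1 (cC r)) (g.2.2.2.2 r))

lemma Sy.pt_gact (y : Sy s m l) (g : Gad s m l) (q) : pt (y.gact g) q = y.act (pt g q) := by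
  rcases q with q | r <;> rfl

lemma Sy.gact_inj (y : Sy s m l) : Function.Injective y.gact := by
  intro g g' h
  apply pt_injective
  funext q
  apply y.act_inj
  rw [← y.pt_gact, ← y.pt_gact, h]

/-- as a permutation -/
noncomputable def Sy.perm (y : Sy s m l) : Equiv.Perm (Gad s m l) :=
  Equiv.ofBijective y.gact (Finite.injective_iff_bijective.1 y.gact_inj)

lemma Sy.supp (y : Sy s m l) (g : Gad s m l) :
    (des s m l).supp (y.gact g) = ((des s m l).supp g).image y.act := by
  ext x
  simp only [Finset.mem_image, mem_des_supp, y.pt_gact]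
  constructor
  · rintro ⟨q, rfl⟩; exact ⟨_, ⟨q, rfl⟩, rfl⟩
  · rintro ⟨_, ⟨q, rfl⟩, rfl⟩; exact ⟨q, rfl⟩

lemma Sy.eItem (y : Sy s m l) (g : Gad s m l) (τ) :
    eItem (y.gact g) τ = (eItem g τ).image y.act := by
  have h1 := y.pt_gact g (Sum.inl (eA τ))
  have h2 := y.pt_gact g (Sum.inl (eB τ))
  simp only [pt, Sum.map_inl] at h1 h2
  simp only [Five8.eItem, Finset.image_insert, Finset.image_singleton, h1, h2]

lemma Sy.iItem (y : Sy s m l) (g : Gad s m l) (τ) :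
    iItem (y.gact g) τ = (iItem g τ).image y.act := by
  have h1 := y.pt_gact g (Sum.inl (iV τ))
  have h2 := y.pt_gact g (Sum.inr (iC τ))
  simp only [pt, Sum.map_inl, Sum.map_inr] at h1 h2
  simp only [Five8.iItem, Finset.image_insert, Finset.image_singleton, h1, h2]

lemma Sy.items (y : Sy s m l) (g : Gad s m l) :
    (des s m l).items (y.gact g) = ((des s m l).items g).image (Finset.image y.act) := by
  ext v
  simp only [Finset.mem_image, mem_des_items, y.eItem, y.iItem]
  constructor
  · rintro (⟨τ, rfl⟩ | ⟨τ, rfl⟩)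
    · exact ⟨_, Or.inl ⟨τ, rfl⟩, rfl⟩
    · exact ⟨_, Or.inr ⟨τ, rfl⟩, rfl⟩
  · rintro ⟨_, ⟨τ, rfl⟩ | ⟨τ, rfl⟩, rfl⟩
    · exact Or.inl ⟨τ, rfl⟩
    · exact Or.inr ⟨τ, rfl⟩

lemma Sy.symm (y : Sy s m l) : (des s m l).Symm y.perm := by
  constructor
  · intro Γ
    have : (des s m l).sp (Γ.map y.perm.toEmbedding) = ((des s m l).sp Γ).image y.act := by
      ext x
      simp only [Sys.sp, Finset.mem_biUnion, Finset.mem_map, Finset.mem_image]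
      constructor
      · rintro ⟨_, ⟨g, hg, rfl⟩, hx⟩
        have hx' : x ∈ (des s m l).supp (y.gact g) := hx
        rw [y.supp, Finset.mem_image] at hx'
        obtain ⟨z, hz, rfl⟩ := hx'
        exact ⟨z, ⟨g, hg, hz⟩, rfl⟩
      · rintro ⟨z, ⟨g, hg, hz⟩, rfl⟩
        refine ⟨y.gact g, ⟨g, hg, rfl⟩, ?_⟩
        rw [y.supp]; exact Finset.mem_image_of_mem _ hz
    rw [this, Finset.card_image_of_injective _ y.act_inj]
  · intro g g'
    have e1 : y.perm g = y.gact g := rfl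
    have e2 : y.perm g' = y.gact g' := rfl
    rw [e1, e2, y.items, y.items]
    constructor
    · rintro ⟨v, hv, hv'⟩
      obtain ⟨w, hw, rfl⟩ := Finset.mem_image.1 hv
      obtain ⟨w', hw', he⟩ := Finset.mem_image.1 hv'
      rw [Finset.image_injective y.act_inj he] at hw'
      exact ⟨w, hw, hw'⟩
    · rintro ⟨v, hv, hv'⟩
      exact ⟨_, Finset.mem_image_of_mem _ hv, Finset.mem_image_of_mem _ hv'⟩

lemma exists_perm_emb {k : ℕ} (f f' : Fin k ↪ Fin s) : ∃ π : Equiv.Perm (Fin s),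
    ∀ x, π (f x) = f' x := by
  classical
  have h := Equiv.Perm.isMultiplyPretransitive (Fin s) k
  obtain ⟨π, hπ⟩ := h.exists_smul_eq f f'
  refine ⟨π, fun x => ?_⟩
  rw [← hπ]; rfl

lemma des_symm (e e' : Gad s m l) : ∃ σ, (des s m l).Symm σ ∧ σ e = e' := by
  classical
  obtain ⟨pI, hI⟩ := exists_perm_emb e.1 e'.1
  obtain ⟨pJ, hJ⟩ := exists_perm_emb e.2.1 e'.2.1
  obtain ⟨pK, hK⟩ := exists_perm_emb e.2.2.1 e'.2.2.1
  have hV : ∃ rV : Fin s → Equiv.Perm (Fin m), ∀ q, rV (e.2.2.1 (cK q)) (e.2.2.2.1 q) =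
      e'.2.2.2.1 q := by
    have : ∀ k : Fin s, ∃ ρ : Equiv.Perm (Fin m), ∀ q, e.2.2.1 (cK q) = k →
        ρ (e.2.2.2.1 q) = e'.2.2.2.1 q := by
      intro k
      by_cases h : ∃ q, e.2.2.1 (cK q) = k
      · obtain ⟨q, rfl⟩ := h
        refine ⟨Equiv.swap (e.2.2.2.1 q) (e'.2.2.2.1 q), fun q' hq' => ?_⟩
        rw [cK_inj (e.2.2.1.injective hq')]
        exact Equiv.swap_apply_left _ _
      · exact ⟨1, fun q hq => absurd ⟨q, hq⟩ h⟩
    choose rV hrV using this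
    exact ⟨rV, fun q => hrV _ q rfl⟩
  have hC : ∃ rC : Fin s → Equiv.Perm (Fin l), ∀ q, rC (e.2.2.1 (cC q)) (e.2.2.2.2 q) =
      e'.2.2.2.2 q := by
    have : ∀ k : Fin s, ∃ ρ : Equiv.Perm (Fin l), ∀ q, e.2.2.1 (cC q) = k →
        ρ (e.2.2.2.2 q) = e'.2.2.2.2 q := by
      intro k
      by_cases h : ∃ q, e.2.2.1 (cC q) = k
      · obtain ⟨q, rfl⟩ := h
        refine ⟨Equiv.swap (e.2.2.2.2 q) (e'.2.2.2.2 q), fun q' hq' => ?_⟩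
        rw [cC_inj (e.2.2.1.injective hq')]
        exact Equiv.swap_apply_left _ _
      · exact ⟨1, fun q hq => absurd ⟨q, hq⟩ h⟩
    choose rC hrC using this
    exact ⟨rC, fun q => hrC _ q rfl⟩
  obtain ⟨rV, hV⟩ := hV
  obtain ⟨rC, hC⟩ := hC
  set y : Sy s m l := ⟨pI, pJ, pK, rV, rC⟩
  refine ⟨y.perm, y.symm, ?_⟩
  have e1 : y.perm e = y.gact e := rfl
  rw [e1]
  refine Prod.ext ?_ (Prod.ext ?_ (Prod.ext ?_ (Prod.ext ?_ ?_)))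
  · apply DFunLike.ext; exact hI
  · apply DFunLike.ext; exact hJ
  · apply DFunLike.ext; exact hK
  · funext q; exact hV q
  · funext r; exact hC r

end Five8


namespace Five8

open Finset

variable {s m l : ℕ}

lemma fiber_le {A B : Type} [Fintype A] [DecidableEq B] (F : A → B) (R : Finset B) (x : B)
    (h : x ∈ R → ∀ y ∈ R, ∃ φ : A → A, Function.Injective φ ∧ ∀ a, F a = x → F (φ a) = y)
    (hF : ∀ a, F a ∈ R) :
    (univ.filter (fun a => F a = x)).card * R.card ≤ Fintype.card A := by
  classical
  by_cases hx : x ∈ R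
  · have h1 : ∀ y ∈ R, (univ.filter (fun a => F a = x)).card ≤ (univ.filter (fun a => F a = y)).card := by
      intro y hy
      obtain ⟨φ, hφ, hφ2⟩ := h hx y hy
      apply Finset.card_le_card_of_injOn φ
      · intro a ha
        simp only [Finset.coe_filter, Finset.mem_univ, true_and, Set.mem_ofPred_eq] at ha ⊢
        exact hφ2 a ha
      · exact hφ.injOn
    have h2 := Finset.card_eq_sum_card_fiberwise (s := (univ : Finset A)) (t := R) (f := F)
      (fun a _ => hF a)
    rw [← Finset.card_univ, h2, mul_comm, ← smul_eq_mul]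
    exact Finset.card_nsmul_le_sum _ _ _ h1
  · have : (univ.filter (fun a => F a = x)) = ∅ := by
      ext a
      simp only [Finset.mem_filter, Finset.mem_univ, true_and, Finset.notMem_empty, iff_false]
      rintro rfl
      exact hx (hF a)
    simp [this]

lemma exists_perm_two {x y x' y' : Fin s} (h : x ≠ y) (h' : x' ≠ y') :
    ∃ π : Equiv.Perm (Fin s), π x = x' ∧ π y = y' := by
  obtain ⟨π, hπ⟩ := exists_perm_emb (k := 2) (⟨![x, y], by
    intro a b hab; fin_cases a <;> fin_cases b <;> simp_all⟩ : Fin 2 ↪ Fin s)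
    (⟨![x', y'], by intro a b hab; fin_cases a <;> fin_cases b <;> simp_all⟩ : Fin 2 ↪ Fin s)
  exact ⟨π, hπ 0, hπ 1⟩

lemma exists_fam {n : ℕ} {k k' : Fin s} (h : k ≠ k') (a b a' b' : Fin n) :
    ∃ r : Fin s → Equiv.Perm (Fin n), r k a = a' ∧ r k' b = b' := by
  refine ⟨fun i => if i = k then Equiv.swap a a' else Equiv.swap b b', ?_, ?_⟩
  · simp
  · simp [h.symm]

/-- number of ordered compatible vertex pairs -/
def R1 (s m : ℕ) : ℕ := (s * (s - 1)) * ((s * (s - 1)) * ((s * (s - 1)) * (m * m)))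
/-- number of compatible vertex-colour pairs -/
def R2 (s m l : ℕ) : ℕ := s * (s * ((s * (s - 1)) * (m * l)))

lemma offDiag_card' : (univ : Finset (Fin s)).offDiag.card = s * (s - 1) := by
  rw [Finset.offDiag_card]; simp [Nat.mul_sub]

lemma vv_count (p q : Fin 6) (hI : cI p ≠ cI q) (hJ : cJ p ≠ cJ q) (hpq : p ≠ q)
    (α β : Vx s m) :
    (univ.filter (fun g : Gad s m l => vert g p = α ∧ vert g q = β)).card * R1 s m ≤
      Fintype.card (Gad s m l) := by
  classical
  let F : Vx s m → Vx s m → (Fin s × Fin s) × (Fin s × Fin s) × (Fin s × Fin s) × (Fin m × Fin m) :=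
    fun α β => ((α.1.1, β.1.1), (α.1.2.1, β.1.2.1), (α.1.2.2, β.1.2.2), (α.2, β.2))
  have hFi : ∀ α β α' β', F α β = F α' β' ↔ (α = α' ∧ β = β') := by
    rintro ⟨⟨a, b, c⟩, d⟩ ⟨⟨a', b', c'⟩, d'⟩ ⟨⟨a2, b2, c2⟩, d2⟩ ⟨⟨a3, b3, c3⟩, d3⟩
    simp only [F, Prod.mk.injEq]; tauto
  have h := fiber_le (A := Gad s m l) (fun g => F (vert g p) (vert g q))
    (univ.offDiag ×ˢ univ.offDiag ×ˢ univ.offDiag ×ˢ univ) (F α β) ?_ ?_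
  · simp only [hFi, Finset.card_product, offDiag_card'] at h
    simpa only [R1, R2, Finset.card_univ, Fintype.card_prod, Fintype.card_fin] using h
  · rintro hx ⟨⟨i, i'⟩, ⟨j, j'⟩, ⟨k, k'⟩, ⟨u, u'⟩⟩ hy
    simp only [F, Finset.mem_product, Finset.mem_offDiag, Finset.mem_univ, true_and, and_true] at hx hy
    obtain ⟨pI, a1, a2⟩ := exists_perm_two hx.1 hy.1
    obtain ⟨pJ, b1, b2⟩ := exists_perm_two hx.2.1 hy.2.1
    obtain ⟨pK, c1, c2⟩ := exists_perm_two hx.2.2 hy.2.2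
    obtain ⟨rV, d1, d2⟩ := exists_fam hx.2.2 α.2 β.2 u u'
    refine ⟨Sy.gact (⟨pI, pJ, pK, rV, fun _ => 1⟩ : Sy s m l), Sy.gact_inj _, fun g hg => ?_⟩
    obtain ⟨h1, h2⟩ := (hFi _ _ _ _).1 hg
    subst h1 h2
    rw [← a1, ← a2, ← b1, ← b2, ← c1, ← c2, ← d1, ← d2]
    rfl
  · intro g
    simp only [F, vert, Finset.mem_product, Finset.mem_offDiag, Finset.mem_univ, true_and, and_true]
    exact ⟨fun h => hI (g.1.injective h), fun h => hJ (g.2.1.injective h),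
      fun h => hpq (cK_inj (g.2.2.1.injective h))⟩

lemma vc_count (p : Fin 6) (r : Fin 3) (hK : cK p ≠ cC r) (α : Vx s m) (β : Cl s l) :
    (univ.filter (fun g : Gad s m l => vert g p = α ∧ col g r = β)).card * R2 s m l ≤
      Fintype.card (Gad s m l) := by
  classical
  let F : Vx s m → Cl s l → Fin s × Fin s × (Fin s × Fin s) × (Fin m × Fin l) :=
    fun α β => (α.1.1, α.1.2.1, (α.1.2.2, β.1), (α.2, β.2))
  have hFi : ∀ α β α' β', F α β = F α' β' ↔ (α = α' ∧ β = β') := by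
    rintro ⟨⟨a, b, c⟩, d⟩ ⟨a', d'⟩ ⟨⟨a2, b2, c2⟩, d2⟩ ⟨a3, d3⟩
    simp only [F, Prod.mk.injEq]; tauto
  have h := fiber_le (A := Gad s m l) (fun g => F (vert g p) (col g r))
    (univ ×ˢ univ ×ˢ univ.offDiag ×ˢ univ) (F α β) ?_ ?_
  · simp only [hFi, Finset.card_product, offDiag_card'] at h
    simpa only [R1, R2, Finset.card_univ, Fintype.card_prod, Fintype.card_fin] using h
  · rintro hx ⟨i, j, ⟨k, k'⟩, ⟨u, u'⟩⟩ hy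
    simp only [F, Finset.mem_product, Finset.mem_offDiag, Finset.mem_univ, true_and, and_true] at hx hy
    obtain ⟨pK, c1, c2⟩ := exists_perm_two hx hy
    refine ⟨Sy.gact (⟨Equiv.swap α.1.1 i, Equiv.swap α.1.2.1 j, pK, fun _ => Equiv.swap α.2 u,
      fun _ => Equiv.swap β.2 u'⟩ : Sy s m l), Sy.gact_inj _, fun g hg => ?_⟩
    obtain ⟨h1, h2⟩ := (hFi _ _ _ _).1 hg
    have e1 : vert (Sy.gact (⟨Equiv.swap α.1.1 i, Equiv.swap α.1.2.1 j, pK, fun _ => Equiv.swap α.2 u,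
      fun _ => Equiv.swap β.2 u'⟩ : Sy s m l) g) p = ((i, j, k), u) := by
      have : vert (Sy.gact (⟨Equiv.swap α.1.1 i, Equiv.swap α.1.2.1 j, pK, fun _ => Equiv.swap α.2 u,
          fun _ => Equiv.swap β.2 u'⟩ : Sy s m l) g) p =
          ((Equiv.swap α.1.1 i (vert g p).1.1, Equiv.swap α.1.2.1 j (vert g p).1.2.1,
            pK (vert g p).1.2.2), Equiv.swap α.2 u (vert g p).2) := rfl
      rw [this, h1, c1]; simp
    have e2 : col (Sy.gact (⟨Equiv.swap α.1.1 i, Equiv.swap α.1.2.1 j, pK, fun _ => Equiv.swap α.2 u,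
      fun _ => Equiv.swap β.2 u'⟩ : Sy s m l) g) r = (k', u') := by
      have : col (Sy.gact (⟨Equiv.swap α.1.1 i, Equiv.swap α.1.2.1 j, pK, fun _ => Equiv.swap α.2 u,
          fun _ => Equiv.swap β.2 u'⟩ : Sy s m l) g) r =
          (pK (col g r).1, Equiv.swap β.2 u' (col g r).2) := rfl
      rw [this, h2, c2]; simp
    rw [e1, e2]
  · intro g
    simp only [F, vert, col, Finset.mem_product, Finset.mem_offDiag, Finset.mem_univ, true_and, and_true]
    exact fun h => hK (g.2.2.1.injective h)

lemma pair_cases {A : Type} [DecidableEq A] {a b c d : A} (h : ({a, b} : Finset A) = {c, d}) :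
    (a = c ∧ b = d) ∨ (a = d ∧ b = c) := by
  have h' : ({a, b} : Set A) = {c, d} := by
    have := congrArg (fun z : Finset A => (z : Set A)) h
    simpa using this
  exact Set.pair_eq_pair_iff.1 h'

lemma e_count (τ : Fin 7) (v : Finset (Vx s m ⊕ Cl s l)) :
    (univ.filter (fun g : Gad s m l => eItem g τ = v)).card * R1 s m ≤
      2 * Fintype.card (Gad s m l) := by
  classical
  by_cases h : ∃ g : Gad s m l, eItem g τ = v
  · obtain ⟨g0, rfl⟩ := h
    have h1 : univ.filter (fun g : Gad s m l => eItem g τ = eItem g0 τ) ⊆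
        univ.filter (fun g : Gad s m l => vert g (eA τ) = vert g0 (eA τ) ∧ vert g (eB τ) = vert g0 (eB τ)) ∪
        univ.filter (fun g : Gad s m l => vert g (eA τ) = vert g0 (eB τ) ∧ vert g (eB τ) = vert g0 (eA τ)) := by
      intro g hg
      have := pair_cases (Finset.mem_filter.1 hg).2
      simpa using this
    have h2 := (Finset.card_le_card h1).trans (Finset.card_union_le _ _)
    have a1 := vv_count (l := l) (eA τ) (eB τ) (eI_ne τ) (eJ_ne τ) (eAB_ne τ) (vert g0 (eA τ)) (vert g0 (eB τ))
    have a2 := vv_count (l := l) (eA τ) (eB τ) (eI_ne τ) (eJ_ne τ) (eAB_ne τ) (vert g0 (eB τ)) (vert g0 (eA τ))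
    refine (Nat.mul_le_mul_right _ h2).trans ?_
    rw [add_mul]; omega
  · have : (univ.filter (fun g : Gad s m l => eItem g τ = v)) = ∅ := by
      ext g; simp; exact fun hg => h ⟨g, hg⟩
    simp [this]

lemma i_count (τ : Fin 12) (v : Finset (Vx s m ⊕ Cl s l)) :
    (univ.filter (fun g : Gad s m l => iItem g τ = v)).card * R2 s m l ≤
      Fintype.card (Gad s m l) := by
  classical
  by_cases h : ∃ g : Gad s m l, iItem g τ = v
  · obtain ⟨g0, rfl⟩ := h
    have h1 : univ.filter (fun g : Gad s m l => iItem g τ = iItem g0 τ) ⊆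
        univ.filter (fun g : Gad s m l => vert g (iV τ) = vert g0 (iV τ) ∧ col g (iC τ) = col g0 (iC τ)) := by
      intro g hg
      have := pair_cases (Finset.mem_filter.1 hg).2
      simpa using this
    exact (Nat.mul_le_mul_right _ (Finset.card_le_card h1)).trans (vc_count _ _ (iK_ne τ) _ _)
  · have : (univ.filter (fun g : Gad s m l => iItem g τ = v)) = ∅ := by
      ext g; simp; exact fun hg => h ⟨g, hg⟩
    simp [this]

lemma deg_le (hR : 7 * R2 s m l = 6 * R1 s m) (v : Finset (Vx s m ⊕ Cl s l))
    [DecidablePred fun g : Gad s m l => v ∈ (des s m l).items g] :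
    (univ.filter (fun g : Gad s m l => v ∈ (des s m l).items g)).card * R1 s m ≤
      14 * Fintype.card (Gad s m l) := by
  classical
  by_cases h : ∃ g : Gad s m l, ∃ τ, eItem g τ = v
  · have h1 : univ.filter (fun g : Gad s m l => v ∈ (des s m l).items g) ⊆
        univ.biUnion (fun τ => univ.filter (fun g : Gad s m l => eItem g τ = v)) := by
      intro g hg
      rw [Finset.mem_filter, mem_des_items] at hg
      rcases hg.2 with ⟨τ, hτ⟩ | ⟨τ, hτ⟩
      · simp only [Finset.mem_biUnion, Finset.mem_filter, Finset.mem_univ, true_and]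
        exact ⟨τ, hτ⟩
      · exfalso
        obtain ⟨g0, τ0, h0⟩ := h
        rw [← h0] at hτ
        have := pair_cases hτ
        simp at this
    have h2 := (Finset.card_le_card h1).trans Finset.card_biUnion_le
    refine (Nat.mul_le_mul_right _ h2).trans ?_
    rw [Finset.sum_mul]
    refine (Finset.sum_le_sum (fun τ _ => e_count τ v)).trans ?_
    simp; omega
  · have h1 : univ.filter (fun g : Gad s m l => v ∈ (des s m l).items g) ⊆
        univ.biUnion (fun τ => univ.filter (fun g : Gad s m l => iItem g τ = v)) := by
      intro g hg
      rw [Finset.mem_filter, mem_des_items] at hg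
      rcases hg.2 with ⟨τ, hτ⟩ | ⟨τ, hτ⟩
      · exact absurd ⟨g, τ, hτ⟩ h
      · simp only [Finset.mem_biUnion, Finset.mem_filter, Finset.mem_univ, true_and]
        exact ⟨τ, hτ⟩
    have h2 := (Finset.card_le_card h1).trans Finset.card_biUnion_le
    have h3 : (univ.filter (fun g : Gad s m l => v ∈ (des s m l).items g)).card * R2 s m l ≤
        12 * Fintype.card (Gad s m l) := by
      refine (Nat.mul_le_mul_right _ h2).trans ?_
      rw [Finset.sum_mul]
      refine (Finset.sum_le_sum (fun τ _ => i_count τ v)).trans ?_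
      simp
    nlinarith

end Five8


namespace Five8

open Finset

lemma gad_card_ge (s t : ℕ) (hs : 7 ≤ s) :
    t ^ 9 ≤ Fintype.card (Gad s (7 * t) (6 * (s - 1) ^ 2 * t)) := by
  have e4 : 1 ≤ Fintype.card (Fin 4 ↪ Fin s) := by
    have : Nonempty (Fin 4 ↪ Fin s) := ⟨Fin.castLEEmb (by omega)⟩
    exact Fintype.card_pos
  have e7 : 1 ≤ Fintype.card (Fin 7 ↪ Fin s) := by
    have : Nonempty (Fin 7 ↪ Fin s) := ⟨Fin.castLEEmb (by omega)⟩
    exact Fintype.card_pos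
  have em : t ^ 6 ≤ Fintype.card (Fin 6 → Fin (7 * t)) := by
    simp only [Fintype.card_fun, Fintype.card_fin]
    exact Nat.pow_le_pow_left (by omega) 6
  have el : t ^ 3 ≤ Fintype.card (Fin 3 → Fin (6 * (s - 1) ^ 2 * t)) := by
    simp only [Fintype.card_fun, Fintype.card_fin]
    apply Nat.pow_le_pow_left
    have : 1 ≤ 6 * (s - 1) ^ 2 := by
      have : 1 ≤ (s - 1) ^ 2 := Nat.one_le_pow _ _ (by omega)
      omega
    calc t = 1 * t := (one_mul t).symm
      _ ≤ _ := Nat.mul_le_mul_right _ this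
  simp only [Fintype.card_prod]
  calc t ^ 9 = 1 * (1 * (1 * (t ^ 6 * t ^ 3))) := by ring
    _ ≤ _ := by gcongr

lemma des_matching (ε : ℝ) (hε : 0 < ε) (hε1 : ε ≤ 1) (s : ℕ) (hs : 7 ≤ s) :
    ∃ T : ℕ, ∀ t : ℕ, T ≤ t → ∃ M : Finset (Gad s (7 * t) (6 * (s - 1) ^ 2 * t)),
      (des s (7 * t) (6 * (s - 1) ^ 2 * t)).Good M ∧
      (1 - 4 * ε) * (R1 s (7 * t) : ℝ) ≤ 14 * (M.card : ℝ) := by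
  classical
  have hs0 : (1 : ℝ) ≤ (s : ℝ) := by exact_mod_cast (by omega : 1 ≤ s)
  set b : ℝ := 13 * (s : ℝ) ^ 3 with hb
  have hb1 : 1 ≤ b := by
    have : (1 : ℝ) ≤ (s : ℝ) ^ 3 := one_le_pow₀ hs0
    rw [hb]; linarith
  have hs6 : (1 : ℝ) ≤ (s : ℝ) ^ 6 := one_le_pow₀ hs0
  have hb7 : (1 : ℝ) ≤ b ^ 7 := one_le_pow₀ hb1
  set c : ℝ := 1 / (49 * (s : ℝ) ^ 6 * b ^ 7) with hc
  have hden : 1 ≤ 49 * (s : ℝ) ^ 6 * b ^ 7 := by nlinarith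
  have hc0 : 0 < c := by rw [hc]; positivity
  have hc1 : c ≤ 1 := by
    rw [hc]; exact (div_le_one (by positivity)).2 hden
  obtain ⟨N₀, hN⟩ := matching ε c hε hε1 hc0 hc1
  refine ⟨max N₀ 1, fun t ht => ?_⟩
  have ht0 : N₀ ≤ t := le_trans (le_max_left _ _) ht
  have ht1 : 1 ≤ t := le_trans (le_max_right _ _) ht
  have htR : (1 : ℝ) ≤ (t : ℝ) := by exact_mod_cast ht1
  have hG := gad_card_ge s t hs
  obtain ⟨w, rfl⟩ : ∃ w, s = w + 1 := ⟨s - 1, by omega⟩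
  simp only [Nat.add_sub_cancel] at *
  set l := 6 * w ^ 2 * t with hl
  set g : ℝ := ((Fintype.card (Gad (w + 1) (7 * t) l) : ℕ) : ℝ) with hg
  have hgR : (t : ℝ) ^ 9 ≤ g := by rw [hg]; exact_mod_cast hG
  have hg0 : 0 < g := lt_of_lt_of_le (by positivity) hgR
  have hR1 : (R1 (w + 1) (7 * t) : ℝ) = 49 * (((w + 1 : ℕ) : ℝ) * w) ^ 3 * t ^ 2 := by
    simp only [R1, Nat.add_sub_cancel]; push_cast; ring
  have hw : (1 : ℝ) ≤ (w : ℝ) := by exact_mod_cast (by omega : 1 ≤ w)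
  have hR1lo : 49 * (t : ℝ) ^ 2 ≤ (R1 (w + 1) (7 * t) : ℝ) := by
    rw [hR1]
    have : (1 : ℝ) ≤ (((w + 1 : ℕ) : ℝ) * w) ^ 3 := one_le_pow₀ (by nlinarith)
    nlinarith [sq_nonneg (t : ℝ)]
  have hR1hi : (R1 (w + 1) (7 * t) : ℝ) ≤ 49 * ((w + 1 : ℕ) : ℝ) ^ 6 * t ^ 2 := by
    rw [hR1]
    have : (((w + 1 : ℕ) : ℝ) * w) ^ 3 ≤ (((w + 1 : ℕ) : ℝ) * ((w + 1 : ℕ) : ℝ)) ^ 3 := by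
      gcongr; push_cast; linarith
    have h2 : (((w + 1 : ℕ) : ℝ) * ((w + 1 : ℕ) : ℝ)) ^ 3 = ((w + 1 : ℕ) : ℝ) ^ 6 := by ring
    rw [h2] at this
    gcongr
  have hRpos : 0 < (R1 (w + 1) (7 * t) : ℝ) := lt_of_lt_of_le (by positivity) hR1lo
  set R : ℝ := (R1 (w + 1) (7 * t) : ℝ) with hRdef
  have hcard : Fintype.card (Vx (w + 1) (7 * t) ⊕ Cl (w + 1) l) =
      (w + 1) ^ 3 * (7 * t) + (w + 1) * l := by
    simp only [Fintype.card_sum, Fintype.card_prod, Fintype.card_fin]; ring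
  have hNt : t ≤ Fintype.card (Vx (w + 1) (7 * t) ⊕ Cl (w + 1) l) := by
    rw [hcard]
    have : 1 ≤ (w + 1) ^ 3 := Nat.one_le_pow _ _ (by omega)
    nlinarith [Nat.zero_le ((w + 1) * l)]
  have hNhi : ((Fintype.card (Vx (w + 1) (7 * t) ⊕ Cl (w + 1) l) : ℕ) : ℝ) ≤ b * t := by
    rw [hcard, hl, hb]
    push_cast
    have : (w : ℝ) ^ 2 ≤ (w + 1 : ℝ) ^ 2 := by gcongr; linarith
    have h3 : ((w : ℝ) + 1) * (6 * w ^ 2 * t) ≤ ((w : ℝ) + 1) * (6 * (w + 1) ^ 2 * t) := by gcongr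
    nlinarith
  have hN0 : (0 : ℝ) ≤ ((Fintype.card (Vx (w + 1) (7 * t) ⊕ Cl (w + 1) l) : ℕ) : ℝ) := by positivity
  have key := hN _ _ (des (w + 1) (7 * t) l) (14 * g / R) (ht0.trans hNt) ?_ ?_ ?_ des_symm
  · obtain ⟨M, hM, hM2⟩ := key
    refine ⟨M, hM, ?_⟩
    have h1 : (M.card : ℝ) * (14 * g / R) = (14 * M.card / R) * g := by ring
    rw [h1] at hM2
    have h2 := le_of_mul_le_mul_right hM2 hg0
    rwa [le_div_iff₀ hRpos] at h2
  · rw [le_div_iff₀ hRpos]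
    have hN7 : ((Fintype.card (Vx (w + 1) (7 * t) ⊕ Cl (w + 1) l) : ℕ) : ℝ) ^ 7 ≤ (b * t) ^ 7 :=
      pow_le_pow_left₀ hN0 hNhi 7
    calc _ ≤ c * (b * t) ^ 7 * (49 * ((w + 1 : ℕ) : ℝ) ^ 6 * t ^ 2) := by gcongr
      _ = (t : ℝ) ^ 9 * (c * (49 * ((w + 1 : ℕ) : ℝ) ^ 6 * b ^ 7)) := by ring
      _ = (t : ℝ) ^ 9 := by rw [hc, one_div_mul_cancel (by positivity), mul_one]
      _ ≤ 14 * g := by linarith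
  · have hN2 : ((Fintype.card (Vx (w + 1) (7 * t) ⊕ Cl (w + 1) l) : ℕ) : ℝ) ^ 2 ≤ (b * t) ^ 2 :=
      pow_le_pow_left₀ hN0 hNhi 2
    have hcb : c * b ^ 2 ≤ 1 := by
      rw [hc, one_div, inv_mul_le_iff₀ (by positivity), mul_one]
      have : b ^ 2 ≤ b ^ 7 := pow_le_pow_right₀ hb1 (by norm_num)
      nlinarith
    rw [← mul_div_assoc, div_le_iff₀ hRpos]
    have hn : c * ((Fintype.card (Vx (w + 1) (7 * t) ⊕ Cl (w + 1) l) : ℕ) : ℝ) ^ 2 ≤ t ^ 2 := by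
      calc _ ≤ c * (b * t) ^ 2 := by gcongr
        _ = (c * b ^ 2) * t ^ 2 := by ring
        _ ≤ 1 * t ^ 2 := by gcongr
        _ = _ := one_mul _
    calc _ ≤ (t : ℝ) ^ 2 * (14 * g) := by gcongr
      _ = g * (14 * (t : ℝ) ^ 2) := by ring
      _ ≤ g * R := by
        apply mul_le_mul_of_nonneg_left _ hg0.le
        linarith [sq_nonneg (t : ℝ)]
  · intro v
    rw [le_div_iff₀ hRpos]
    have := deg_le (s := w + 1) (m := 7 * t) (l := l)
      (by simp only [R1, R2, Nat.add_sub_cancel, hl]; ring) v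
    have h2 : (((univ.filter (fun g => v ∈ (des (w + 1) (7 * t) l).items g)).card * R1 (w + 1) (7 * t) : ℕ) : ℝ) ≤
       ((14 * Fintype.card (Gad (w + 1) (7 * t) l) : ℕ) : ℝ) := by exact_mod_cast this
    push_cast at h2
    refine le_of_eq_of_le ?_ h2
    congr!

end Five8


namespace Five8

open Finset

/-! ### no violations -/

/-- edge positions inside a set of vertex positions -/
def edg (A : Finset (Fin 6)) : Finset (Fin 7) := univ.filter (fun τ => eA τ ∈ A ∧ eB τ ∈ A)
/-- colours inside a set of vertex positions -/
def cols (A : Finset (Fin 6)) : Finset (Fin 3) := (edg A).image eC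

set_option maxRecDepth 100000 in
lemma fact0 : ∀ A : Finset (Fin 6), A.card ≤ 5 → (edg A).Nonempty →
    (edg A).card + 2 ≤ A.card + (cols A).card ∧ (edg A).card ≤ (cols A).card + 2 := by
  decide +kernel

/-- tight position sets -/
def Tight (A : Finset (Fin 6)) : Prop := A.card ≤ 5 ∧ (edg A).Nonempty ∧
    (edg A).card + 2 = A.card + (cols A).card

instance : DecidablePred Tight := fun A => by unfold Tight; infer_instance

lemma fact1 : ∀ A : Finset (Fin 6), Tight A → ∀ p ∈ A, ∀ q ∈ A, p ≠ q →
    (∃ τ, (eA τ = p ∧ eB τ = q) ∨ (eA τ = q ∧ eB τ = p)) ∨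
      ((cols A).card + 2 ≤ (edg A).card ∧ (cI p = cI q ∨ cJ p = cJ q)) := by
  decide +kernel

lemma fact2 : ∀ A : Finset (Fin 6), Tight A → ∀ p ∈ A, ∀ r ∈ cols A,
    (∃ τ, iV τ = p ∧ iC τ = r) ∨ ((cols A).card + 2 ≤ (edg A).card ∧ cK p = cC r) := by
  decide +kernel

lemma fact3 : ∀ A : Finset (Fin 6), Tight A → ∀ r ∈ cols A, ∀ r' ∈ cols A, r ≠ r' →
    (cols A).card + 1 ≤ (edg A).card := by
  decide +kernel

variable {s m l : ℕ}

/-- compatibility of types of points -/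
def compat : Vx s m ⊕ Cl s l → Vx s m ⊕ Cl s l → Prop
  | Sum.inl α, Sum.inl β => α.1.1 ≠ β.1.1 ∧ α.1.2.1 ≠ β.1.2.1
  | Sum.inl α, Sum.inr γ => α.1.2.2 ≠ γ.1
  | Sum.inr γ, Sum.inl α => α.1.2.2 ≠ γ.1
  | Sum.inr _, Sum.inr _ => True

lemma pair_state (g : Gad s m l) (A : Finset (Fin 6)) (hA : Tight A) (u v : Fin 6 ⊕ Fin 3)
    (huv : u ≠ v) (hu : u ∈ A.disjSum (cols A)) (hv : v ∈ A.disjSum (cols A)) :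
    ({pt g u, pt g v} ∈ (des s m l).items g ∧ compat (pt g u) (pt g v)) ∨
    ((cols A).card + 2 ≤ (edg A).card ∧ ¬ compat (pt g u) (pt g v)) ∨
    ((∃ γ, pt g u = Sum.inr γ) ∧ (∃ γ, pt g v = Sum.inr γ) ∧ (cols A).card + 1 ≤ (edg A).card) := by
  classical
  rcases u with p | r <;> rcases v with q | r'
  · rw [Finset.inl_mem_disjSum] at hu hv
    have hpq : p ≠ q := fun h => huv (by rw [h])
    rcases fact1 A hA p hu q hv hpq with ⟨τ, hτ⟩ | ⟨h1, h2⟩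
    · left
      refine ⟨?_, ?_⟩
      · rw [mem_des_items]
        left
        refine ⟨τ, ?_⟩
        rcases hτ with ⟨rfl, rfl⟩ | ⟨rfl, rfl⟩
        · rfl
        · exact Finset.pair_comm _ _
      · rcases hτ with ⟨rfl, rfl⟩ | ⟨rfl, rfl⟩
        · exact ⟨fun h => eI_ne τ (g.1.injective h), fun h => eJ_ne τ (g.2.1.injective h)⟩
        · exact ⟨fun h => eI_ne τ (g.1.injective h.symm), fun h => eJ_ne τ (g.2.1.injective h.symm)⟩
    · right; left
      refine ⟨h1, ?_⟩
      rintro ⟨h3, h4⟩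
      rcases h2 with h2 | h2
      · exact h3 (congrArg g.1 h2)
      · exact h4 (congrArg g.2.1 h2)
  · rw [Finset.inl_mem_disjSum] at hu
    rw [Finset.inr_mem_disjSum] at hv
    rcases fact2 A hA p hu r' hv with ⟨τ, rfl, rfl⟩ | ⟨h1, h2⟩
    · left
      refine ⟨?_, ?_⟩
      · rw [mem_des_items]
        exact Or.inr ⟨τ, rfl⟩
      · exact fun h => iK_ne τ (g.2.2.1.injective h)
    · right; left
      exact ⟨h1, fun h => h (congrArg g.2.2.1 h2)⟩
  · rw [Finset.inl_mem_disjSum] at hv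
    rw [Finset.inr_mem_disjSum] at hu
    rcases fact2 A hA q hv r hu with ⟨τ, rfl, rfl⟩ | ⟨h1, h2⟩
    · left
      refine ⟨?_, ?_⟩
      · rw [mem_des_items]
        exact Or.inr ⟨τ, Finset.pair_comm _ _⟩
      · exact fun h => iK_ne τ (g.2.2.1.injective h)
    · right; left
      exact ⟨h1, fun h => h (congrArg g.2.2.1 h2)⟩
  · rw [Finset.inr_mem_disjSum] at hu hv
    right; right
    exact ⟨⟨_, rfl⟩, ⟨_, rfl⟩, fact3 A hA r hu r' hv (fun h => huv (by rw [h]))⟩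

/-- double counting -/
lemma multi_count {G B : Type} [DecidableEq G] [DecidableEq B] (Γ : Finset G) (C : G → Finset B) :
    ∃ X : Finset B, X ⊆ Γ.biUnion C ∧ (∀ γ ∈ X, 2 ≤ (Γ.filter (fun g => γ ∈ C g)).card) ∧
      (∑ g ∈ Γ, (C g).card) + X.card = (Γ.biUnion C).card + ∑ g ∈ Γ, (C g ∩ X).card ∧
      2 * X.card ≤ ∑ g ∈ Γ, (C g ∩ X).card := by
  classical
  set U := Γ.biUnion C with hU
  set X := U.filter (fun γ => 2 ≤ (Γ.filter (fun g => γ ∈ C g)).card) with hX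
  have key : ∀ T : Finset B, ∑ g ∈ Γ, (C g ∩ T).card = ∑ γ ∈ T, (Γ.filter (fun g => γ ∈ C g)).card := by
    intro T
    have := Finset.sum_card_bipartiteAbove_eq_sum_card_bipartiteBelow (s := Γ) (t := T)
      (fun g γ => γ ∈ C g)
    refine Eq.trans ?_ this
    refine Finset.sum_congr rfl (fun g _ => ?_)
    congr 1
    ext γ
    simp [Finset.bipartiteAbove, and_comm]
  have hXU : X ⊆ U := Finset.filter_subset _ _
  have hX2 : ∀ γ ∈ X, 2 ≤ (Γ.filter (fun g => γ ∈ C g)).card := fun γ h => (Finset.mem_filter.1 h).2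
  refine ⟨X, hXU, hX2, ?_, ?_⟩
  · have h1 : ∑ g ∈ Γ, (C g).card = ∑ g ∈ Γ, (C g ∩ U).card := by
      refine Finset.sum_congr rfl (fun g hg => ?_)
      rw [Finset.inter_eq_left.2 (Finset.subset_biUnion_of_mem C hg)]
    rw [h1, key, key, ← Finset.sum_sdiff hXU]
    have h2 : ∑ γ ∈ U \ X, (Γ.filter (fun g => γ ∈ C g)).card = (U \ X).card := by
      rw [Finset.card_eq_sum_ones]
      refine Finset.sum_congr rfl (fun γ hγ => ?_)
      rw [Finset.mem_sdiff] at hγ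
      obtain ⟨h3, h4⟩ := hγ
      have h5 : ¬ 2 ≤ (Γ.filter (fun g => γ ∈ C g)).card := fun h => h4 (Finset.mem_filter.2 ⟨h3, h⟩)
      rw [hU, Finset.mem_biUnion] at h3
      obtain ⟨g, hg, hgγ⟩ := h3
      have : 0 < (Γ.filter (fun g => γ ∈ C g)).card :=
        Finset.card_pos.2 ⟨g, Finset.mem_filter.2 ⟨hg, hgγ⟩⟩
      omega
    rw [h2]
    have := Finset.card_sdiff_add_card_eq_card hXU
    omega
  · rw [key, mul_comm, ← smul_eq_mul]
    exact Finset.card_nsmul_le_sum _ _ _ hX2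

lemma card_biUnion_lt' {G B : Type} [DecidableEq G] [DecidableEq B] (Γ : Finset G) (W : G → Finset B)
    {g g' : G} (hg : g ∈ Γ) (hg' : g' ∈ Γ) (hne : g ≠ g') {x : B} (hx : x ∈ W g) (hx' : x ∈ W g') :
    (Γ.biUnion W).card + 1 ≤ ∑ g ∈ Γ, (W g).card := by
  classical
  have h1 : Γ.biUnion W ⊆ (Γ.erase g).biUnion W ∪ (W g).erase x := by
    intro y hy
    obtain ⟨k, hk, hyk⟩ := Finset.mem_biUnion.1 hy
    rw [Finset.mem_union]
    by_cases hkg : k = g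
    · by_cases hyx : y = x
      · left
        exact Finset.mem_biUnion.2 ⟨g', Finset.mem_erase.2 ⟨hne.symm, hg'⟩, hyx ▸ hx'⟩
      · right
        exact Finset.mem_erase.2 ⟨hyx, hkg ▸ hyk⟩
    · left
      exact Finset.mem_biUnion.2 ⟨k, Finset.mem_erase.2 ⟨hkg, hk⟩, hyk⟩
  have h2 := (Finset.card_le_card h1).trans (Finset.card_union_le _ _)
  have h3 : ((Γ.erase g).biUnion W).card ≤ ∑ g ∈ Γ.erase g, (W g).card := Finset.card_biUnion_le
  have h4 := Finset.card_erase_add_one hx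
  have h5 := Finset.add_sum_erase Γ (fun g => (W g).card) hg
  omega

/-- positions of a gadget in a vertex set -/
def pos (S : Finset (Vx s m)) (g : Gad s m l) : Finset (Fin 6) := univ.filter (fun p => vert g p ∈ S)

lemma pos_card_le (S : Finset (Vx s m)) (g : Gad s m l) : (pos S g).card ≤ S.card := by
  apply Finset.card_le_card_of_injOn (vert g)
  · intro p hp
    exact (Finset.mem_filter.1 hp).2
  · exact (vert_inj g).injOn

lemma mem_edg_pos (S : Finset (Vx s m)) (g : Gad s m l) (τ : Fin 7) :
    τ ∈ edg (pos S g) ↔ vert g (eA τ) ∈ S ∧ vert g (eB τ) ∈ S := by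
  simp [edg, pos]

lemma supp_sdiff_card (S : Finset (Vx s m)) (X : Finset (Cl s l)) (g : Gad s m l) :
    ((des s m l).supp g \ S.disjSum X).card + (pos S g).card +
      (univ.filter (fun r => col g r ∈ X)).card = 9 := by
  classical
  have h1 : (des s m l).supp g ∩ S.disjSum X =
      ((pos S g).disjSum (univ.filter (fun r => col g r ∈ X))).image (pt g) := by
    ext x
    simp only [Finset.mem_inter, mem_des_supp, Finset.mem_image]
    constructor
    · rintro ⟨⟨q, rfl⟩, hq⟩
      refine ⟨q, ?_, rfl⟩
      rcases q with p | r
      · simpa [pt, pos] using hq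
      · simpa [pt] using hq
    · rintro ⟨q, hq, rfl⟩
      refine ⟨⟨q, rfl⟩, ?_⟩
      rcases q with p | r
      · simpa [pt, pos] using hq
      · simpa [pt] using hq
  have h2 := Finset.card_sdiff_add_card_inter ((des s m l).supp g) (S.disjSum X)
  rw [h1, Finset.card_image_of_injective _ (pt_inj g), Finset.card_disjSum, (des s m l).card_supp] at h2
  omega

end Five8


namespace Five8

open Finset

variable {s m l : ℕ}

lemma edge_unique {M : Finset (Gad s m l)} (hM : (des s m l).Good M) {g g' : Gad s m l}
    (hg : g ∈ M) (hg' : g' ∈ M) {τ τ' : Fin 7} (h : eItem g τ = eItem g' τ') : g = g' := by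
  by_contra hne
  exact hM.1 g hg g' hg' hne _ (mem_des_items.2 (Or.inl ⟨τ, rfl⟩))
    (h ▸ mem_des_items.2 (Or.inl ⟨τ', rfl⟩))

lemma gamma_card_le {M : Finset (Gad s m l)} (hM : (des s m l).Good M) (S : Finset (Vx s m))
    (hS : S.card ≤ 5) (Γ : Finset (Gad s m l)) (hΓ : Γ ⊆ M)
    (hE : ∀ g ∈ Γ, (edg (pos S g)).Nonempty) : Γ.card ≤ 10 := by
  classical
  choose! τ hτ using hE
  have h1 : Γ.card ≤ ((S.image Sum.inl : Finset (Vx s m ⊕ Cl s l)).powersetCard 2).card := by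
    apply Finset.card_le_card_of_injOn (fun g => eItem g (τ g))
    · intro g hg
      have h2 := (mem_edg_pos S g _).1 (hτ g hg)
      refine Finset.mem_coe.2 (Finset.mem_powersetCard.2 ⟨?_, ?_⟩)
      · intro x hx
        simp only [eItem, Finset.mem_insert, Finset.mem_singleton] at hx
        rcases hx with rfl | rfl
        · exact Finset.mem_image_of_mem _ h2.1
        · exact Finset.mem_image_of_mem _ h2.2
      · exact (des s m l).item_card g _ (mem_des_items.2 (Or.inl ⟨_, rfl⟩))
    · intro g hg g' hg' h
      exact edge_unique hM (hΓ hg) (hΓ hg') h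
  rw [Finset.card_powersetCard, Finset.card_image_of_injective _ Sum.inl_injective] at h1
  exact h1.trans ((Nat.choose_le_choose 2 hS).trans (by decide))

set_option maxHeartbeats 1000000 in
lemma no_violation_gad {M : Finset (Gad s m l)} (hM : (des s m l).Good M) (S : Finset (Vx s m))
    (hS : S.card ≤ 5) (Γ : Finset (Gad s m l)) (hΓ : Γ ⊆ M)
    (hE : ∀ g ∈ Γ, (edg (pos S g)).Nonempty) :
    ∑ g ∈ Γ, (edg (pos S g)).card ≤
      (Γ.biUnion (fun g => (cols (pos S g)).image (col g))).card + 2 := by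
  classical
  by_contra hcon
  push Not at hcon
  obtain ⟨X, hXU, hX2, hX3, hX4⟩ := multi_count Γ (fun g => (cols (pos S g)).image (col g))
  set U := Γ.biUnion (fun g => (cols (pos S g)).image (col g)) with hU
  have hΓ10 := gamma_card_le hM S hS Γ hΓ hE
  have hA5 : ∀ g : Gad s m l, (pos S g).card ≤ 5 := fun g => (pos_card_le S g).trans hS
  have hcc : ∀ g : Gad s m l, ((cols (pos S g)).image (col g)).card = (cols (pos S g)).card := fun g =>
    Finset.card_image_of_injective _ (col_inj g)
  simp only [hcc] at hX3
  have hce : ∀ g : Gad s m l, (cols (pos S g)).card ≤ (edg (pos S g)).card := fun g =>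
    Finset.card_image_le
  -- at least two gadgets
  have hΓ2 : 2 ≤ Γ.card := by
    by_contra hlt
    have hXe : X = ∅ := by
      rw [Finset.eq_empty_iff_forall_notMem]
      intro γ hγ
      have := hX2 γ hγ
      have h3 := Finset.card_filter_le Γ (fun g => γ ∈ (cols (pos S g)).image (col g))
      omega
    have h1 : ∑ g ∈ Γ, (edg (pos S g)).card ≤ ∑ g ∈ Γ, ((cols (pos S g)).card + 2) :=
      Finset.sum_le_sum (fun g hg => (fact0 _ (hA5 g) (hE g hg)).2)
    rw [Finset.sum_add_distrib, Finset.sum_const, smul_eq_mul] at h1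
    rw [hXe] at hX3
    simp only [Finset.inter_empty, Finset.card_empty, Finset.sum_const_zero] at hX3
    omega
  -- the defects
  set K : Gad s m l → Finset (Fin 3) := fun g => univ.filter (fun r => col g r ∈ X) with hK
  have hκ : ∀ g : Gad s m l, ((cols (pos S g)).image (col g) ∩ X) =
      ((cols (pos S g)) ∩ K g).image (col g) := by
    intro g
    ext γ
    simp only [Finset.mem_inter, Finset.mem_image, hK, Finset.mem_filter, Finset.mem_univ, true_and]
    constructor
    · rintro ⟨⟨r, hr, rfl⟩, h⟩; exact ⟨r, ⟨hr, h⟩, rfl⟩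
    · rintro ⟨r, ⟨hr, h⟩, rfl⟩; exact ⟨⟨r, hr, rfl⟩, h⟩
  have hκc : ∀ g : Gad s m l, ((cols (pos S g)).image (col g) ∩ X).card =
      (cols (pos S g) ∩ K g).card := fun g => by
    rw [hκ, Finset.card_image_of_injective _ (col_inj g)]
  simp only [hκc] at hX3 hX4
  set Y := S.disjSum X with hY
  have hYc : Y.card = S.card + X.card := Finset.card_disjSum _ _
  have hdef : ∀ g ∈ Γ, ∃ d1 d2 : ℕ, (pos S g).card + (cols (pos S g)).card = (edg (pos S g)).card + 2 + d1 ∧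
      (K g).card = (cols (pos S g) ∩ K g).card + d2 := by
    intro g hg
    obtain ⟨d1, h1⟩ := Nat.exists_eq_add_of_le (fact0 _ (hA5 g) (hE g hg)).1
    obtain ⟨d2, h2⟩ := Nat.exists_eq_add_of_le (Finset.card_le_card
      (Finset.inter_subset_right : cols (pos S g) ∩ K g ⊆ K g))
    exact ⟨d1, d2, h1, h2⟩
  choose! d1 d2 hd1 hd2 using hdef
  have hw : ∀ g ∈ Γ, ((des s m l).supp g \ Y).card + d1 g + d2 g + (edg (pos S g)).card +
      (cols (pos S g) ∩ K g).card = 7 + (cols (pos S g)).card := by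
    intro g hg
    have h1 := hd1 g hg
    have h2 := hd2 g hg
    have h3 := supp_sdiff_card S X g
    simp only [hK, hY] at *
    omega
  have hsum := Finset.sum_congr (rfl : Γ = Γ) hw
  simp only [Finset.sum_add_distrib, Finset.sum_const, smul_eq_mul] at hsum
  have hsp : ((des s m l).sp Γ).card ≤ Y.card + (Γ.biUnion (fun g => (des s m l).supp g \ Y)).card := by
    refine (Finset.card_le_card ?_).trans (Finset.card_union_le _ _)
    intro x hx
    obtain ⟨g, hg, hxg⟩ := Finset.mem_biUnion.1 hx
    rw [Finset.mem_union]
    by_cases hxY : x ∈ Y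
    · exact Or.inl hxY
    · exact Or.inr (Finset.mem_biUnion.2 ⟨g, hg, Finset.mem_sdiff.2 ⟨hxg, hxY⟩⟩)
  have hbu : (Γ.biUnion (fun g => (des s m l).supp g \ Y)).card ≤
      ∑ g ∈ Γ, ((des s m l).supp g \ Y).card := Finset.card_biUnion_le
  obtain ⟨heq, g, hg, g', hg', hne, h2⟩ := hM.2 Γ hΓ hΓ2 hΓ10 (by omega)
  have z1 : ∑ g ∈ Γ, d1 g = 0 := by omega
  have z2 : ∑ g ∈ Γ, d2 g = 0 := by omega
  have z3 : ∑ g ∈ Γ, (edg (pos S g)).card = U.card + 3 := by omega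
  have z4 : (Γ.biUnion (fun g => (des s m l).supp g \ Y)).card =
      ∑ g ∈ Γ, ((des s m l).supp g \ Y).card := by omega
  rw [Finset.sum_eq_zero_iff] at z1 z2
  have hT : ∀ g ∈ Γ, Tight (pos S g) := fun g hg => ⟨hA5 g, hE g hg, by
    have := hd1 g hg; have := z1 g hg; omega⟩
  have hKs : ∀ g ∈ Γ, K g ⊆ cols (pos S g) := by
    intro g hg
    have h3 : cols (pos S g) ∩ K g = K g := Finset.eq_of_subset_of_card_le Finset.inter_subset_right (by
      have := hd2 g hg; have := z2 g hg; omega)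
    rw [← h3]; exact Finset.inter_subset_left
  obtain ⟨x, y, hxy, hxyE⟩ := Finset.card_eq_two.1 h2
  have hmem : ∀ z ∈ (des s m l).supp g ∩ (des s m l).supp g', z ∈ Y := by
    intro z hz
    rw [Finset.mem_inter] at hz
    by_contra hzY
    have := card_biUnion_lt' Γ (fun g => (des s m l).supp g \ Y) hg hg' hne
      (Finset.mem_sdiff.2 ⟨hz.1, hzY⟩) (Finset.mem_sdiff.2 ⟨hz.2, hzY⟩)
    omega
  have hx : x ∈ (des s m l).supp g ∩ (des s m l).supp g' := by rw [hxyE]; simp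
  have hy : y ∈ (des s m l).supp g ∩ (des s m l).supp g' := by rw [hxyE]; simp
  have hposn : ∀ k ∈ Γ, ∀ z ∈ (des s m l).supp k, z ∈ Y → ∃ u ∈ (pos S k).disjSum (cols (pos S k)),
      pt k u = z := by
    intro k hk z hz hzY
    obtain ⟨u, rfl⟩ := mem_des_supp.1 hz
    refine ⟨u, ?_, rfl⟩
    rcases u with p | r
    · rw [Finset.inl_mem_disjSum]
      have : vert k p ∈ S := by simpa [pt, hY] using hzY
      simp [pos, this]
    · rw [Finset.inr_mem_disjSum]
      have : col k r ∈ X := by simpa [pt, hY] using hzY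
      exact hKs k hk (by simp [hK, this])
  have hst : ∀ k ∈ Γ, x ∈ (des s m l).supp k → y ∈ (des s m l).supp k →
      ({x, y} ∈ (des s m l).items k ∧ compat x y) ∨
      ((cols (pos S k)).card + 2 ≤ (edg (pos S k)).card ∧ ¬ compat x y) ∨
      ((∃ γ, x = Sum.inr γ) ∧ (∃ γ, y = Sum.inr γ) ∧
        (cols (pos S k)).card + 1 ≤ (edg (pos S k)).card) := by
    intro k hk hxk hyk
    obtain ⟨u, hu, hux⟩ := hposn k hk x hxk (hmem x hx)
    obtain ⟨v, hv, hvy⟩ := hposn k hk y hyk (hmem y hy)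
    have := pair_state k _ (hT k hk) u v (fun h => hxy (by rw [← hux, ← hvy, h])) hu hv
    rw [hux, hvy] at this
    exact this
  have hstg := hst g hg (Finset.mem_inter.1 hx).1 (Finset.mem_inter.1 hy).1
  have hstg' := hst g' hg' (Finset.mem_inter.1 hx).2 (Finset.mem_inter.1 hy).2
  -- total of the repetitions
  have htot : ∀ a : ℕ, (cols (pos S g)).card + a ≤ (edg (pos S g)).card →
      (cols (pos S g')).card + a ≤ (edg (pos S g')).card →
      ∑ k ∈ Γ, (cols (pos S k)).card + 2 * a ≤ ∑ k ∈ Γ, (edg (pos S k)).card := by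
    intro a ha ha'
    have hg'' : g' ∈ Γ.erase g := Finset.mem_erase.2 ⟨hne.symm, hg'⟩
    have e1 := Finset.add_sum_erase Γ (fun k => (cols (pos S k)).card) hg
    have e2 := Finset.add_sum_erase Γ (fun k => (edg (pos S k)).card) hg
    have e3 := Finset.add_sum_erase _ (fun k => (cols (pos S k)).card) hg''
    have e4 := Finset.add_sum_erase _ (fun k => (edg (pos S k)).card) hg''
    have e5 : ∑ k ∈ (Γ.erase g).erase g', (cols (pos S k)).card ≤
        ∑ k ∈ (Γ.erase g).erase g', (edg (pos S k)).card := Finset.sum_le_sum (fun k _ => hce k)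
    omega
  have hcc2 : (∃ γ, x = Sum.inr γ) → (∃ γ, y = Sum.inr γ) → 2 ≤ X.card ∧ compat x y := by
    rintro ⟨γ, rfl⟩ ⟨γ', rfl⟩
    have h3 := hmem _ hx
    have h4 := hmem _ hy
    rw [hY, Finset.inr_mem_disjSum] at h3 h4
    refine ⟨?_, trivial⟩
    have h5 : ({γ, γ'} : Finset (Cl s l)) ⊆ X := by
      intro z hz
      simp only [Finset.mem_insert, Finset.mem_singleton] at hz
      rcases hz with rfl | rfl <;> assumption
    have h6 := Finset.card_le_card h5
    rwa [Finset.card_pair (fun h => hxy (by rw [h]))] at h6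
  have hitem : ∀ k, {x, y} ∈ (des s m l).items k → ((∃ γ, x = Sum.inr γ) ∧ (∃ γ, y = Sum.inr γ)) → False := by
    rintro k hk ⟨⟨γ, rfl⟩, γ', rfl⟩
    rcases mem_des_items.1 hk with ⟨τ, h⟩ | ⟨τ, h⟩
    · have := pair_cases h
      simp at this
    · have := pair_cases h
      simp at this
  rcases hstg with ⟨a1, a2⟩ | ⟨a1, a2⟩ | ⟨a1, a2, a3⟩
  · rcases hstg' with ⟨b1, b2⟩ | ⟨b1, b2⟩ | ⟨b1, b2, b3⟩
    · exact hM.1 g (hΓ hg) g' (hΓ hg') hne _ a1 b1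
    · exact b2 a2
    · exact hitem g a1 ⟨b1, b2⟩
  · rcases hstg' with ⟨b1, b2⟩ | ⟨b1, b2⟩ | ⟨b1, b2, b3⟩
    · exact a2 b2
    · have := htot 2 a1 b1
      omega
    · exact a2 (hcc2 b1 b2).2
  · rcases hstg' with ⟨b1, b2⟩ | ⟨b1, b2⟩ | ⟨b1, b2, b3⟩
    · exact hitem g' b1 ⟨a1, a2⟩
    · exact b2 (hcc2 a1 a2).2
    · have := htot 1 a3 b3
      have := (hcc2 a1 a2).1
      omega

end Five8


namespace Five8

open Finset

variable {s m l : ℕ}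

/-- edges of gadgets inside a vertex set -/
noncomputable def inside (M : Finset (Gad s m l)) (S : Finset (Vx s m)) : Finset (Gad s m l × Fin 7) :=
  (M ×ˢ univ).filter (fun x => vert x.1 (eA x.2) ∈ S ∧ vert x.1 (eB x.2) ∈ S)

lemma no_violation {M : Finset (Gad s m l)} (hM : (des s m l).Good M) (S : Finset (Vx s m))
    (hS : S.card ≤ 5) :
    (inside M S).card ≤ ((inside M S).image (fun x => col x.1 (eC x.2))).card + 2 := by
  classical
  set Γ := M.filter (fun g => (edg (pos S g)).Nonempty) with hΓ
  have h := no_violation_gad hM S hS Γ (Finset.filter_subset _ _) (fun g hg => (Finset.mem_filter.1 hg).2)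
  have e1 : (inside M S).card = ∑ g ∈ Γ, (edg (pos S g)).card := by
    rw [Finset.card_eq_sum_card_fiberwise (s := inside M S) (t := Γ) (f := Prod.fst)]
    · refine Finset.sum_congr rfl (fun g hg => ?_)
      have : (inside M S).filter (fun x => x.1 = g) = (edg (pos S g)).image (fun τ => (g, τ)) := by
        ext ⟨g', τ⟩
        simp only [inside, Finset.mem_filter, Finset.mem_product, Finset.mem_univ, and_true,
          Finset.mem_image, mem_edg_pos, Prod.mk.injEq]
        constructor
        · rintro ⟨⟨_, h1⟩, rfl⟩
          exact ⟨τ, h1, rfl, rfl⟩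
        · rintro ⟨τ', h1, rfl, rfl⟩
          exact ⟨⟨(Finset.mem_filter.1 hg).1, h1⟩, rfl⟩
      rw [this, Finset.card_image_of_injective]
      intro a b hab
      exact (Prod.mk.inj hab).2
    · rintro ⟨g, τ⟩ hx
      have hx' := Finset.mem_filter.1 (Finset.mem_coe.1 hx)
      refine Finset.mem_coe.2 (Finset.mem_filter.2 ⟨(Finset.mem_product.1 hx'.1).1, τ, ?_⟩)
      exact (mem_edg_pos _ _ _).2 hx'.2
  have e2 : (inside M S).image (fun x => col x.1 (eC x.2)) =
      Γ.biUnion (fun g => (cols (pos S g)).image (col g)) := by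
    ext γ
    simp only [inside, cols, Finset.mem_image, Finset.mem_biUnion, Finset.mem_filter,
      Finset.mem_product, Finset.mem_univ, and_true, mem_edg_pos]
    constructor
    · rintro ⟨⟨g, τ⟩, ⟨h1, h2⟩, rfl⟩
      exact ⟨g, Finset.mem_filter.2 ⟨h1, τ, (mem_edg_pos _ _ _).2 h2⟩, eC τ, ⟨τ, h2, rfl⟩, rfl⟩
    · rintro ⟨g, hg, r, ⟨τ, h2, rfl⟩, rfl⟩
      exact ⟨(g, τ), ⟨(Finset.mem_filter.1 hg).1, h2⟩, rfl⟩
  rw [e1, e2]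
  exact h

lemma tau_unique : ∀ τ τ' : Fin 7, ((eA τ = eA τ' ∧ eB τ = eB τ') ∨ (eA τ = eB τ' ∧ eB τ = eA τ')) →
    τ = τ' := by decide

/-- edge of the complete graph -/
def edm {n : ℕ} (φ : Vx s m ↪ Fin n) (x : Gad s m l × Fin 7) : Sym2 (Fin n) :=
  s(φ (vert x.1 (eA x.2)), φ (vert x.1 (eB x.2)))

lemma edm_inj {n : ℕ} (φ : Vx s m ↪ Fin n) {M : Finset (Gad s m l)} (hM : (des s m l).Good M)
    {x y : Gad s m l × Fin 7} (hx : x.1 ∈ M) (hy : y.1 ∈ M) (h : edm φ x = edm φ y) : x = y := by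
  obtain ⟨g, τ⟩ := x
  obtain ⟨g', τ'⟩ := y
  simp only [edm, Sym2.eq_iff, EmbeddingLike.apply_eq_iff_eq] at h
  have hgg : g = g' := by
    apply edge_unique hM hx hy (τ := τ) (τ' := τ')
    rcases h with ⟨h1, h2⟩ | ⟨h1, h2⟩
    · simp only [eItem, h1, h2]
    · simp only [eItem, h1, h2]; exact Finset.pair_comm _ _
  subst hgg
  have := tau_unique τ τ' (by
    rcases h with ⟨h1, h2⟩ | ⟨h1, h2⟩
    · exact Or.inl ⟨vert_inj g h1, vert_inj g h2⟩
    · exact Or.inr ⟨vert_inj g h1, vert_inj g h2⟩)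
  rw [this]

lemma build {n k : ℕ} (φ : Vx s m ↪ Fin n) (ψ : Cl s l ≃ Fin k) {M : Finset (Gad s m l)}
    (hM : (des s m l).Good M) :
    ∃ (E₀ : Finset (Sym2 (Fin n))) (c : Sym2 (Fin n) → Option (Fin k)),
      (∀ e ∈ E₀, ¬ e.IsDiag) ∧ E₀.card = 7 * M.card ∧
      (∀ e : Sym2 (Fin n), (c e).isSome ↔ e ∈ E₀) ∧
      ∀ S : Finset (Fin n), S.card = 5 →
        ({e : Sym2 (Fin n) | e ∈ S.sym2 ∧ ¬ e.IsDiag ∧ (c e).isSome}).ncard ≤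
          (c '' {e : Sym2 (Fin n) | e ∈ S.sym2 ∧ ¬ e.IsDiag ∧ (c e).isSome}).ncard + 2 := by
  classical
  set c : Sym2 (Fin n) → Option (Fin k) := fun e =>
    if h : ∃ x : Gad s m l × Fin 7, x.1 ∈ M ∧ edm φ x = e then
      some (ψ (col h.choose.1 (eC h.choose.2))) else none with hc
  have hc1 : ∀ x : Gad s m l × Fin 7, x.1 ∈ M → c (edm φ x) = some (ψ (col x.1 (eC x.2))) := by
    intro x hx
    have h : ∃ y : Gad s m l × Fin 7, y.1 ∈ M ∧ edm φ y = edm φ x := ⟨x, hx, rfl⟩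
    have h2 : h.choose = x := edm_inj φ hM h.choose_spec.1 hx h.choose_spec.2
    simp only [hc]
    rw [dif_pos h, h2]
  have hc2 : ∀ e, (c e).isSome ↔ ∃ x : Gad s m l × Fin 7, x.1 ∈ M ∧ edm φ x = e := by
    intro e
    simp only [hc]
    split_ifs with h
    · simpa using h
    · simpa using h
  have hdiag : ∀ x : Gad s m l × Fin 7, ¬ (edm φ x).IsDiag := by
    intro x h
    simp only [edm, Sym2.mk_isDiag_iff, EmbeddingLike.apply_eq_iff_eq] at h
    exact eAB_ne _ (vert_inj _ h)
  refine ⟨(M ×ˢ univ).image (edm φ), c, ?_, ?_, ?_, ?_⟩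
  · intro e he
    obtain ⟨x, hx, rfl⟩ := Finset.mem_image.1 he
    exact hdiag x
  · rw [Finset.card_image_of_injOn, Finset.card_product]
    · simp [mul_comm]
    · intro x hx y hy h
      exact edm_inj φ hM (Finset.mem_product.1 hx).1 (Finset.mem_product.1 hy).1 h
  · intro e
    rw [hc2]
    simp only [Finset.mem_image, Finset.mem_product, Finset.mem_univ, and_true]
  · intro S hS
    set S' : Finset (Vx s m) := univ.filter (fun v => φ v ∈ S) with hS'
    have hS5 : S'.card ≤ 5 := by
      rw [← hS]
      apply Finset.card_le_card_of_injOn φ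
      · intro v hv; exact (Finset.mem_filter.1 hv).2
      · exact φ.injective.injOn
    have h1 : {e : Sym2 (Fin n) | e ∈ S.sym2 ∧ ¬ e.IsDiag ∧ (c e).isSome} =
        (((inside M S').image (edm φ) : Finset _) : Set (Sym2 (Fin n))) := by
      ext e
      rw [Set.mem_ofPred_eq, Finset.mem_coe, Finset.mem_image, hc2]
      constructor
      · rintro ⟨he, _, x, hx, rfl⟩
        refine ⟨x, Finset.mem_filter.2 ⟨by simp [hx], ?_⟩, rfl⟩
        simp only [edm, Finset.mk_mem_sym2_iff] at he
        simpa [hS'] using he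
      · rintro ⟨x, hx, rfl⟩
        have hx' := Finset.mem_filter.1 hx
        refine ⟨?_, hdiag x, x, (Finset.mem_product.1 hx'.1).1, rfl⟩
        simp only [edm, Finset.mk_mem_sym2_iff]
        simpa [hS'] using hx'.2
    have hin : ∀ x ∈ inside M S', x.1 ∈ M := fun x hx =>
      (Finset.mem_product.1 (Finset.mem_filter.1 hx).1).1
    have h2 : c '' (((inside M S').image (edm φ) : Finset _) : Set (Sym2 (Fin n))) =
        ((((inside M S').image (fun x => col x.1 (eC x.2))).image (fun γ => some (ψ γ)) : Finset _) :
          Set (Option (Fin k))) := by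
      rw [← Finset.coe_image, Finset.image_image, Finset.image_image]
      congr 1
      exact Finset.image_congr (fun x hx => hc1 x (hin x hx))
    rw [h1, h2, Set.ncard_coe_finset, Set.ncard_coe_finset, Finset.card_image_of_injOn,
      Finset.card_image_of_injective]
    · exact no_violation hM S' hS5
    · intro a b hab
      exact ψ.injective (Option.some_injective _ hab)
    · intro x hx y hy h
      exact edm_inj φ hM (hin x hx) (hin y hy) h

lemma sq_aux {y n b : ℝ} (hy : 0 ≤ y) (h1 : y ≤ n) (h2 : n ≤ y + b) : n ^ 2 - 2 * b * n ≤ y ^ 2 := by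
  have h3 : 0 ≤ (n + y) * (y + b - n) := mul_nonneg (by linarith) (by linarith)
  have h4 : 0 ≤ b * (n - y) := mul_nonneg (by linarith) (by linarith)
  nlinarith

set_option maxHeartbeats 1000000 in
lemma main (ε : ℝ) (hε : 0 < ε) : ∃ N : ℕ, ∀ n : ℕ, N ≤ n →
      ∃ (E₀ : Finset (Sym2 (Fin n))) (k : ℕ) (c : Sym2 (Fin n) → Option (Fin k)),
        (∀ e ∈ E₀, ¬ e.IsDiag) ∧
        ((n.choose 2 : ℝ) - ε * (n : ℝ) ^ 2 ≤ (E₀.card : ℝ)) ∧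
        ((k : ℝ) ≤ (6 / 7 + ε) * n) ∧
        (∀ e : Sym2 (Fin n), (c e).isSome ↔ e ∈ E₀) ∧
        ∀ S : Finset (Fin n), S.card = 5 →
        ({e : Sym2 (Fin n) | e ∈ S.sym2 ∧ ¬ e.IsDiag ∧ (c e).isSome}).ncard ≤
          (c '' {e : Sym2 (Fin n) | e ∈ S.sym2 ∧ ¬ e.IsDiag ∧ (c e).isSome}).ncard + 2 := by
  obtain ⟨s₀, hs₀⟩ := exists_nat_gt (6 / ε)
  obtain ⟨s, hs7, hsε⟩ : ∃ s : ℕ, 7 ≤ s ∧ 6 / ε ≤ (s : ℝ) :=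
    ⟨max 7 s₀, le_max_left _ _, hs₀.le.trans (by exact_mod_cast le_max_right _ _)⟩
  set η : ℝ := min (ε / 8) (1 / 8) with hη
  have hη0 : 0 < η := by rw [hη]; positivity
  have hη1 : η ≤ 1 / 8 := min_le_right _ _
  have hηε : η ≤ ε / 8 := min_le_left _ _
  obtain ⟨T, hT⟩ := des_matching η hη0 (by linarith) s hs7
  obtain ⟨N₁, hN₁⟩ := exists_nat_gt (14 * (s : ℝ) ^ 3 / ε)
  have hs0 : (0 : ℝ) < (s : ℝ) := by exact_mod_cast (by omega : 0 < s)
  have hq0 : 0 < 7 * s ^ 3 := by positivity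
  refine ⟨max (7 * s ^ 3 * T) (max N₁ 1), fun n hn => ?_⟩
  have hnT : 7 * s ^ 3 * T ≤ n := (le_max_left _ _).trans hn
  have hn1 : N₁ ≤ n := (le_max_left _ _).trans ((le_max_right _ _).trans hn)
  set t := n / (7 * s ^ 3) with ht
  have htT : T ≤ t := by
    rw [ht, Nat.le_div_iff_mul_le hq0]; linarith
  obtain ⟨M, hM, hMc⟩ := hT t htT
  have hlo : 7 * s ^ 3 * t ≤ n := Nat.mul_div_le _ _
  have hhi : n < 7 * s ^ 3 * t + 7 * s ^ 3 := by
    have := Nat.lt_mul_div_succ n hq0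
    rw [← ht] at this; linarith
  have hφ : Nonempty (Vx s (7 * t) ↪ Fin n) := by
    apply Function.Embedding.nonempty_of_card_le
    simp only [Fintype.card_prod, Fintype.card_fin]
    calc _ = 7 * s ^ 3 * t := by ring
      _ ≤ n := hlo
  obtain ⟨φ⟩ := hφ
  have ψ : Cl s (6 * (s - 1) ^ 2 * t) ≃ Fin (s * (6 * (s - 1) ^ 2 * t)) := finProdFinEquiv
  obtain ⟨E₀, c, h1, h2, h3, h4⟩ := build φ ψ hM
  refine ⟨E₀, _, c, h1, ?_, ?_, h3, h4⟩
  · rw [h2]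
    have hn' : (0 : ℝ) ≤ (n : ℝ) := Nat.cast_nonneg n
    have hloR : 7 * (s : ℝ) ^ 3 * t ≤ n := by exact_mod_cast hlo
    have hhiR : (n : ℝ) ≤ 7 * (s : ℝ) ^ 3 * t + 7 * (s : ℝ) ^ 3 := by exact_mod_cast hhi.le
    have hs1 : ((s - 1 : ℕ) : ℝ) = (s : ℝ) - 1 := by
      rw [Nat.cast_sub (by omega)]; simp
    have hR : (R1 s (7 * t) : ℝ) = (1 - 1 / (s : ℝ)) ^ 3 * (7 * (s : ℝ) ^ 3 * t) ^ 2 := by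
      simp only [R1]; push_cast; rw [hs1]; field_simp
    set y : ℝ := 7 * (s : ℝ) ^ 3 * t with hy
    have hy0 : 0 ≤ y := by rw [hy]; positivity
    have hB : ∃ B : ℝ, B = 1 / (s : ℝ) ∧ 0 ≤ B ∧ B ≤ ε / 6 ∧ B ≤ 1 := by
      refine ⟨_, rfl, by positivity, ?_, ?_⟩
      · rw [div_le_iff₀ hε] at hsε
        rw [div_le_iff₀ hs0]; linarith
      · rw [div_le_iff₀ hs0]
        have : (7 : ℝ) ≤ s := by exact_mod_cast hs7
        linarith
    obtain ⟨B, hBe, hB0, hBε, hB1⟩ := hB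
    rw [← hBe] at hR
    have hB3 : 1 - 3 * B ≤ (1 - B) ^ 3 := by nlinarith [mul_nonneg hB0 hB0, mul_nonneg (mul_nonneg hB0 hB0) (sub_nonneg.2 hB1)]
    have hprod : 1 - ε ≤ (1 - 4 * η) * (1 - B) ^ 3 := by
      have h5 : (1 - 4 * η) * (1 - 3 * B) ≤ (1 - 4 * η) * (1 - B) ^ 3 :=
        mul_le_mul_of_nonneg_left hB3 (by linarith)
      nlinarith [mul_nonneg hη0.le hB0]
    have h14 : (1 - ε) * y ^ 2 ≤ 14 * (M.card : ℝ) := by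
      refine le_trans ?_ hMc
      rw [hR, ← mul_assoc]
      exact mul_le_mul_of_nonneg_right hprod (sq_nonneg y)
    have hch : (n.choose 2 : ℝ) ≤ (n : ℝ) ^ 2 / 2 := by
      rw [Nat.cast_choose_two]; nlinarith
    have hz : 14 * (s : ℝ) ^ 3 * n ≤ ε * n ^ 2 := by
      have : 14 * (s : ℝ) ^ 3 / ε ≤ n := hN₁.le.trans (by exact_mod_cast hn1)
      rw [div_le_iff₀ hε] at this
      nlinarith
    have hyn : (n : ℝ) ^ 2 - ε * n ^ 2 ≤ y ^ 2 := by
      have := sq_aux hy0 hloR hhiR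
      linarith
    have hyn2 : y ^ 2 ≤ (n : ℝ) ^ 2 := pow_le_pow_left₀ hy0 hloR 2
    have : ε * y ^ 2 ≤ ε * n ^ 2 := mul_le_mul_of_nonneg_left hyn2 hε.le
    push_cast
    linarith
  · have h5 : s * (6 * (s - 1) ^ 2 * t) ≤ 6 * s ^ 3 * t := by
      have : (s - 1) ^ 2 ≤ s ^ 2 := Nat.pow_le_pow_left (by omega) 2
      calc _ = 6 * s * t * (s - 1) ^ 2 := by ring
        _ ≤ 6 * s * t * s ^ 2 := Nat.mul_le_mul_left _ this
        _ = _ := by ring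
    have h6 : ((s * (6 * (s - 1) ^ 2 * t) : ℕ) : ℝ) ≤ 6 * (s : ℝ) ^ 3 * t := by exact_mod_cast h5
    have hloR : 7 * (s : ℝ) ^ 3 * t ≤ n := by exact_mod_cast hlo
    have hn' : (0 : ℝ) ≤ ε * (n : ℝ) := by positivity
    linarith

end Five8

/-- For every `ε > 0` and all sufficiently large `n`, there is a partial
`(5,8)`-coloring of `K_n` coloring all but at most `ε·n²` of the `C(n,2)` edges
and using at most `(6/7 + ε)n` colors. -/
theorem exists_partial_five_eight_coloring :
    ∀ ε : ℝ, 0 < ε → ∃ N : ℕ, ∀ n : ℕ, N ≤ n →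
      ∃ (E₀ : Finset (Sym2 (Fin n))) (k : ℕ) (c : Sym2 (Fin n) → Option (Fin k)),
        (∀ e ∈ E₀, ¬ e.IsDiag) ∧
        ((n.choose 2 : ℝ) - ε * (n : ℝ) ^ 2 ≤ (E₀.card : ℝ)) ∧
        ((k : ℝ) ≤ (6 / 7 + ε) * n) ∧
        (∀ e : Sym2 (Fin n), (c e).isSome ↔ e ∈ E₀) ∧
        NoViolation58 c := by
  intro ε hε
  exact Five8.main ε hε
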